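/- arXiv:2109.02180 — 2 statements merged into one kernel-verified Lean document; each statement's English description precedes it below -/
import Mathlib

section
/- Let $(X,\sigma_X)$, $(Y,\sigma_Y)$ be one-sided subshifts, $\pi: X\to Y$ a one-block factor map, $f \in C(X)$ and $h \in C(Y)$. If $\int P(\sigma_X,\pi,f)\,dm = \int h\,dm$ for every $m \in M(Y,\sigma_Y)$, then $f - h\circ\pi$ is a compensation function for $\pi$, i.e. $\sup_{\mu\in M(X,\sigma_X)}\{h_\mu(\sigma_X)+\int(f - h\circ\pi)\,d\mu + \int\phi\circ\pi\,d\mu\} = \sup_{\nu\in M(Y,\sigma_Y)}\{h_\nu(\sigma_Y)+\int\phi\,d\nu\}$ for every $\phi\in C(Y)$. -/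
open Filter Topology MeasureTheory

/-- The shift map on the full one-sided shift on `k` symbols. -/
def shiftMap {k : ℕ} : (ℕ → Fin k) → (ℕ → Fin k) := fun x n => x (n + 1)

/-- A one-sided subshift: a closed, shift-invariant subset of the full shift. -/
def IsSubshift {k : ℕ} (X : Set (ℕ → Fin k)) : Prop :=
  IsClosed X ∧ ∀ x ∈ X, shiftMap x ∈ X

/-- Birkhoff sum `S_n h = ∑_{i<n} h ∘ T^i`. -/
noncomputable def birk {α : Type*} (T : α → α) (h : α → ℝ) (n : ℕ) (x : α) : ℝ :=
  ∑ i ∈ Finset.range n, h (T^[i] x)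

/-- The word `u` of length `n` appears in (is allowable for) the subshift `X`. -/
def WordIn {k : ℕ} (X : Set (ℕ → Fin k)) {n : ℕ} (u : Fin n → Fin k) : Prop :=
  ∃ x ∈ X, ∀ i : Fin n, x (i : ℕ) = u i

/-- The cylinder set of the word `u` inside the subshift `X`. -/
def cylSet {k : ℕ} (X : Set (ℕ → Fin k)) {n : ℕ} (u : Fin n → Fin k) : Set X :=
  {x : X | ∀ i : Fin n, (x : ℕ → Fin k) (i : ℕ) = u i}

/-- The periodic sequence `(u)^∞` obtained by repeating the word `u`. -/
def periodize {k p : ℕ} (hp : 0 < p) (u : Fin p → Fin k) : ℕ → Fin k :=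
  fun i => u ⟨i % p, Nat.mod_lt i hp⟩

/-- A sequence `{log f_n}` is asymptotically additive on the subshift `X` (with shift `σ`)
if for every `ε > 0` there is a continuous `ρ` with
`limsup_n (1/n)‖log f_n - S_n ρ‖_∞ < ε`. -/
def AsympAdd {k : ℕ} (X : Set (ℕ → Fin k)) (σ : X → X) (f : ℕ → X → ℝ) : Prop :=
  ∀ ε : ℝ, 0 < ε → ∃ ρ : X → ℝ, Continuous ρ ∧
    Filter.limsup
      (fun n : ℕ => (1 / (n : ℝ)) * ⨆ x : X, |Real.log (f n x) - birk σ ρ n x|)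
      Filter.atTop < ε

/-- Measure-theoretic entropy of a measure on a one-sided subshift, computed with the
canonical generating partition into cylinders. -/
noncomputable def mEntropy {k : ℕ} (X : Set (ℕ → Fin k)) (μ : MeasureTheory.Measure X) : ℝ :=
  Filter.liminf
    (fun n : ℕ => (1 / (n : ℝ)) *
      ∑ u : Fin n → Fin k, Real.negMulLog ((μ (cylSet X u)).toReal))
    Filter.atTop

-- The standard metric on the full shift: `d(x,y) = (1/2)^{min{i : x_i ≠ y_i}}`.
open Classical in
noncomputable def dSeq {k : ℕ} (x y : ℕ → Fin k) : ℝ :=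
  if x = y then 0 else (1 / 2 : ℝ) ^ (sInf {i : ℕ | x i ≠ y i})

/-- `P_n(σ, π, f, δ)(y)`: supremum of `∑_{x ∈ E} e^{S_n f(x)}` over `(n,δ)`-separated
subsets `E` of the fiber `π⁻¹(y)`. -/
noncomputable def relPn {k l : ℕ} (X : Set (ℕ → Fin k)) (σ : X → X)
    (πs : X → (ℕ → Fin l)) (f : X → ℝ) (n : ℕ) (δ : ℝ) (y : ℕ → Fin l) : ℝ :=
  sSup {s : ℝ | ∃ E : Finset X, (∀ x ∈ E, πs x = y) ∧
    (∀ x ∈ E, ∀ x' ∈ E, x ≠ x' →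
      ∃ i < n, δ ≤ dSeq ((σ^[i] x : X) : ℕ → Fin k) ((σ^[i] x' : X) : ℕ → Fin k)) ∧
    s = ∑ x ∈ E, Real.exp (birk σ f n x)}

/-- The relative pressure function `P(σ, π, f) : (ℕ → Fin l) → ℝ` of `f`. -/
noncomputable def relP {k l : ℕ} (X : Set (ℕ → Fin k)) (σ : X → X)
    (πs : X → (ℕ → Fin l)) (f : X → ℝ) (y : ℕ → Fin l) : ℝ :=
  ⨆ δ : {δ : ℝ // 0 < δ},
    Filter.limsup (fun n : ℕ => (1 / (n : ℝ)) * Real.log (relPn X σ πs f n δ.1 y))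
      Filter.atTop

/-- `g_n(y) = sup_{E_n(y)} ∑_{x ∈ E_n(y)} e^{S_n f(x)}`, where `E_n(y)` consists of exactly
one point from each cylinder `[x_1…x_n]` of `X` whose word is mapped by the one-block map
to `y_1…y_n`. -/
noncomputable def gfun {k l : ℕ} (X : Set (ℕ → Fin k)) (σ : X → X)
    (πs : X → (ℕ → Fin l)) (f : X → ℝ) (n : ℕ) (y : ℕ → Fin l) : ℝ :=
  sSup {s : ℝ | ∃ E : Finset X,
    (∀ x ∈ E, ∀ i : Fin n, πs x (i : ℕ) = y (i : ℕ)) ∧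
    (∀ x ∈ E, ∀ x' ∈ E, (∀ i : Fin n, (x : ℕ → Fin k) (i : ℕ) = (x' : ℕ → Fin k) (i : ℕ)) →
      x = x') ∧
    (∀ u : Fin n → Fin k,
      (∃ z : X, (∀ i : Fin n, (z : ℕ → Fin k) (i : ℕ) = u i) ∧
        ∀ i : Fin n, πs z (i : ℕ) = y (i : ℕ)) →
      ∃ x ∈ E, ∀ i : Fin n, (x : ℕ → Fin k) (i : ℕ) = u i) ∧
    s = ∑ x ∈ E, Real.exp (birk σ f n x)}


/-- Comparison of limsups up to an error tending to zero. -/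
lemma limsup_le_aux {u v w : ℕ → ℝ} {c C : ℝ} (hu : ∀ n, c ≤ u n) (hv : ∀ n, v n ≤ C)
    (hw : Tendsto w atTop (𝓝 0)) (h : ∀ᶠ n in atTop, u n ≤ v n + w n) :
    limsup u atTop ≤ limsup v atTop := by
  refine le_of_forall_pos_le_add fun ε hε => ?_
  have hbv : IsBoundedUnder (· ≤ ·) atTop v := isBoundedUnder_of ⟨C, hv⟩
  have h1 : ∀ᶠ n in atTop, v n < limsup v atTop + ε / 2 :=
    eventually_lt_of_limsup_lt (by linarith) hbv
  have h2 : ∀ᶠ n in atTop, w n < ε / 2 := hw.eventually_lt_const (by linarith)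
  refine limsup_le_of_le (IsBoundedUnder.isCoboundedUnder_le (isBoundedUnder_of ⟨c, hu⟩)) ?_
  filter_upwards [h, h1, h2] with n a1 a2 a3
  linarith

/-- Gibbs inequality. -/
lemma gibbs_ineq {ι : Type*} (s : Finset ι) (p e : ι → ℝ) (hp : ∀ i ∈ s, 0 ≤ p i)
    (he : ∀ i ∈ s, 0 ≤ e i) (hpe : ∀ i ∈ s, p i ≠ 0 → 0 < e i) :
    ∑ i ∈ s, (Real.negMulLog (p i) + p i * Real.log (e i)) ≤
      Real.negMulLog (∑ i ∈ s, p i) + (∑ i ∈ s, p i) * Real.log (∑ i ∈ s, e i) := by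
  set P := ∑ i ∈ s, p i with hP
  set Z := ∑ i ∈ s, e i with hZ
  have hP0 : 0 ≤ P := Finset.sum_nonneg hp
  rcases hP0.eq_or_lt with h0 | hPpos
  · have : ∀ i ∈ s, p i = 0 := (Finset.sum_eq_zero_iff_of_nonneg hp).1 h0.symm
    rw [← h0, Finset.sum_eq_zero]
    · simp
    · intro i hi; simp [this i hi]
  · have hZpos : 0 < Z := by
      obtain ⟨i, hi, hpi⟩ : ∃ i ∈ s, p i ≠ 0 := by
        by_contra hcon
        push Not at hcon
        exact hPpos.ne' (Finset.sum_eq_zero hcon)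
      exact Finset.sum_pos' he ⟨i, hi, hpe i hi hpi⟩
    have key : ∀ i ∈ s, Real.negMulLog (p i) + p i * Real.log (e i) ≤
        p i * (Real.log Z - Real.log P) + (e i * (P / Z) - p i) := by
      intro i hi
      rcases (hp i hi).eq_or_lt with h0 | hpi
      · rw [← h0]
        have := he i hi
        simp
        positivity
      · have hei := hpe i hi hpi.ne'
        have hlog : Real.log (e i * P / (p i * Z)) ≤ e i * P / (p i * Z) - 1 :=
          Real.log_le_sub_one_of_pos (by positivity)
        rw [Real.log_div (by positivity) (by positivity), Real.log_mul hei.ne' hPpos.ne',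
          Real.log_mul hpi.ne' hZpos.ne'] at hlog
        have h2 := mul_le_mul_of_nonneg_left hlog hpi.le
        have h3 : p i * (e i * P / (p i * Z) - 1) = e i * (P / Z) - p i := by
          field_simp
        rw [h3] at h2
        simp only [Real.negMulLog]
        linarith
    calc _ ≤ ∑ i ∈ s, (p i * (Real.log Z - Real.log P) + (e i * (P / Z) - p i)) :=
          Finset.sum_le_sum key
      _ = P * (Real.log Z - Real.log P) + (Z * (P / Z) - P) := by
          rw [Finset.sum_add_distrib, Finset.sum_sub_distrib, ← Finset.sum_mul, ← Finset.sum_mul]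
      _ = _ := by
          rw [Real.negMulLog]; field_simp; ring

/-- Subadditivity of Shannon entropy. -/
lemma entropy_prod_le {α β : Type*} [Fintype α] [Fintype β] (p : α × β → ℝ)
    (hp : ∀ i, 0 ≤ p i) (h1 : ∑ i, p i = 1) :
    ∑ i, Real.negMulLog (p i) ≤ ∑ a, Real.negMulLog (∑ b, p (a, b)) +
      ∑ b, Real.negMulLog (∑ a, p (a, b)) := by
  set q : α → ℝ := fun a => ∑ b, p (a, b) with hq
  set r : β → ℝ := fun b => ∑ a, p (a, b) with hr
  have hq0 : ∀ a, 0 ≤ q a := fun a => Finset.sum_nonneg fun _ _ => hp _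
  have hr0 : ∀ a, 0 ≤ r a := fun a => Finset.sum_nonneg fun _ _ => hp _
  have hpq : ∀ a b, p (a, b) ≤ q a := fun a b =>
    Finset.single_le_sum (f := fun b => p (a, b)) (fun _ _ => hp _) (Finset.mem_univ b)
  have hpr : ∀ a b, p (a, b) ≤ r b := fun a b =>
    Finset.single_le_sum (f := fun a => p (a, b)) (fun _ _ => hp _) (Finset.mem_univ a)
  have hq1 : ∑ a, q a = 1 := by rw [← h1, Fintype.sum_prod_type]
  have hr1 : ∑ a, r a = 1 := by rw [← h1, Fintype.sum_prod_type_right]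
  have G := gibbs_ineq Finset.univ p (fun i => q i.1 * r i.2) (fun i _ => hp i)
    (fun i _ => mul_nonneg (hq0 _) (hr0 _))
    (fun i _ hi => by
      have : 0 < p i := lt_of_le_of_ne (hp i) (Ne.symm hi)
      exact mul_pos (this.trans_le (hpq i.1 i.2)) (this.trans_le (hpr i.1 i.2)))
  have hs : ∑ i : α × β, q i.1 * r i.2 = 1 := by
    rw [Fintype.sum_prod_type, ← Finset.sum_mul_sum, hq1, hr1, one_mul]
  rw [h1, hs] at G
  simp only [Real.negMulLog_one, Real.log_one, mul_zero, add_zero] at G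
  rw [Finset.sum_add_distrib] at G
  have e1 : ∑ i : α × β, p i * Real.log (q i.1 * r i.2) =
      ∑ a, q a * Real.log (q a) + ∑ b, r b * Real.log (r b) := by
    have : ∀ i : α × β, p i * Real.log (q i.1 * r i.2) =
        p i * Real.log (q i.1) + p i * Real.log (r i.2) := by
      intro i
      rcases (hp i).eq_or_lt with h0 | hpi
      · simp [← h0]
      · rw [Real.log_mul (hpi.trans_le (hpq i.1 i.2)).ne' (hpi.trans_le (hpr i.1 i.2)).ne']
        ring
    simp_rw [this]
    rw [Finset.sum_add_distrib, Fintype.sum_prod_type, Fintype.sum_prod_type_right]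
    simp only [← Finset.sum_mul]
    rfl
  rw [e1] at G
  have e2 : ∀ x : ℝ, Real.negMulLog x = -(x * Real.log x) := fun x => by simp [Real.negMulLog]
  have e3 : ∑ a, Real.negMulLog (q a) = -∑ a, q a * Real.log (q a) := by
    rw [← Finset.sum_neg_distrib]; exact Finset.sum_congr rfl fun _ _ => e2 _
  have e4 : ∑ a, Real.negMulLog (r a) = -∑ a, r a * Real.log (r a) := by
    rw [← Finset.sum_neg_distrib]; exact Finset.sum_congr rfl fun _ _ => e2 _
  rw [e3, e4]
  linarith

lemma entropy_le_log_card {α : Type*} [Fintype α] [Nonempty α] (p : α → ℝ)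
    (hp : ∀ i, 0 ≤ p i) (h1 : ∑ i, p i = 1) :
    ∑ i, Real.negMulLog (p i) ≤ Real.log (Fintype.card α) := by
  have G := gibbs_ineq Finset.univ p (fun _ => 1) (fun i _ => hp i) (by simp) (by simp)
  rw [h1] at G
  simpa using G

lemma birk_zero {α : Type*} (T : α → α) (g : α → ℝ) (x : α) : birk T g 0 x = 0 := by simp [birk]

lemma birk_succ' {α : Type*} (T : α → α) (g : α → ℝ) (n : ℕ) (x : α) :
    birk T g (n + 1) x = g x + birk T g n (T x) := by
  simp [birk, Finset.sum_range_succ', add_comm]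

lemma birk_add {α : Type*} (T : α → α) (g : α → ℝ) (n m : ℕ) (x : α) :
    birk T g (n + m) x = birk T g n x + birk T g m (T^[n] x) := by
  simp only [birk, Finset.sum_range_add, ← Function.iterate_add_apply, add_comm]

lemma birk_abs_le {α : Type*} (T : α → α) (g : α → ℝ) {C : ℝ} (hC : ∀ x, |g x| ≤ C) (n : ℕ)
    (x : α) : |birk T g n x| ≤ n * C := by
  refine (Finset.abs_sum_le_sum_abs _ _).trans ?_
  refine (Finset.sum_le_sum fun i _ => hC _).trans ?_
  simp

lemma birk_measurable {α : Type*} [MeasurableSpace α] {T : α → α} (hT : Measurable T)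
    {g : α → ℝ} (hg : Measurable g) (n : ℕ) : Measurable (birk T g n) := by
  unfold birk
  exact Finset.measurable_fun_sum _ fun i _ => hg.comp (hT.iterate i)

lemma bdd_integrable {Ω : Type*} [MeasurableSpace Ω] {m : Measure Ω} [IsFiniteMeasure m]
    {g : Ω → ℝ} (hg : Measurable g) (C : ℝ) (hC : ∀ x, |g x| ≤ C) : Integrable g m :=
  Integrable.of_bound hg.aestronglyMeasurable C (ae_of_all _ hC)

/-- auxiliary maxima of Birkhoff sums -/
noncomputable def mxm {Ω : Type*} (T : Ω → Ω) (F : Ω → ℝ) : ℕ → Ω → ℝ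
  | 0 => F
  | n + 1 => fun x => F x + max 0 (mxm T F n (T x))

lemma maximal_ergodic {Ω : Type*} [MeasurableSpace Ω] (m : Measure Ω) [IsProbabilityMeasure m]
    (T : Ω → Ω) (hT : MeasurePreserving T m m) (F : Ω → ℝ) (hF : Measurable F) (C : ℝ)
    (hC : ∀ x, |F x| ≤ C) (hpos : ∀ x, ∃ n, 0 < birk T F (n + 1) x) : 0 ≤ ∫ x, F x ∂m := by
  have hmeas : ∀ n, Measurable (mxm T F n) := by
    intro n
    induction n with
    | zero => exact hF
    | succ n ih => exact hF.add (measurable_const.max (ih.comp hT.measurable))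
  have hbd : ∀ n x, |mxm T F n x| ≤ (n + 1) * C := by
    intro n
    induction n with
    | zero => intro x; simpa [mxm] using hC x
    | succ n ih =>
      intro x
      have h1 := abs_le.1 (ih (T x))
      have h2 := abs_le.1 (hC x)
      simp only [mxm]
      push_cast
      rw [abs_le]
      constructor
      · have := le_max_left 0 (mxm T F n (T x))
        have : 0 ≤ C := by linarith
        nlinarith [(Nat.cast_nonneg n : (0:ℝ) ≤ n)]
      · have h3 : max 0 (mxm T F n (T x)) ≤ (n + 1) * C := max_le (by linarith) h1.2
        linarith
  have hmono : ∀ n x, mxm T F n x ≤ mxm T F (n + 1) x := by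
    intro n
    induction n with
    | zero => intro x; simp [mxm]
    | succ n ih =>
      intro x
      have := max_le_max (le_refl (0:ℝ)) (ih (T x))
      simp only [mxm] at this ⊢
      linarith
  have hge : ∀ n x, birk T F (n + 1) x ≤ mxm T F n x := by
    intro n
    induction n with
    | zero => intro x; simp [mxm, birk]
    | succ n ih =>
      intro x
      rw [birk_succ']
      have := (ih (T x)).trans (le_max_right 0 _)
      simp only [mxm]
      linarith
  have hFle : ∀ n x, F x ≤ mxm T F n x := by
    intro n x
    cases n with
    | zero => exact le_rfl
    | succ n => simp [mxm]
  have hint : ∀ n, Integrable (mxm T F n) m := fun n => bdd_integrable (hmeas n) _ (hbd n)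
  have hintF : Integrable F m := bdd_integrable hF C hC
  have hintmax : ∀ n, Integrable (fun x => max 0 (mxm T F n x)) m := fun n =>
    (integrable_zero _ _ _).sup (hint n)
  have key : ∀ n, ∫ x, min 0 (mxm T F (n + 1) x) ∂m ≤ ∫ x, F x ∂m := by
    intro n
    have e1 : ∫ x, mxm T F (n + 1) x ∂m = ∫ x, F x ∂m + ∫ x, max 0 (mxm T F n (T x)) ∂m := by
      simp only [mxm]
      exact integral_add hintF ((hT.integrable_comp
        (hintmax n).aestronglyMeasurable).2 (hintmax n))
    have e2 : ∫ x, max 0 (mxm T F n (T x)) ∂m = ∫ x, max 0 (mxm T F n x) ∂m := by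
      have := integral_map (μ := m) hT.measurable.aemeasurable
        (f := fun x => max 0 (mxm T F n x)) (by rw [hT.map_eq]; exact (hintmax n).aestronglyMeasurable)
      rw [hT.map_eq] at this
      exact this.symm
    have e3 : ∫ x, max 0 (mxm T F n x) ∂m ≤ ∫ x, max 0 (mxm T F (n + 1) x) ∂m :=
      integral_mono (hintmax n) (hintmax (n + 1)) fun x => max_le_max le_rfl (hmono n x)
    have e4 : ∫ x, min 0 (mxm T F (n + 1) x) ∂m =
        ∫ x, mxm T F (n + 1) x ∂m - ∫ x, max 0 (mxm T F (n + 1) x) ∂m := by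
      rw [← integral_sub (hint _) (hintmax _)]
      congr 1
      ext x
      have := min_add_max 0 (mxm T F (n + 1) x)
      linarith
    linarith
  have hlim : Tendsto (fun n => ∫ x, min 0 (mxm T F (n + 1) x) ∂m) atTop (𝓝 (∫ x, (0:ℝ) ∂m)) := by
    refine tendsto_integral_of_dominated_convergence (fun _ => C)
      (fun n => (measurable_const.min (hmeas _)).aestronglyMeasurable) (integrable_const C) ?_ ?_
    · intro n
      refine ae_of_all _ fun x => ?_
      have h1 := hFle (n + 1) x
      have h2 := abs_le.1 (hC x)
      rw [Real.norm_eq_abs, abs_of_nonpos (min_le_left _ _)]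
      have : -C ≤ min 0 (mxm T F (n + 1) x) := le_min (by linarith) (by linarith)
      linarith
    · refine ae_of_all _ fun x => ?_
      obtain ⟨N, hN⟩ := hpos x
      have hN' : 0 < mxm T F N x := hN.trans_le (hge N x)
      have hm : Monotone fun n => mxm T F n x := monotone_nat_of_le_succ fun n => hmono n x
      refine tendsto_const_nhds.congr' ?_
      filter_upwards [eventually_ge_atTop N] with n hn
      have : mxm T F N x ≤ mxm T F (n + 1) x := hm (by omega)
      rw [min_eq_left (by linarith)]
  rw [integral_zero] at hlim
  exact le_of_tendsto' hlim key

lemma abs_avg_le {a C : ℝ} (hC0 : 0 ≤ C) {n : ℕ} (h : |a| ≤ n * C) : |(1 / (n : ℝ)) * a| ≤ C := by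
  rcases Nat.eq_zero_or_pos n with rfl | hn
  · simpa using hC0
  · have hn' : (0:ℝ) < n := by exact_mod_cast hn
    rw [abs_mul, abs_of_pos (by positivity : (0:ℝ) < 1 / n), one_div, inv_mul_le_iff₀ hn']
    exact h

lemma limsup_abs_le {u : ℕ → ℝ} {C : ℝ} (h : ∀ n, |u n| ≤ C) : |limsup u atTop| ≤ C := by
  have hb1 : IsBoundedUnder (· ≤ ·) atTop u := isBoundedUnder_of ⟨C, fun n => (abs_le.1 (h n)).2⟩
  have hb2 : IsBoundedUnder (· ≥ ·) atTop u := isBoundedUnder_of ⟨-C, fun n => (abs_le.1 (h n)).1⟩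
  rw [abs_le]
  constructor
  · exact le_limsup_of_frequently_le (Frequently.of_forall fun n => (abs_le.1 (h n)).1) hb1
  · exact limsup_le_of_le hb2.isCoboundedUnder_le (Eventually.of_forall fun n => (abs_le.1 (h n)).2)

/-- Half of the Birkhoff ergodic theorem. -/
lemma half_birkhoff {Ω : Type*} [MeasurableSpace Ω] (m : Measure Ω) [IsProbabilityMeasure m]
    (T : Ω → Ω) (hT : MeasurePreserving T m m) (g : Ω → ℝ) (hg : Measurable g) (C : ℝ)
    (hC0 : 0 ≤ C) (hC : ∀ x, |g x| ≤ C) :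
    Measurable (fun x => limsup (fun n : ℕ => (1 / (n : ℝ)) * birk T g n x) atTop) ∧
    ∫ x, limsup (fun n : ℕ => (1 / (n : ℝ)) * birk T g n x) atTop ∂m ≤ ∫ x, g x ∂m := by
  set B : Ω → ℝ := fun x => limsup (fun n : ℕ => (1 / (n : ℝ)) * birk T g n x) atTop with hB
  have hab : ∀ x (n : ℕ), |(1 / (n : ℝ)) * birk T g n x| ≤ C := fun x n =>
    abs_avg_le hC0 (birk_abs_le T g hC n x)
  have hBm : Measurable B := Measurable.limsup fun n => (birk_measurable hT.measurable hg n).const_mul _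
  have hBb : ∀ x, |B x| ≤ C := fun x => limsup_abs_le (hab x)
  have hsh : ∀ x, Tendsto (fun n : ℕ => (1 / ((n + 1 : ℕ) : ℝ)) * birk T g (n + 1) x
      - (1 / (n : ℝ)) * birk T g n (T x)) atTop (𝓝 0) := by
    intro x
    have hz : Tendsto (fun n : ℕ => 2 * C * (1 / ((n : ℝ) + 1))) atTop (𝓝 0) := by
      simpa using (tendsto_one_div_add_atTop_nhds_zero_nat (𝕜 := ℝ)).const_mul (2 * C)
    refine squeeze_zero_norm' ?_ hz
    filter_upwards [eventually_gt_atTop 0] with n hn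
    have hn' : (0:ℝ) < n := by exact_mod_cast hn
    rw [birk_succ', Real.norm_eq_abs]
    have e : 1 / ((n + 1 : ℕ) : ℝ) * (g x + birk T g n (T x)) - 1 / (n:ℝ) * birk T g n (T x) =
        (g x - 1 / (n:ℝ) * birk T g n (T x)) * (1 / ((n:ℝ) + 1)) := by
      push_cast
      field_simp
      ring
    rw [e, abs_mul, abs_of_pos (by positivity : (0:ℝ) < 1 / ((n:ℝ) + 1))]
    refine mul_le_mul_of_nonneg_right ?_ (by positivity)
    refine (abs_sub _ _).trans ?_
    have := hab (T x) n
    have := hC x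
    linarith
  have hinv : ∀ x, B (T x) = B x := by
    intro x
    have e : B x = limsup (fun n : ℕ => (1 / ((n + 1 : ℕ) : ℝ)) * birk T g (n + 1) x) atTop :=
      (limsup_nat_add (fun n : ℕ => (1 / (n : ℝ)) * birk T g n x) 1).symm
    rw [e]
    apply le_antisymm
    · refine limsup_le_aux (fun n => (abs_le.1 (hab (T x) n)).1)
        (fun n => (abs_le.1 (hab x (n + 1))).2) (by simpa only [neg_zero] using (hsh x).neg) ?_
      filter_upwards with n
      linarith
    · refine limsup_le_aux (fun n => (abs_le.1 (hab x (n + 1))).1)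
        (fun n => (abs_le.1 (hab (T x) n)).2) (hsh x) ?_
      filter_upwards with n
      linarith
  refine ⟨hBm, ?_⟩
  have hinvn : ∀ n x, B (T^[n] x) = B x := by
    intro n
    induction n with
    | zero => intro x; rfl
    | succ n ih => intro x; rw [Function.iterate_succ_apply, ih, hinv]
  have hBi : Integrable B m := bdd_integrable hBm C hBb
  have hgi : Integrable g m := bdd_integrable hg C hC
  refine le_of_forall_pos_le_add fun ε hε => ?_
  have hbirk : ∀ n x, birk T (fun x => g x - B x + ε) n x = birk T g n x - n * B x + n * ε := by
    intro n x
    simp only [birk, hinvn, Finset.sum_add_distrib, Finset.sum_sub_distrib]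
    simp
  have := maximal_ergodic m T hT (fun x => g x - B x + ε) ((hg.sub hBm).add_const ε)
    (2 * C + ε) (fun x => by
      have h1 := abs_le.1 (hC x)
      have h2 := abs_le.1 (hBb x)
      rw [abs_le]
      constructor <;> linarith) (fun x => by
      have hfr : ∃ᶠ n : ℕ in atTop, B x - ε < (1 / (n : ℝ)) * birk T g n x :=
        frequently_lt_of_lt_limsup
          (isBoundedUnder_of ⟨-C, fun n => (abs_le.1 (hab x n)).1⟩ :
            IsBoundedUnder (· ≥ ·) atTop _).isCoboundedUnder_le (by simp only [hB]; linarith)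
      obtain ⟨n, hn, hn1⟩ := (hfr.and_eventually (eventually_ge_atTop 1)).exists
      refine ⟨n - 1, ?_⟩
      rw [Nat.sub_add_cancel hn1, hbirk]
      have hn' : (0:ℝ) < n := by exact_mod_cast hn1
      have h3 := mul_lt_mul_of_pos_left hn hn'
      have h4 : (n:ℝ) * (1 / n * birk T g n x) = birk T g n x := by field_simp
      rw [h4] at h3
      linarith)
  have h5 : ∫ x, (g x - B x + ε) ∂m = ∫ x, g x ∂m - ∫ x, B x ∂m + ε := by
    have := integral_add (hgi.sub hBi) (integrable_const (μ := m) ε)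
    simp only [Pi.sub_apply] at this
    rw [this, integral_sub hgi hBi]
    simp
  rw [h5] at this
  linarith

/-- Reverse Fatou for uniformly bounded functions. -/
lemma reverse_fatou {Ω : Type*} [MeasurableSpace Ω] (m : Measure Ω) [IsProbabilityMeasure m]
    (v : ℕ → Ω → ℝ) (hv : ∀ n, Measurable (v n)) (C : ℝ) (hC : ∀ n x, |v n x| ≤ C) (c : ℝ)
    (hc : ∀ n, 1 ≤ n → c ≤ ∫ x, v n x ∂m) :
    c ≤ ∫ x, limsup (fun n => v n x) atTop ∂m := by
  have hbdd : ∀ n x, BddAbove (Set.range fun j => v (j + n) x) := fun n x =>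
    ⟨C, by rintro _ ⟨j, rfl⟩; exact (abs_le.1 (hC _ x)).2⟩
  set s : ℕ → Ω → ℝ := fun n x => ⨆ j, v (j + n) x with hs
  have hsm : ∀ n, Measurable (s n) := fun n =>
    Measurable.iSup fun j => hv (j + n)
  have hsb : ∀ n x, |s n x| ≤ C := by
    intro n x
    rw [abs_le]
    exact ⟨((abs_le.1 (hC (0 + n) x)).1).trans (le_ciSup (hbdd n x) 0),
      ciSup_le fun j => (abs_le.1 (hC _ x)).2⟩
  have hvs : ∀ n x, v n x ≤ s n x := fun n x => by
    simpa using le_ciSup (hbdd n x) 0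
  have hlim : ∀ x, Tendsto (fun n => s n x) atTop (𝓝 (limsup (fun n => v n x) atTop)) := by
    intro x
    have hanti : Antitone fun n => s n x := by
      refine antitone_nat_of_succ_le fun n => ?_
      refine ciSup_le fun j => ?_
      have := le_ciSup (hbdd n x) (j + 1)
      rwa [show j + 1 + n = j + (n + 1) by ring] at this
    have h1 : Tendsto (fun n => s n x) atTop (𝓝 (⨅ n, s n x)) :=
      tendsto_atTop_ciInf hanti ⟨-C, by rintro _ ⟨j, rfl⟩; exact (abs_le.1 (hsb j x)).1⟩
    have h2 : limsup (fun n => v n x) atTop = ⨅ n, s n x := by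
      have hb1 : IsBoundedUnder (· ≤ ·) atTop fun n => v n x :=
        isBoundedUnder_of ⟨C, fun n => (abs_le.1 (hC n x)).2⟩
      have hb2 : IsBoundedUnder (· ≥ ·) atTop fun n => v n x :=
        isBoundedUnder_of ⟨-C, fun n => (abs_le.1 (hC n x)).1⟩
      apply le_antisymm
      · refine le_ciInf fun n => limsup_le_of_le hb2.isCoboundedUnder_le ?_
        filter_upwards [eventually_ge_atTop n] with j hj
        have := le_ciSup (hbdd n x) (j - n)
        rwa [Nat.sub_add_cancel hj] at this
      · refine le_of_forall_gt_imp_ge_of_dense fun a ha => ?_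
        obtain ⟨N, hN⟩ := eventually_atTop.1 (eventually_lt_of_limsup_lt ha hb1)
        refine (ciInf_le ⟨-C, by rintro _ ⟨j, rfl⟩; exact (abs_le.1 (hsb j x)).1⟩ N).trans ?_
        exact ciSup_le fun j => (hN (j + N) (by omega)).le
    rw [h2]
    exact h1
  have ht : Tendsto (fun n => ∫ x, s n x ∂m) atTop (𝓝 (∫ x, limsup (fun n => v n x) atTop ∂m)) :=
    tendsto_integral_of_dominated_convergence (fun _ => C)
      (fun n => (hsm n).aestronglyMeasurable) (integrable_const C)
      (fun n => ae_of_all _ fun x => hsb n x) (ae_of_all _ hlim)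
  refine ge_of_tendsto ht ?_
  filter_upwards [eventually_ge_atTop 1] with n hn
  refine (hc n hn).trans ?_
  exact integral_mono (bdd_integrable (hv n) C (hC n)) (bdd_integrable (hsm n) C (hsb n)) (hvs n)


/-- the initial word of length `n` -/
def wd {k : ℕ} (X : Set (ℕ → Fin k)) (n : ℕ) (x : X) : Fin n → Fin k := fun i => (x : ℕ → Fin k) i

/-- entropy of the partition into `n`-cylinders -/
noncomputable def Hn {k : ℕ} (X : Set (ℕ → Fin k)) (μ : Measure X) (n : ℕ) : ℝ :=
  ∑ u : Fin n → Fin k, Real.negMulLog ((μ (cylSet X u)).toReal)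

lemma cylSet_eq {k : ℕ} (X : Set (ℕ → Fin k)) {n : ℕ} (u : Fin n → Fin k) :
    cylSet X u = wd X n ⁻¹' {u} := by
  ext x
  simp only [cylSet, Set.mem_ofPred_eq, Set.mem_preimage, Set.mem_singleton_iff, funext_iff, wd]

lemma mem_cyl {k : ℕ} (X : Set (ℕ → Fin k)) {n : ℕ} (u : Fin n → Fin k) (x : X) :
    x ∈ cylSet X u ↔ wd X n x = u := by
  rw [cylSet_eq]; rfl

lemma wd_continuous {k : ℕ} (X : Set (ℕ → Fin k)) (n : ℕ) : Continuous (wd X n) :=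
  continuous_pi fun i => (continuous_apply (i : ℕ)).comp continuous_subtype_val

lemma wd_measurable {k : ℕ} (X : Set (ℕ → Fin k)) (n : ℕ) : Measurable (wd X n) :=
  measurable_pi_lambda _ fun i => (measurable_pi_apply (i : ℕ)).comp measurable_subtype_coe

lemma cyl_clopen {k : ℕ} (X : Set (ℕ → Fin k)) {n : ℕ} (u : Fin n → Fin k) :
    IsClopen (cylSet X u) := by
  rw [cylSet_eq]
  exact (isClopen_discrete _).preimage (wd_continuous X n)

lemma cyl_meas {k : ℕ} (X : Set (ℕ → Fin k)) {n : ℕ} (u : Fin n → Fin k) :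
    MeasurableSet (cylSet X u) := (cyl_clopen X u).isOpen.measurableSet

lemma integral_wd {k : ℕ} (X : Set (ℕ → Fin k)) (μ : Measure X) [IsProbabilityMeasure μ] (n : ℕ)
    (c : (Fin n → Fin k) → ℝ) :
    ∫ x, c (wd X n x) ∂μ = ∑ u, (μ (cylSet X u)).toReal * c u := by
  have hm := wd_measurable X n
  have : IsProbabilityMeasure (μ.map (wd X n)) := Measure.isProbabilityMeasure_map hm.aemeasurable
  rw [← integral_map (μ := μ) hm.aemeasurable (f := c)
    (measurable_of_finite c).aestronglyMeasurable,
    integral_fintype (Integrable.of_finite)]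
  refine Finset.sum_congr rfl fun u _ => ?_
  rw [cylSet_eq, measureReal_def, Measure.map_apply hm (measurableSet_singleton u), smul_eq_mul]

lemma sum_cyl {k : ℕ} (X : Set (ℕ → Fin k)) (μ : Measure X) [IsProbabilityMeasure μ] (n : ℕ) :
    ∑ u : Fin n → Fin k, (μ (cylSet X u)).toReal = 1 := by
  have := integral_wd X μ n fun _ => 1
  simpa using this.symm

lemma cyl_le_one {k : ℕ} (X : Set (ℕ → Fin k)) (μ : Measure X) [IsProbabilityMeasure μ] {n : ℕ}
    (u : Fin n → Fin k) : (μ (cylSet X u)).toReal ≤ 1 := measureReal_le_one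

lemma Hn_nonneg {k : ℕ} (X : Set (ℕ → Fin k)) (μ : Measure X) [IsProbabilityMeasure μ] (n : ℕ) :
    0 ≤ Hn X μ n :=
  Finset.sum_nonneg fun u _ => Real.negMulLog_nonneg ENNReal.toReal_nonneg (cyl_le_one X μ u)

lemma Hn_le {k : ℕ} (X : Set (ℕ → Fin k)) (μ : Measure X) [IsProbabilityMeasure μ] (n : ℕ) :
    Hn X μ n ≤ n * Real.log k := by
  obtain ⟨x⟩ : Nonempty X := nonempty_of_isProbabilityMeasure μ
  have : Nonempty (Fin n → Fin k) := ⟨wd X n x⟩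
  refine (entropy_le_log_card _ (fun u => ENNReal.toReal_nonneg) (sum_cyl X μ n)).trans ?_
  simp

lemma logk_nonneg (k : ℕ) : 0 ≤ Real.log k := Real.log_natCast_nonneg k

section shift
variable {k : ℕ} {X : Set (ℕ → Fin k)} {σ : X → X}

lemma iter_apply (hσ : ∀ x : X, (σ x : ℕ → Fin k) = shiftMap (x : ℕ → Fin k)) (n : ℕ) (x : X)
    (i : ℕ) : ((σ^[n] x : X) : ℕ → Fin k) i = (x : ℕ → Fin k) (n + i) := by
  induction n generalizing x with
  | zero => simp
  | succ n ih =>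
    rw [Function.iterate_succ_apply, ih, hσ, shiftMap, show n + 1 + i = n + i + 1 by omega]

lemma shift_continuous (hσ : ∀ x : X, (σ x : ℕ → Fin k) = shiftMap (x : ℕ → Fin k)) :
    Continuous σ := by
  rw [continuous_induced_rng]
  have : (Subtype.val ∘ σ) = fun x : X => shiftMap (x : ℕ → Fin k) := funext hσ
  rw [this]
  exact continuous_pi fun i => (continuous_apply (i + 1)).comp continuous_subtype_val

lemma cyl_append (hσ : ∀ x : X, (σ x : ℕ → Fin k) = shiftMap (x : ℕ → Fin k)) {n m : ℕ}
    (u : Fin n → Fin k) (v : Fin m → Fin k) (x : X) :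
    x ∈ cylSet X (Fin.append u v) ↔ x ∈ cylSet X u ∧ σ^[n] x ∈ cylSet X v := by
  simp only [cylSet, Set.mem_ofPred_eq]
  constructor
  · intro h
    refine ⟨fun i => ?_, fun i => ?_⟩
    · simpa using h (Fin.castAdd m i)
    · rw [iter_apply hσ]
      simpa using h (Fin.natAdd n i)
  · rintro ⟨h1, h2⟩ i
    refine Fin.addCases (fun i => ?_) (fun i => ?_) i
    · simpa using h1 i
    · have := h2 i
      rw [iter_apply hσ] at this
      simpa using this

lemma iter_meas (hσ : ∀ x : X, (σ x : ℕ → Fin k) = shiftMap (x : ℕ → Fin k)) (n : ℕ) :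
    Measurable σ^[n] := ((shift_continuous hσ).iterate n).measurable

lemma iter_prob (hσ : ∀ x : X, (σ x : ℕ → Fin k) = shiftMap (x : ℕ → Fin k)) (ν : Measure X)
    [IsProbabilityMeasure ν] (n : ℕ) : IsProbabilityMeasure (ν.map σ^[n]) :=
  Measure.isProbabilityMeasure_map (iter_meas hσ n).aemeasurable

lemma Hn_add (hσ : ∀ x : X, (σ x : ℕ → Fin k) = shiftMap (x : ℕ → Fin k)) (ν : Measure X)
    [IsProbabilityMeasure ν] (n m : ℕ) :
    Hn X ν (n + m) ≤ Hn X ν n + Hn X (ν.map σ^[n]) m := by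
  set p : (Fin n → Fin k) × (Fin m → Fin k) → ℝ := fun i =>
    (ν (cylSet X (Fin.append i.1 i.2))).toReal with hp
  have hsum : ∀ c : (Fin (n + m) → Fin k) → ℝ, ∑ u, c u =
      ∑ i : (Fin n → Fin k) × (Fin m → Fin k), c (Fin.append i.1 i.2) := by
    intro c
    exact (Equiv.sum_comp (Fin.appendEquiv n m) c).symm
  have key := entropy_prod_le p (fun i => ENNReal.toReal_nonneg)
    (by rw [← sum_cyl X ν (n + m), hsum])
  have hA : ∀ u : Fin n → Fin k, ∑ v, p (u, v) = (ν (cylSet X u)).toReal := by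
    intro u
    have h1 := integral_wd X ν (n + m) (fun w => if (∀ i : Fin n, w (Fin.castAdd m i) = u i) then 1 else 0)
    have h2 := integral_wd X ν n (fun w => if w = u then 1 else 0)
    have h3 : ∀ x : X, (∀ i : Fin n, wd X (n + m) x (Fin.castAdd m i) = u i) ↔ wd X n x = u := by
      intro x; simp [wd, funext_iff]
    simp only [h3] at h1
    rw [h1, hsum, Fintype.sum_prod_type] at h2
    simp only [Fin.append_left, ← funext_iff] at h2
    simp at h2
    rw [← h2]
  have hB : ∀ v : Fin m → Fin k, ∑ u, p (u, v) = ((ν.map σ^[n]) (cylSet X v)).toReal := by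
    intro v
    have := iter_prob hσ ν n
    have h1 := integral_wd X ν (n + m) (fun w => if (∀ i : Fin m, w (Fin.natAdd n i) = v i) then 1 else 0)
    have h2 := integral_wd X (ν.map σ^[n]) m (fun w => if w = v then 1 else 0)
    have h3 : ∀ x : X, (∀ i : Fin m, wd X (n + m) x (Fin.natAdd n i) = v i) ↔
        wd X m (σ^[n] x) = v := by
      intro x; simp [wd, funext_iff, iter_apply hσ]
    simp only [h3] at h1
    rw [integral_map (iter_meas hσ n).aemeasurable] at h2
    · rw [h1, hsum, Fintype.sum_prod_type_right] at h2
      simp only [Fin.append_right, ← funext_iff] at h2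
      simp at h2
      rw [← h2]
    · exact ((measurable_of_finite (fun w : Fin m → Fin k => if w = v then (1:ℝ) else 0)).comp
        (wd_measurable X m)).aestronglyMeasurable
  simp only [hA, hB] at key
  unfold Hn
  rw [hsum]
  exact key

lemma Hn_ineq (hσ : ∀ x : X, (σ x : ℕ → Fin k) = shiftMap (x : ℕ → Fin k)) (ν : Measure X)
    [IsProbabilityMeasure ν] (n q : ℕ) (hq : q ≤ n) :
    q * Hn X ν n ≤ ∑ a ∈ Finset.range n, Hn X (ν.map σ^[a]) q + 2 * (q * (q * Real.log k)) := by
  have hpr := iter_prob hσ ν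
  have hmm : ∀ a b, (ν.map σ^[a]).map σ^[b] = ν.map σ^[a + b] := by
    intro a b
    rw [Measure.map_map (iter_meas hσ b) (iter_meas hσ a), ← Function.iterate_add, add_comm]
  set K : ℕ → ℝ := fun a => Hn X (ν.map σ^[a]) (n - a) with hK
  set S : ℕ → ℝ := fun a => ∑ j ∈ Finset.range q, K (a + j) with hS
  have hl := logk_nonneg k
  have hstep : ∀ a, a + q ≤ n → K a ≤ Hn X (ν.map σ^[a]) q + K (a + q) := by
    intro a ha
    have := Hn_add hσ (ν.map σ^[a]) q (n - (a + q))
    rw [hmm, show q + (n - (a + q)) = n - a by omega] at this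
    exact this
  have hSS : ∀ a, S a - S (a + 1) = K a - K (a + q) := by
    intro a
    have h1 := Finset.sum_range_succ (fun j => K (a + j)) q
    have h2 := Finset.sum_range_succ' (fun j => K (a + j)) q
    simp only [hS]
    simp only [add_zero] at h2
    have h3 : ∑ j ∈ Finset.range q, K (a + 1 + j) = ∑ j ∈ Finset.range q, K (a + (j + 1)) :=
      Finset.sum_congr rfl fun j _ => by congr 1; ring
    rw [h3]
    linarith
  have htel : ∀ t, t + q ≤ n → S 0 ≤ ∑ a ∈ Finset.range t, Hn X (ν.map σ^[a]) q + S t := by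
    intro t
    induction t with
    | zero => intro _; simp
    | succ t ih =>
      intro ht
      have h1 := ih (by omega)
      have h2 := hstep t (by omega)
      have h3 := hSS t
      rw [Finset.sum_range_succ]
      linarith
  have h1 := htel (n - q) (by omega)
  have h2 : ∑ a ∈ Finset.range (n - q), Hn X (ν.map σ^[a]) q ≤
      ∑ a ∈ Finset.range n, Hn X (ν.map σ^[a]) q :=
    Finset.sum_le_sum_of_subset_of_nonneg (Finset.range_mono (by omega))
      fun i _ _ => Hn_nonneg X _ q
  have h3 : S (n - q) ≤ q * (q * Real.log k) := by
    have : ∀ j ∈ Finset.range q, K (n - q + j) ≤ q * Real.log k := by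
      intro j hj
      refine (Hn_le X _ _).trans ?_
      refine mul_le_mul_of_nonneg_right ?_ hl
      have : n - (n - q + j) ≤ q := by omega
      exact_mod_cast this
    refine (Finset.sum_le_sum this).trans ?_
    simp
  have h4 : q * Hn X ν n ≤ S 0 + q * (q * Real.log k) := by
    have : ∀ j ∈ Finset.range q, Hn X ν n ≤ K (0 + j) + q * Real.log k := by
      intro j hj
      have hj' := Finset.mem_range.1 hj
      have h5 := Hn_add hσ ν j (n - j)
      rw [show j + (n - j) = n by omega] at h5
      have h6 : Hn X ν j ≤ q * Real.log k := by
        refine (Hn_le X _ _).trans ?_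
        refine mul_le_mul_of_nonneg_right ?_ hl
        exact_mod_cast hj'.le
      simp only [hK, zero_add]
      linarith
    have := Finset.sum_le_sum this
    rw [Finset.sum_add_distrib] at this
    simpa [hS] using this
  linarith
end shift


section mis
variable {k : ℕ} {X : Set (ℕ → Fin k)} {σ : X → X}

lemma cont_bound (hX : IsClosed X) (g : X → ℝ) (hg : Continuous g) :
    ∃ C, 0 ≤ C ∧ ∀ x, |g x| ≤ C := by
  have : CompactSpace X := isCompact_iff_compactSpace.1 hX.isCompact
  obtain ⟨C, hC⟩ := isCompact_univ.exists_bound_of_continuousOn hg.continuousOn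
  exact ⟨max C 0, le_max_right _ _, fun x => (hC x trivial).trans (le_max_left _ _)⟩

lemma birk_continuous {α : Type*} [TopologicalSpace α] {T : α → α} (hT : Continuous T)
    {g : α → ℝ} (hg : Continuous g) (n : ℕ) : Continuous (birk T g n) := by
  unfold birk
  exact continuous_finsetSum _ fun i _ => hg.comp (hT.iterate i)

/-- averaged measures -/
lemma exists_avg (hX : IsClosed X) (hσ : ∀ x : X, (σ x : ℕ → Fin k) = shiftMap (x : ℕ → Fin k))
    (ν : Measure X) [IsProbabilityMeasure ν] (n : ℕ) (hn : 1 ≤ n) :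
    ∃ P : ProbabilityMeasure X,
      (∀ A, MeasurableSet A → ((P : Measure X) A).toReal =
        ∑ i ∈ Finset.range n, (1 / (n : ℝ)) * ((ν.map σ^[i]) A).toReal) ∧
      (∀ g : X → ℝ, Continuous g → ∫ x, g x ∂(P : Measure X) =
        (1 / (n : ℝ)) * ∫ x, birk σ g n x ∂ν) := by
  have hpr := iter_prob hσ ν
  have hn0 : (n : ENNReal) ≠ 0 := by simp; omega
  set Q : Measure X := (n : ENNReal)⁻¹ • ∑ i ∈ Finset.range n, ν.map σ^[i] with hQ
  have hQp : IsProbabilityMeasure Q := by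
    constructor
    rw [hQ, Measure.smul_apply, Measure.finsetSum_apply]
    simp only [measure_univ]
    simp [ENNReal.inv_mul_cancel hn0]
  refine ⟨⟨Q, hQp⟩, ?_, ?_⟩
  · intro A hA
    simp only [ProbabilityMeasure.coe_mk]
    rw [hQ, Measure.smul_apply, Measure.finsetSum_apply, smul_eq_mul, ENNReal.toReal_mul,
      ENNReal.toReal_sum (fun i _ => measure_ne_top _ _), Finset.mul_sum]
    simp
  · intro g hg
    obtain ⟨C, hC0, hC⟩ := cont_bound hX g hg
    have hgm := hg.measurable
    simp only [ProbabilityMeasure.coe_mk]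
    rw [hQ, integral_smul_measure, integral_finsetSum_measure
      (fun i _ => bdd_integrable hgm C hC)]
    unfold birk
    rw [integral_finsetSum _ (fun i _ => bdd_integrable (g := fun x => g (σ^[i] x))
      (hgm.comp (iter_meas hσ i)) C fun x => hC _)]
    simp only [smul_eq_mul, ENNReal.toReal_inv, ENNReal.toReal_natCast, one_div]
    congr 1
    refine Finset.sum_congr rfl fun i _ => ?_
    rw [integral_map (iter_meas hσ i).aemeasurable hgm.aestronglyMeasurable]

lemma misiurewicz (hX : IsClosed X)
    (hσ : ∀ x : X, (σ x : ℕ → Fin k) = shiftMap (x : ℕ → Fin k))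
    (Φ : X → ℝ) (hΦ : Continuous Φ) (ν : ℕ → Measure X) (hν : ∀ n, IsProbabilityMeasure (ν n))
    (L : ℝ) (hL : ∀ ε > 0, ∀ᶠ n : ℕ in atTop,
      n * (L - ε) ≤ Hn X (ν n) n + ∫ x, birk σ Φ n x ∂(ν n)) :
    ∃ μ : Measure X, IsProbabilityMeasure μ ∧ MeasurePreserving σ μ μ ∧
      L ≤ mEntropy X μ + ∫ x, Φ x ∂μ := by
  have hcpt : CompactSpace X := isCompact_iff_compactSpace.1 hX.isCompact
  have hσc := shift_continuous hσ
  have hP : ∀ n : ℕ, ∃ P : ProbabilityMeasure X, 1 ≤ n →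
      (∀ A, MeasurableSet A → ((P : Measure X) A).toReal =
        ∑ i ∈ Finset.range n, (1 / (n : ℝ)) * (((ν n).map σ^[i]) A).toReal) ∧
      (∀ g : X → ℝ, Continuous g → ∫ x, g x ∂(P : Measure X) =
        (1 / (n : ℝ)) * ∫ x, birk σ g n x ∂(ν n)) := by
    intro n
    have := hν n
    by_cases hn : 1 ≤ n
    · obtain ⟨P, hP⟩ := exists_avg hX hσ (ν n) n hn
      exact ⟨P, fun _ => hP⟩
    · exact ⟨⟨ν n, hν n⟩, fun h => absurd h hn⟩
  choose P hP using hP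
  set U : Ultrafilter ℕ := hyperfilter ℕ with hU
  have hUle : (U : Filter ℕ) ≤ atTop := Nat.hyperfilter_le_atTop
  obtain ⟨μ, -, hμ⟩ := (isCompact_univ (X := ProbabilityMeasure X)).ultrafilter_le_nhds (U.map P)
    (by simp)
  have hlim : Tendsto P U (𝓝 μ) := hμ
  have hint : ∀ g : X → ℝ, Continuous g →
      Tendsto (fun n => ∫ x, g x ∂(P n : Measure X)) U (𝓝 (∫ x, g x ∂(μ : Measure X))) := by
    intro g hg
    exact ProbabilityMeasure.tendsto_iff_forall_integral_tendsto.1 hlim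
      (BoundedContinuousFunction.mkOfCompact ⟨g, hg⟩)
  have hclop : ∀ A : Set X, IsClopen A →
      Tendsto (fun n => ((P n : Measure X) A).toReal) U (𝓝 ((μ : Measure X) A).toReal) := by
    intro A hA
    have h1 := hint (A.indicator fun _ => (1:ℝ)) (continuous_const.indicator (by simp [hA.frontier_eq]))
    simpa [integral_indicator hA.isOpen.measurableSet, measureReal_def] using h1
  have hinv : (μ : Measure X).map σ = μ := by
    have : IsProbabilityMeasure ((μ : Measure X).map σ) :=
      Measure.isProbabilityMeasure_map hσc.measurable.aemeasurable
    refine ext_of_forall_integral_eq_of_IsFiniteMeasure fun g => ?_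
    have hg : Continuous g := g.continuous
    rw [integral_map hσc.measurable.aemeasurable hg.measurable.aestronglyMeasurable]
    obtain ⟨C, hC0, hC⟩ := cont_bound hX g hg
    have h1 := (hint (fun x => g (σ x)) (hg.comp hσc)).sub (hint g hg)
    have h2 : Tendsto (fun n => ∫ x, g (σ x) ∂(P n : Measure X) - ∫ x, g x ∂(P n : Measure X)) U
        (𝓝 0) := by
      have hz : Tendsto (fun n : ℕ => 2 * C * (1 / (n : ℝ))) U (𝓝 0) := by
        have : Tendsto (fun n : ℕ => 2 * C * (1 / (n : ℝ))) atTop (𝓝 (2 * C * 0)) :=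
          tendsto_one_div_atTop_nhds_zero_nat.const_mul (2 * C)
        rw [mul_zero] at this
        exact this.mono_left hUle
      refine squeeze_zero_norm' ?_ hz
      filter_upwards [hUle (eventually_ge_atTop 1)] with n hn
      have hn' : (0:ℝ) < n := by exact_mod_cast hn
      have := hν n
      rw [(hP n hn).2 (fun x => g (σ x)) (hg.comp hσc), (hP n hn).2 g hg, ← mul_sub, ← integral_sub]
      · rw [norm_mul, mul_comm, Real.norm_of_nonneg (by positivity : (0:ℝ) ≤ 1 / n)]
        refine mul_le_mul_of_nonneg_right ?_ (by positivity)
        have hb : ∀ x, ‖birk σ (fun x => g (σ x)) n x - birk σ g n x‖ ≤ 2 * C := by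
          intro x
          have e1 : birk σ (fun x => g (σ x)) n x = birk σ g n (σ x) := by
            simp only [birk]
            refine Finset.sum_congr rfl fun i _ => ?_
            rw [← Function.iterate_succ_apply, Function.iterate_succ_apply']
          have e2 := birk_succ' σ g n x
          have e3 := birk_add σ g n 1 x
          have e4 : birk σ g 1 (σ^[n] x) = g (σ^[n] x) := by simp [birk]
          rw [e1, Real.norm_eq_abs]
          have a1 := abs_le.1 (hC x)
          have a2 := abs_le.1 (hC (σ^[n] x))
          rw [abs_le]
          constructor <;> linarith
        have := norm_integral_le_of_norm_le_const (μ := ν n) (ae_of_all _ hb)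
        simpa using this
      · exact bdd_integrable (birk_measurable hσc.measurable (hg.comp hσc).measurable n) (n * C)
          (birk_abs_le _ _ (fun x => hC _) n)
      · exact bdd_integrable (birk_measurable hσc.measurable hg.measurable n) (n * C)
          (birk_abs_le _ _ hC n)
    have := tendsto_nhds_unique h1 h2
    linarith
  refine ⟨μ, inferInstance, ⟨hσc.measurable, hinv⟩, ?_⟩
  -- concavity
  have hconc : ∀ n, 1 ≤ n → ∀ q, ∑ a ∈ Finset.range n, (1 / (n:ℝ)) * Hn X ((ν n).map σ^[a]) q ≤
      Hn X (P n) q := by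
    intro n hn q
    have hn' : (0:ℝ) < n := by exact_mod_cast hn
    unfold Hn
    simp only [Finset.mul_sum]
    rw [Finset.sum_comm]
    refine Finset.sum_le_sum fun u _ => ?_
    rw [(hP n hn).1 _ (cyl_meas X u)]
    have := Real.concaveOn_negMulLog.le_map_sum (t := Finset.range n) (w := fun _ => 1 / (n:ℝ))
      (p := fun i => (((ν n).map σ^[i]) (cylSet X u)).toReal) (fun _ _ => by positivity)
      (by simp; field_simp) (fun i _ => by simp)
    simpa only [smul_eq_mul] using this
  have hq : ∀ q : ℕ, 1 ≤ q → L ≤ (1 / (q:ℝ)) * Hn X μ q + ∫ x, Φ x ∂(μ : Measure X) := by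
    intro q hq1
    have hq' : (0:ℝ) < q := by exact_mod_cast hq1
    have hHlim : Tendsto (fun n => Hn X (P n) q) U (𝓝 (Hn X μ q)) := by
      unfold Hn
      refine tendsto_finsetSum _ fun u _ => ?_
      exact (Real.continuous_negMulLog.tendsto _).comp (hclop _ (cyl_clopen X u))
    have hz : Tendsto (fun n : ℕ => 2 * (q * Real.log k) * (1 / (n : ℝ))) U (𝓝 0) := by
      have : Tendsto (fun n : ℕ => 2 * (q * Real.log k) * (1 / (n : ℝ))) atTop
          (𝓝 (2 * (q * Real.log k) * 0)) :=
        tendsto_one_div_atTop_nhds_zero_nat.const_mul _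
      rw [mul_zero] at this
      exact this.mono_left hUle
    have hsum := ((hHlim.const_mul (1 / (q:ℝ))).add (hint Φ hΦ)).add hz
    rw [add_zero] at hsum
    refine le_of_forall_pos_sub_le fun ε hε => ?_
    refine ge_of_tendsto hsum ?_
    filter_upwards [hUle (eventually_ge_atTop q), hUle (hL ε hε)] with n hn hLn
    have hn1 : 1 ≤ n := hq1.trans hn
    have hn' : (0:ℝ) < n := by exact_mod_cast hn1
    have := hν n
    have h1 := hconc n hn1 q
    rw [← Finset.mul_sum] at h1
    have h2 := Hn_ineq hσ (ν n) n q hn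
    rw [(hP n hn1).2 Φ hΦ]
    set I := ∫ x, birk σ Φ n x ∂(ν n)
    set S := ∑ a ∈ Finset.range n, Hn X ((ν n).map σ^[a]) q
    set H := Hn X (ν n) n
    have h3 : (1 / (q:ℝ)) * ((1 / (n:ℝ)) * S) ≤ (1 / (q:ℝ)) * Hn X (P n) q :=
      mul_le_mul_of_nonneg_left h1 (by positivity)
    have h4 : (1 / ((q:ℝ) * n)) * (q * H) ≤ (1 / ((q:ℝ) * n)) * (S + 2 * (q * (q * Real.log k))) :=
      mul_le_mul_of_nonneg_left h2 (by positivity)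
    have h5 : (1 / (n:ℝ)) * (n * (L - ε)) ≤ (1 / (n:ℝ)) * (H + I) :=
      mul_le_mul_of_nonneg_left hLn (by positivity)
    have e1 : (1 / ((q:ℝ) * n)) * (q * H) = (1 / (n:ℝ)) * H := by field_simp
    have e2 : (1 / ((q:ℝ) * n)) * (S + 2 * (q * (q * Real.log k))) =
        (1 / (q:ℝ)) * ((1 / (n:ℝ)) * S) + 2 * (q * Real.log k) * (1 / n) := by field_simp
    have e3 : (1 / (n:ℝ)) * (n * (L - ε)) = L - ε := by field_simp
    rw [e1, e2] at h4
    rw [e3, mul_add] at h5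
    linarith
  have hfin : L - ∫ x, Φ x ∂(μ : Measure X) ≤ mEntropy X μ := by
    unfold mEntropy
    refine le_liminf_of_le ?_ ?_
    · refine IsBoundedUnder.isCoboundedUnder_ge (isBoundedUnder_of ⟨Real.log k, fun n => ?_⟩)
      refine (abs_le.1 (abs_avg_le (logk_nonneg k) ?_)).2
      have h0 := Hn_nonneg X (μ : Measure X) n
      have h1 := Hn_le X (μ : Measure X) n
      unfold Hn at h0 h1
      rwa [abs_of_nonneg h0]
    · filter_upwards [eventually_ge_atTop 1] with q hq1
      have := hq q hq1
      unfold Hn at this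
      linarith
  linarith

/-- Atomic measures supported on one point in each cylinder. -/
lemma exists_atomic {n : ℕ} (s : Finset (Fin n → Fin k)) (hs : s.Nonempty)
    (z : (Fin n → Fin k) → X) (hz : ∀ u ∈ s, z u ∈ cylSet X u) (b : X → ℝ) (hb : Measurable b)  :
    ∃ ν : Measure X, IsProbabilityMeasure ν ∧
      Hn X ν n + ∫ x, b x ∂ν = Real.log (∑ u ∈ s, Real.exp (b (z u))) := by
  set Z := ∑ u ∈ s, Real.exp (b (z u)) with hZ
  have hZpos : 0 < Z := Finset.sum_pos (fun _ _ => Real.exp_pos _) hs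
  set p : (Fin n → Fin k) → ℝ := fun u => Real.exp (b (z u)) / Z with hp
  have hp0 : ∀ u, 0 < p u := fun u => by positivity
  have hp1 : ∑ u ∈ s, p u = 1 := by
    rw [hp, ← Finset.sum_div, ← hZ, div_self hZpos.ne']
  set ν : Measure X := ∑ u ∈ s, ENNReal.ofReal (p u) • Measure.dirac (z u) with hν
  have hint : ∀ g : X → ℝ, Measurable g → ∫ x, g x ∂ν = ∑ u ∈ s, p u * g (z u) := by
    intro g hg
    rw [hν, integral_finsetSum_measure]
    · refine Finset.sum_congr rfl fun u _ => ?_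
      rw [integral_smul_measure, integral_dirac' _ _ hg.stronglyMeasurable,
        ENNReal.toReal_ofReal (hp0 u).le, smul_eq_mul]
    · intro u _
      refine Integrable.smul_measure ?_ ENNReal.ofReal_ne_top
      exact integrable_dirac' hg.stronglyMeasurable (by simp)
  have hprob : IsProbabilityMeasure ν := by
    constructor
    rw [hν, Measure.finsetSum_apply]
    simp only [Measure.smul_apply, measure_univ, smul_eq_mul, mul_one]
    rw [← ENNReal.ofReal_sum_of_nonneg fun u _ => (hp0 u).le, hp1, ENNReal.ofReal_one]
  have hcyl : ∀ u, (ν (cylSet X u)).toReal = if u ∈ s then p u else 0 := by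
    intro u
    have h1 : (ν (cylSet X u)).toReal = ∫ x, (cylSet X u).indicator (fun _ => (1:ℝ)) x ∂ν := by
      simp [integral_indicator (cyl_meas X u), measureReal_def]
    rw [h1, hint _ (measurable_const.indicator (cyl_meas X u))]
    have h2 : ∀ v ∈ s, p v * (cylSet X u).indicator (fun _ => (1:ℝ)) (z v) =
        if u = v then p v else 0 := by
      intro v hv
      have h3 := (mem_cyl X v (z v)).1 (hz v hv)
      by_cases huv : u = v
      · subst huv
        simp [Set.indicator_of_mem (hz u hv)]
      · have : z v ∉ cylSet X u := by
          rw [mem_cyl, h3]; exact fun h => huv h.symm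
        simp [Set.indicator_of_notMem this, huv]
    rw [Finset.sum_congr rfl h2, Finset.sum_ite_eq]
  refine ⟨ν, hprob, ?_⟩
  rw [hint b hb]
  unfold Hn
  simp only [hcyl]
  have h4 : ∑ u, Real.negMulLog (if u ∈ s then p u else 0) = ∑ u ∈ s, Real.negMulLog (p u) := by
    rw [← Finset.sum_filter_add_sum_filter_not Finset.univ (· ∈ s)]
    have : ∑ u with u ∉ s, Real.negMulLog (if u ∈ s then p u else 0) = 0 :=
      Finset.sum_eq_zero fun u hu => by
        rw [if_neg (Finset.mem_filter.1 hu).2, Real.negMulLog_zero]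
    rw [this, add_zero]
    simp only [Finset.filter_mem_eq_inter, Finset.univ_inter]
    exact Finset.sum_congr rfl fun u hu => by rw [if_pos hu]
  rw [h4, ← Finset.sum_add_distrib]
  have h5 : ∀ u ∈ s, Real.negMulLog (p u) + p u * b (z u) = p u * Real.log Z := by
    intro u _
    rw [Real.negMulLog]
    have : Real.log (p u) = b (z u) - Real.log Z := by
      rw [hp]
      simp only
      rw [Real.log_div (Real.exp_pos _).ne' hZpos.ne', Real.log_exp]
    rw [this]
    ring
  rw [Finset.sum_congr rfl h5, ← Finset.sum_mul, hp1, one_mul]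

/-- Bounded distortion. -/
lemma unif_cyl (hX : IsClosed X) (ψ : X → ℝ) (hψ : Continuous ψ) (ε : ℝ) (hε : 0 < ε) :
    ∃ r : ℕ, ∀ x x' : X, (∀ i < r, (x : ℕ → Fin k) i = (x' : ℕ → Fin k) i) →
      |ψ x - ψ x'| ≤ ε := by
  have hcpt : CompactSpace X := isCompact_iff_compactSpace.1 hX.isCompact
  by_contra hcon
  push Not at hcon
  choose x x' hag hgt using hcon
  have hK : IsClosed {z : X × X | ε ≤ |ψ z.1 - ψ z.2|} :=
    isClosed_le continuous_const (by fun_prop)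
  set U : Ultrafilter ℕ := hyperfilter ℕ with hU
  have hUle : (U : Filter ℕ) ≤ atTop := Nat.hyperfilter_le_atTop
  obtain ⟨z, -, hz⟩ := (isCompact_univ (X := X × X)).ultrafilter_le_nhds
    (U.map fun r => (x r, x' r)) (by simp)
  have hlim : Tendsto (fun r => (x r, x' r)) U (𝓝 z) := hz
  have h1 : Tendsto (fun r => |ψ (x r) - ψ (x' r)|) U (𝓝 |ψ z.1 - ψ z.2|) := by
    have hc : Continuous fun z : X × X => |ψ z.1 - ψ z.2| := by fun_prop
    exact (hc.tendsto z).comp hlim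
  have h2 : ε ≤ |ψ z.1 - ψ z.2| := ge_of_tendsto' h1 fun r => (hgt r).le
  have h3 : z.1 = z.2 := by
    apply Subtype.ext
    funext i
    have c1 : Continuous fun z : X × X => (z.1 : ℕ → Fin k) i :=
      (continuous_apply i).comp (continuous_subtype_val.comp continuous_fst)
    have c2 : Continuous fun z : X × X => (z.2 : ℕ → Fin k) i :=
      (continuous_apply i).comp (continuous_subtype_val.comp continuous_snd)
    have t1 := (c1.tendsto z).comp hlim
    have t2 := (c2.tendsto z).comp hlim
    refine tendsto_nhds_unique (t1.congr' ?_) t2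
    filter_upwards [hUle (eventually_gt_atTop i)] with r hr
    exact hag r i hr
  rw [h3, sub_self, abs_zero] at h2
  linarith

lemma distortion (hX : IsClosed X)
    (hσ : ∀ x : X, (σ x : ℕ → Fin k) = shiftMap (x : ℕ → Fin k))
    (ψ : X → ℝ) (hψ : Continuous ψ) (ε : ℝ) (hε : 0 < ε) :
    ∃ c : ℝ, 0 ≤ c ∧ ∀ (n : ℕ) (x x' : X), wd X n x = wd X n x' →
      birk σ ψ n x ≤ birk σ ψ n x' + (n * ε + c) := by
  obtain ⟨C, hC0, hC⟩ := cont_bound hX ψ hψ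
  obtain ⟨r, hr⟩ := unif_cyl hX ψ hψ ε hε
  refine ⟨r * (2 * C), by positivity, fun n x x' hxx => ?_⟩
  have hag : ∀ i < n, (x : ℕ → Fin k) i = (x' : ℕ → Fin k) i := fun i hi =>
    congrFun hxx ⟨i, hi⟩
  have hterm : ∀ i ∈ Finset.range n, ψ (σ^[i] x) - ψ (σ^[i] x') ≤
      ε + if n < i + r then 2 * C else 0 := by
    intro i hi
    split_ifs with hir
    · have a1 := abs_le.1 (hC (σ^[i] x))
      have a2 := abs_le.1 (hC (σ^[i] x'))
      linarith
    · have := hr (σ^[i] x) (σ^[i] x') fun j hj => by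
        rw [iter_apply hσ, iter_apply hσ]
        exact hag _ (by omega)
      have := (abs_le.1 this).2
      linarith
  have h1 := Finset.sum_le_sum hterm
  rw [Finset.sum_sub_distrib, Finset.sum_add_distrib, Finset.sum_const, Finset.card_range,
    nsmul_eq_mul, ← Finset.sum_filter, Finset.sum_const, nsmul_eq_mul] at h1
  have h2 : ((Finset.range n).filter fun i => n < i + r).card ≤ r := by
    have : ((Finset.range n).filter fun i => n < i + r) ⊆ Finset.Ico (n - r) n := by
      intro i hi
      simp only [Finset.mem_filter, Finset.mem_range] at hi
      rw [Finset.mem_Ico]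
      omega
    refine (Finset.card_le_card this).trans ?_
    simp
    omega
  have h3 : (((Finset.range n).filter fun i => n < i + r).card : ℝ) * (2 * C) ≤ r * (2 * C) :=
    mul_le_mul_of_nonneg_right (by exact_mod_cast h2) (by positivity)
  unfold birk
  linarith
end mis


/-- supremum of Birkhoff sums over a cylinder -/
noncomputable def Fs {k : ℕ} (X : Set (ℕ → Fin k)) (σ : X → X) (f : X → ℝ) (n : ℕ)
    (u : Fin n → Fin k) : ℝ := sSup (birk σ f n '' cylSet X u)

open Classical in
/-- weighted count of the words seen by points satisfying `R` -/
noncomputable def Wt {k : ℕ} (X : Set (ℕ → Fin k)) (σ : X → X) (f : X → ℝ) (n : ℕ)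
    (R : X → Prop) : ℝ :=
  ∑ u : Fin n → Fin k, if ∃ x ∈ cylSet X u, R x then Real.exp (Fs X σ f n u) else 0

section basic
variable {k : ℕ} {X : Set (ℕ → Fin k)} {σ : X → X} {f : X → ℝ} {C : ℝ}

lemma le_Fs (hC : ∀ x, |f x| ≤ C) {n : ℕ} {u : Fin n → Fin k} {x : X} (hx : x ∈ cylSet X u) :
    birk σ f n x ≤ Fs X σ f n u :=
  le_csSup ⟨n * C, by rintro _ ⟨z, -, rfl⟩; exact (abs_le.1 (birk_abs_le σ f hC n z)).2⟩
    ⟨x, hx, rfl⟩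

lemma Fs_le {n : ℕ} {u : Fin n → Fin k} {x : X} (hx : x ∈ cylSet X u) {a : ℝ}
    (h : ∀ x ∈ cylSet X u, birk σ f n x ≤ a) : Fs X σ f n u ≤ a :=
  csSup_le ⟨_, x, hx, rfl⟩ (by rintro _ ⟨z, hz, rfl⟩; exact h z hz)

lemma Wt_mono (n : ℕ) {R R' : X → Prop} (h : ∀ x, R x → R' x) : Wt X σ f n R ≤ Wt X σ f n R' := by
  unfold Wt
  refine Finset.sum_le_sum fun u _ => ?_
  split_ifs with h1 h2 h2
  · exact le_rfl
  · obtain ⟨x, hx, hR⟩ := h1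
    exact absurd ⟨x, hx, h x hR⟩ h2
  · positivity
  · exact le_rfl

lemma Wt_le (hC : ∀ x, |f x| ≤ C) (n : ℕ) (R : X → Prop) (x0 : X) :
    Wt X σ f n R ≤ Real.exp (n * (C + Real.log k)) := by
  have hk : (0:ℝ) < k := by
    have := ((x0 : ℕ → Fin k) 0).pos
    exact_mod_cast this
  classical
  unfold Wt
  have h1 : ∀ u ∈ (Finset.univ : Finset (Fin n → Fin k)),
      (if ∃ x ∈ cylSet X u, R x then Real.exp (Fs X σ f n u) else 0) ≤ Real.exp (n * C) := by
    intro u _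
    split_ifs with h
    · obtain ⟨x, hx, -⟩ := h
      exact Real.exp_le_exp.2 (Fs_le hx fun z _ => (abs_le.1 (birk_abs_le σ f hC n z)).2)
    · positivity
  refine (Finset.sum_le_sum h1).trans ?_
  rw [Finset.sum_const, nsmul_eq_mul, mul_add, Real.exp_add, mul_comm]
  refine mul_le_mul_of_nonneg_left ?_ (by positivity)
  rw [Real.exp_nat_mul, Real.exp_log hk]
  simp

lemma le_Wt (hC : ∀ x, |f x| ≤ C) (n : ℕ) (R : X → Prop) {x : X} (hx : R x) :
    Real.exp (-(n * C)) ≤ Wt X σ f n R := by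
  classical
  have h0 : x ∈ cylSet X (wd X n x) := (mem_cyl X _ _).2 rfl
  have h1 : Real.exp (-(n * C)) ≤ Real.exp (Fs X σ f n (wd X n x)) := by
    refine Real.exp_le_exp.2 (le_trans ?_ (le_Fs (σ := σ) hC h0))
    exact (abs_le.1 (birk_abs_le σ f hC n x)).1
  refine h1.trans ?_
  unfold Wt
  have := Finset.single_le_sum (s := Finset.univ) (a := wd X n x)
    (f := fun u => if ∃ x ∈ cylSet X u, R x then Real.exp (Fs X σ f n u) else 0)
    (fun u _ => by split_ifs <;> positivity) (Finset.mem_univ _)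
  rw [if_pos ⟨x, h0, hx⟩] at this
  exact this

lemma Wt_pos (hC : ∀ x, |f x| ≤ C) (n : ℕ) (R : X → Prop) {x : X} (hx : R x) :
    0 < Wt X σ f n R := (Real.exp_pos _).trans_le (le_Wt hC n R hx)

lemma log_Wt_abs (hC0 : 0 ≤ C) (hC : ∀ x, |f x| ≤ C) (n : ℕ) (R : X → Prop) {x : X} (hx : R x) :
    |Real.log (Wt X σ f n R)| ≤ n * (C + Real.log k) := by
  have h1 := Real.log_le_log (Real.exp_pos _) (le_Wt (σ := σ) hC n R hx)
  have h2 := Real.log_le_log (Wt_pos (σ := σ) hC n R hx) (Wt_le hC n R x)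
  rw [Real.log_exp] at h1 h2
  rw [abs_le]
  refine ⟨le_trans ?_ h1, h2⟩
  have := logk_nonneg k
  have : 0 ≤ (n:ℝ) * Real.log k := by positivity
  linarith
end basic

/-- the standing assumptions -/
structure SU {k l : ℕ} (X : Set (ℕ → Fin k)) (Y : Set (ℕ → Fin l)) (σX : X → X) (σY : Y → Y)
    (π : X → Y) (f : X → ℝ) (C : ℝ) : Prop where
  hX : IsClosed X
  hY : IsClosed Y
  hσX : ∀ x : X, (σX x : ℕ → Fin k) = shiftMap (x : ℕ → Fin k)
  hσY : ∀ y : Y, (σY y : ℕ → Fin l) = shiftMap (y : ℕ → Fin l)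
  hπc : Continuous π
  hπs : Function.Surjective π
  hπcomm : ∀ x, π (σX x) = σY (π x)
  hf : Continuous f
  hC0 : 0 ≤ C
  hC : ∀ x, |f x| ≤ C

/-- weighted count of `n`-words which extend to points over `y_0 … y_{N-1}` -/
noncomputable def Gs {k l : ℕ} {X : Set (ℕ → Fin k)} {Y : Set (ℕ → Fin l)} (σX : X → X)
    (π : X → Y) (f : X → ℝ) (n N : ℕ) (y : Y) : ℝ :=
  Wt X σX f n fun x => wd Y N (π x) = wd Y N y

/-- weighted count of `n`-words of points in the fiber of `y` -/
noncomputable def Ds {k l : ℕ} {X : Set (ℕ → Fin k)} {Y : Set (ℕ → Fin l)} (σX : X → X)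
    (π : X → Y) (f : X → ℝ) (n : ℕ) (y : Y) : ℝ :=
  Wt X σX f n fun x => π x = y

section main
variable {k l : ℕ} {X : Set (ℕ → Fin k)} {Y : Set (ℕ → Fin l)} {σX : X → X} {σY : Y → Y}
  {π : X → Y} {f : X → ℝ} {C : ℝ}

lemma SU.comm (S : SU X Y σX σY π f C) (n : ℕ) (x : X) : π (σX^[n] x) = σY^[n] (π x) := by
  induction n generalizing x with
  | zero => rfl
  | succ n ih => rw [Function.iterate_succ_apply, ih, S.hπcomm, Function.iterate_succ_apply]

lemma SU.Gs_meas (_ : SU X Y σX σY π f C) (n N : ℕ) : Measurable (Gs σX π f n N) := by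
  have : Gs σX π f n N = (fun w => Wt X σX f n fun x => wd Y N (π x) = w) ∘ wd Y N := rfl
  rw [this]
  exact (measurable_of_finite _).comp (wd_measurable Y N)

lemma SU.Ds_meas (S : SU X Y σX σY π f C) (n : ℕ) : Measurable (Ds σX π f n) := by
  have hcpt : CompactSpace X := isCompact_iff_compactSpace.1 S.hX.isCompact
  unfold Ds Wt
  refine Finset.measurable_fun_sum _ fun u _ => ?_
  refine Measurable.ite ?_ measurable_const measurable_const
  have : {y : Y | ∃ x ∈ cylSet X u, π x = y} = π '' cylSet X u := rfl
  rw [this]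
  exact ((cyl_clopen X u).isClosed.isCompact.image S.hπc).isClosed.measurableSet

lemma SU.Gs_abs (S : SU X Y σX σY π f C) (n N : ℕ) (y : Y) :
    |Real.log (Gs σX π f n N y)| ≤ n * (C + Real.log k) := by
  obtain ⟨x, rfl⟩ := S.hπs y
  exact log_Wt_abs S.hC0 S.hC n _ (x := x) rfl

lemma SU.Ds_abs (S : SU X Y σX σY π f C) (n : ℕ) (y : Y) :
    |Real.log (Ds σX π f n y)| ≤ n * (C + Real.log k) := by
  obtain ⟨x, rfl⟩ := S.hπs y
  exact log_Wt_abs S.hC0 S.hC n _ (x := x) rfl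

lemma SU.Gs_pos (S : SU X Y σX σY π f C) (n N : ℕ) (y : Y) : 0 < Gs σX π f n N y := by
  obtain ⟨x, rfl⟩ := S.hπs y
  exact Wt_pos S.hC n _ (x := x) rfl

lemma SU.Ds_pos (S : SU X Y σX σY π f C) (n : ℕ) (y : Y) : 0 < Ds σX π f n y := by
  obtain ⟨x, rfl⟩ := S.hπs y
  exact Wt_pos S.hC n _ (x := x) rfl

lemma wd_mono {Y : Set (ℕ → Fin l)} {n N : ℕ} (h : n ≤ N) {y y' : Y}
    (e : wd Y N y = wd Y N y') : wd Y n y = wd Y n y' :=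
  funext fun i => congrFun e ⟨i, i.2.trans_le h⟩

lemma SU.Gs_step (S : SU X Y σX σY π f C) (n M N : ℕ) (hN : N ≤ n + M) (y : Y) :
    Gs σX π f (n + M) (n + M) y ≤ Gs σX π f n N y * Gs σX π f M M (σY^[n] y) := by
  classical
  unfold Gs Wt
  rw [Finset.sum_mul_sum, ← Finset.sum_product', Finset.univ_product_univ,
    ← Equiv.sum_comp (Fin.appendEquiv n M)]
  refine Finset.sum_le_sum fun p _ => ?_
  obtain ⟨u, v⟩ := p
  have hap : (Fin.appendEquiv n M) (u, v) = Fin.append u v := rfl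
  rw [hap]
  split_ifs with h1 h2 h3 h3 <;> try positivity
  · obtain ⟨x, hx, -⟩ := h1
    rw [← Real.exp_add]
    refine Real.exp_le_exp.2 (Fs_le hx fun z hz => ?_)
    have hz' := (cyl_append S.hσX u v z).1 hz
    rw [birk_add]
    exact add_le_add (le_Fs S.hC hz'.1) (le_Fs S.hC hz'.2)
  all_goals
    exfalso
    obtain ⟨x, hx, hw⟩ := h1
    have hx' := (cyl_append S.hσX u v x).1 hx
    first
    | exact h2 ⟨x, hx'.1, wd_mono hN hw⟩
    | refine h3 ⟨σX^[n] x, hx'.2, ?_⟩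
      show wd Y M (π (σX^[n] x)) = wd Y M (σY^[n] y)
      rw [S.comm]
      funext i
      simp only [wd, iter_apply S.hσY]
      exact congrFun hw (Fin.natAdd n i)

lemma SU.log_step (S : SU X Y σX σY π f C) (n M N : ℕ) (hN : N ≤ n + M) (y : Y) :
    Real.log (Gs σX π f (n + M) (n + M) y) ≤
      Real.log (Gs σX π f n N y) + Real.log (Gs σX π f M M (σY^[n] y)) := by
  rw [← Real.log_mul (S.Gs_pos _ _ _).ne' (S.Gs_pos _ _ _).ne']
  exact Real.log_le_log (S.Gs_pos _ _ _) (S.Gs_step n M N hN y)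

lemma SU.Gs_lim (S : SU X Y σX σY π f C) (n : ℕ) (y : Y) :
    ∀ᶠ N in atTop, Gs σX π f n N y = Ds σX π f n y := by
  classical
  have hcpt : CompactSpace X := isCompact_iff_compactSpace.1 S.hX.isCompact
  have key : ∀ u : Fin n → Fin k, ∀ᶠ N in atTop,
      ((∃ x ∈ cylSet X u, wd Y N (π x) = wd Y N y) ↔ ∃ x ∈ cylSet X u, π x = y) := by
    intro u
    by_cases hu : ∃ x ∈ cylSet X u, π x = y
    · obtain ⟨x, hx, rfl⟩ := hu
      exact Eventually.of_forall fun N => ⟨fun _ => ⟨x, hx, rfl⟩, fun _ => ⟨x, hx, rfl⟩⟩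
    · have : ∃ N, ¬ ∃ x ∈ cylSet X u, wd Y N (π x) = wd Y N y := by
        by_contra hcon
        push Not at hcon
        choose x hx hw using hcon
        set U : Ultrafilter ℕ := hyperfilter ℕ with hU
        have hUle : (U : Filter ℕ) ≤ atTop := Nat.hyperfilter_le_atTop
        obtain ⟨z, -, hz⟩ := (isCompact_univ (X := X)).ultrafilter_le_nhds (U.map x) (by simp)
        have hlim : Tendsto x U (𝓝 z) := hz
        refine hu ⟨z, (cyl_clopen X u).isClosed.mem_of_tendsto hlim (Eventually.of_forall hx), ?_⟩
        apply Subtype.ext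
        funext i
        have c1 : Continuous fun z : X => ((π z : Y) : ℕ → Fin l) i :=
          (continuous_apply i).comp (continuous_subtype_val.comp S.hπc)
        have t1 := (c1.tendsto z).comp hlim
        refine tendsto_nhds_unique (t1.congr' ?_) tendsto_const_nhds
        filter_upwards [hUle (eventually_gt_atTop i)] with r hr
        exact congrFun (hw r) ⟨i, hr⟩
      obtain ⟨N, hN⟩ := this
      filter_upwards [eventually_ge_atTop N] with N' hN'
      refine iff_of_false (fun h => hN ?_) hu
      obtain ⟨x, hx, hw⟩ := h
      exact ⟨x, hx, wd_mono hN' hw⟩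
  filter_upwards [eventually_all.2 key] with N hN
  unfold Gs Ds Wt
  refine Finset.sum_congr rfl fun u _ => ?_
  simp only [hN u]

lemma SU.logG_int (S : SU X Y σX σY π f C) (m : Measure Y) [IsProbabilityMeasure m] (n N : ℕ) :
    Integrable (fun y => Real.log (Gs σX π f n N y)) m :=
  bdd_integrable (Real.measurable_log.comp (S.Gs_meas n N)) _ (S.Gs_abs n N)

lemma SU.logD_int (S : SU X Y σX σY π f C) (m : Measure Y) [IsProbabilityMeasure m] (n : ℕ) :
    Integrable (fun y => Real.log (Ds σX π f n y)) m :=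
  bdd_integrable (Real.measurable_log.comp (S.Ds_meas n)) _ (S.Ds_abs n)

lemma integral_iter {Ω : Type*} [MeasurableSpace Ω] (m : Measure Ω) (T : Ω → Ω)
    (hT : MeasurePreserving T m m) (g : Ω → ℝ) (hg : Measurable g) (n : ℕ) :
    ∫ x, g (T^[n] x) ∂m = ∫ x, g x ∂m := by
  have h := hT.iterate n
  have := integral_map (μ := m) h.measurable.aemeasurable (f := g) hg.aestronglyMeasurable
  rw [h.map_eq] at this
  exact this.symm

lemma SU.int_step (S : SU X Y σX σY π f C) (m : Measure Y) [IsProbabilityMeasure m]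
    (hm : MeasurePreserving σY m m) (n M N : ℕ) (hN : N ≤ n + M) :
    ∫ y, Real.log (Gs σX π f (n + M) (n + M) y) ∂m ≤
      ∫ y, Real.log (Gs σX π f n N y) ∂m + ∫ y, Real.log (Gs σX π f M M y) ∂m := by
  have hmeas := Real.measurable_log.comp (S.Gs_meas M M)
  rw [← integral_iter m σY hm (fun y => Real.log (Gs σX π f M M y)) hmeas n,
    ← integral_add (S.logG_int m n N)]
  · refine integral_mono (S.logG_int m _ _) ?_ fun y => S.log_step n M N hN y
    exact (S.logG_int m _ _).add
      (((hm.iterate n).integrable_comp hmeas.aestronglyMeasurable).2 (S.logG_int m M M))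
  · exact ((hm.iterate n).integrable_comp hmeas.aestronglyMeasurable).2 (S.logG_int m M M)

lemma K_nonneg (S : SU X Y σX σY π f C) : 0 ≤ C + Real.log k := add_nonneg S.hC0 (logk_nonneg k)

lemma int_abs_le {Ω : Type*} [MeasurableSpace Ω] (m : Measure Ω) [IsProbabilityMeasure m]
    (g : Ω → ℝ) (c : ℝ) (hg : ∀ x, |g x| ≤ c) : |∫ x, g x ∂m| ≤ c := by
  have := norm_integral_le_of_norm_le_const (μ := m) (f := g) (C := c) (ae_of_all _ hg)
  simpa using this

lemma SU.exists_lim (S : SU X Y σX σY π f C) (m : Measure Y) [IsProbabilityMeasure m]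
    (hm : MeasurePreserving σY m m) :
    ∃ Λ : ℝ, Tendsto (fun n : ℕ => (1 / (n:ℝ)) * ∫ y, Real.log (Gs σX π f n n y) ∂m) atTop (𝓝 Λ) ∧
      (∀ n : ℕ, 1 ≤ n → Λ ≤ (1 / (n:ℝ)) * ∫ y, Real.log (Ds σX π f n y) ∂m) := by
  set a : ℕ → ℝ := fun n => ∫ y, Real.log (Gs σX π f n n y) ∂m with ha
  have hsub : Subadditive a := fun n M => S.int_step m hm n M n (by omega)
  have hab : ∀ n, |a n| ≤ n * (C + Real.log k) := fun n => int_abs_le m _ _ (S.Gs_abs n n)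
  have hbdd : BddBelow (Set.range fun n => a n / n) := by
    refine ⟨-(C + Real.log k), ?_⟩
    rintro _ ⟨n, rfl⟩
    have := (abs_le.1 (abs_avg_le (K_nonneg S) (hab n))).1
    rwa [one_div, inv_mul_eq_div] at this
  have ht := hsub.tendsto_lim hbdd
  refine ⟨hsub.lim, ?_, ?_⟩
  · refine ht.congr fun n => ?_
    rw [one_div, inv_mul_eq_div]
  · intro n hn
    have hn' : (0:ℝ) < n := by exact_mod_cast hn
    have hNbd : ∀ N, hsub.lim ≤ (1 / (n:ℝ)) * ∫ y, Real.log (Gs σX π f n N y) ∂m := by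
      intro N
      set b := ∫ y, Real.log (Gs σX π f n N y) ∂m with hb
      have hq : ∀ q : ℕ, a (q * n + N) ≤ q * b + a N := by
        intro q
        induction q with
        | zero => simp
        | succ q ih =>
          have := S.int_step m hm n (q * n + N) N (by omega)
          rw [show n + (q * n + N) = (q + 1) * n + N by ring] at this
          push_cast
          simp only [ha] at ih ⊢
          linarith
      have hle : ∀ q : ℕ, 1 ≤ q → hsub.lim * (q * n + N) ≤ q * b + a N := by
        intro q hq1
        have hne : q * n + N ≠ 0 := by positivity
        have h1 := hsub.lim_le_div hbdd hne
        rw [le_div_iff₀ (by positivity)] at h1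
        push_cast at h1
        exact h1.trans (hq q)
      have hlim2 : Tendsto (fun q : ℕ => (1 / (q:ℝ)) * (hsub.lim * N - a N)) atTop (𝓝 0) := by
        simpa only [zero_mul] using
          (tendsto_one_div_atTop_nhds_zero_nat (𝕜 := ℝ)).mul_const (hsub.lim * N - a N)
      have : 0 ≤ b - hsub.lim * n := by
        refine le_of_tendsto hlim2 ?_
        filter_upwards [eventually_ge_atTop 1] with q hq1
        have hq' : (0:ℝ) < q := by exact_mod_cast hq1
        rw [one_div, inv_mul_le_iff₀ hq']
        have := hle q hq1
        linarith
      rw [one_div, le_inv_mul_iff₀ hn']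
      linarith
    have hlimN : Tendsto (fun N => ∫ y, Real.log (Gs σX π f n N y) ∂m) atTop
        (𝓝 (∫ y, Real.log (Ds σX π f n y) ∂m)) := by
      refine tendsto_integral_of_dominated_convergence (fun _ => n * (C + Real.log k))
        (fun N => (S.logG_int m n N).aestronglyMeasurable) (integrable_const _)
        (fun N => ae_of_all _ fun y => S.Gs_abs n N y) (ae_of_all _ fun y => ?_)
      refine tendsto_const_nhds.congr' ?_
      filter_upwards [S.Gs_lim n y] with N hN
      rw [hN]
    exact ge_of_tendsto' (hlimN.const_mul _) hNbd

/-- upper limit function -/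
noncomputable def p2 (σX : X → X) (π : X → Y) (f : X → ℝ) (y : Y) : ℝ :=
  limsup (fun n : ℕ => (1 / (n:ℝ)) * Real.log (Gs σX π f n n y)) atTop

/-- lower function -/
noncomputable def p1 (σX : X → X) (π : X → Y) (f : X → ℝ) (y : Y) : ℝ :=
  limsup (fun n : ℕ => (1 / (n:ℝ)) * Real.log (Ds σX π f n y)) atTop

lemma SU.Gavg_abs (S : SU X Y σX σY π f C) (n N : ℕ) (y : Y) :
    |(1 / (n:ℝ)) * Real.log (Gs σX π f n N y)| ≤ C + Real.log k :=
  abs_avg_le (K_nonneg S) (S.Gs_abs n N y)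

lemma SU.Davg_abs (S : SU X Y σX σY π f C) (n : ℕ) (y : Y) :
    |(1 / (n:ℝ)) * Real.log (Ds σX π f n y)| ≤ C + Real.log k :=
  abs_avg_le (K_nonneg S) (S.Ds_abs n y)

lemma SU.p2_meas (S : SU X Y σX σY π f C) : Measurable (p2 σX π f) :=
  Measurable.limsup fun n => (Real.measurable_log.comp (S.Gs_meas n n)).const_mul _

lemma SU.p1_meas (S : SU X Y σX σY π f C) : Measurable (p1 σX π f) :=
  Measurable.limsup fun n => (Real.measurable_log.comp (S.Ds_meas n)).const_mul _

lemma SU.p2_int (S : SU X Y σX σY π f C) (m : Measure Y) [IsProbabilityMeasure m] :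
    Integrable (p2 σX π f) m :=
  bdd_integrable S.p2_meas (C + Real.log k) fun y => limsup_abs_le fun n => S.Gavg_abs n n y

lemma SU.p1_int (S : SU X Y σX σY π f C) (m : Measure Y) [IsProbabilityMeasure m] :
    Integrable (p1 σX π f) m :=
  bdd_integrable S.p1_meas (C + Real.log k) fun y => limsup_abs_le fun n => S.Davg_abs n y

lemma SU.int_p2_le (S : SU X Y σX σY π f C) (m : Measure Y) [IsProbabilityMeasure m]
    (hm : MeasurePreserving σY m m) (N : ℕ) (hN : 1 ≤ N) :
    ∫ y, p2 σX π f y ∂m ≤ (1 / (N:ℝ)) * ∫ y, Real.log (Gs σX π f N N y) ∂m := by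
  have hN' : (0:ℝ) < N := by exact_mod_cast hN
  set K := C + Real.log k with hK
  have hK0 : 0 ≤ K := K_nonneg S
  set g : Y → ℝ := fun y => Real.log (Gs σX π f N N y) with hg
  have hgm : Measurable g := Real.measurable_log.comp (S.Gs_meas N N)
  have hgb : ∀ y, |g y| ≤ N * K := S.Gs_abs N N
  obtain ⟨hBm, hBle⟩ := half_birkhoff m (σY^[N]) (hm.iterate N) g hgm (N * K) (by positivity) hgb
  set B : Y → ℝ := fun y => limsup (fun n : ℕ => (1 / (n : ℝ)) * birk (σY^[N]) g n y) atTop with hB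
  have hab : ∀ y (n : ℕ), |(1 / (n : ℝ)) * birk (σY^[N]) g n y| ≤ N * K := fun y n =>
    abs_avg_le (by positivity) (birk_abs_le _ g hgb n y)
  have hBb : ∀ y, |B y| ≤ N * K := fun y => limsup_abs_le (hab y)
  -- log G_{qN+r} ≤ S_q g + r K
  have hq : ∀ (q r : ℕ) (y : Y), Real.log (Gs σX π f (q * N + r) (q * N + r) y) ≤
      birk (σY^[N]) g q y + r * K := by
    intro q
    induction q with
    | zero =>
      intro r y
      rw [birk_zero, zero_mul, zero_add, zero_add]
      exact (abs_le.1 (S.Gs_abs r r y)).2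
    | succ q ih =>
      intro r y
      have h1 := S.log_step N (q * N + r) N (by omega) y
      rw [show N + (q * N + r) = (q + 1) * N + r by ring] at h1
      have h2 := ih r (σY^[N] y)
      rw [birk_succ']
      simp only [hg] at h2 ⊢
      linarith
  have hpt : ∀ y, p2 σX π f y ≤ (1 / (N:ℝ)) * B y := by
    intro y
    refine le_of_forall_pos_le_add fun ε hε => ?_
    set c := (1 / (N:ℝ)) * B y + ε / 2 with hc
    have hbu : IsBoundedUnder (· ≤ ·) atTop fun n : ℕ => (1 / (n : ℝ)) * birk (σY^[N]) g n y :=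
      isBoundedUnder_of ⟨N * K, fun n => (abs_le.1 (hab y n)).2⟩
    have hlt : B y < N * c := by
      rw [hc, mul_add]
      have : (N:ℝ) * (1 / N * B y) = B y := by field_simp
      rw [this]
      have : 0 < (N:ℝ) * (ε / 2) := by positivity
      linarith
    have hev : ∀ᶠ q : ℕ in atTop, (1 / (q : ℝ)) * birk (σY^[N]) g q y < N * c :=
      eventually_lt_of_limsup_lt hlt hbu
    have hdiv : Tendsto (fun n : ℕ => n / N) atTop atTop :=
      Nat.tendsto_div_const_atTop (by omega)
    have hz : Tendsto (fun n : ℕ => (1 / (n:ℝ)) * (N * |c| + N * K)) atTop (𝓝 0) := by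
      simpa only [zero_mul] using
        (tendsto_one_div_atTop_nhds_zero_nat (𝕜 := ℝ)).mul_const (N * |c| + N * K)
    refine limsup_le_of_le (IsBoundedUnder.isCoboundedUnder_le
      (isBoundedUnder_of ⟨-K, fun n => (abs_le.1 (S.Gavg_abs n n y)).1⟩)) ?_
    filter_upwards [hdiv.eventually hev, hdiv.eventually (eventually_ge_atTop 1),
      eventually_ge_atTop 1, hz.eventually_lt_const (by linarith : (0:ℝ) < ε / 2)]
      with n h1 h2 h3 h4
    have hn' : (0:ℝ) < n := by exact_mod_cast h3
    have hq' : (0:ℝ) < ((n / N : ℕ) : ℝ) := by exact_mod_cast h2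
    have h5 := hq (n / N) (n % N) y
    rw [Nat.div_add_mod'] at h5
    rw [one_div, inv_mul_lt_iff₀ hq'] at h1
    have h6 : (n:ℝ) = ((n / N : ℕ) : ℝ) * N + ((n % N : ℕ) : ℝ) := by
      exact_mod_cast (Nat.div_add_mod' n N).symm
    have h7 : ((n % N : ℕ) : ℝ) ≤ N := by exact_mod_cast (Nat.mod_lt n (by omega)).le
    have h8 : ((n / N : ℕ) : ℝ) * (N * c) ≤ n * c + N * |c| := by
      have e : ((n / N : ℕ) : ℝ) * (N * c) = n * c - ((n % N : ℕ) : ℝ) * c := by rw [h6]; ring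
      rw [e]
      have h9 : -(((n % N : ℕ) : ℝ) * c) ≤ ((n % N : ℕ) : ℝ) * |c| := by
        rw [← mul_neg]
        exact mul_le_mul_of_nonneg_left (neg_le_abs c) (Nat.cast_nonneg _)
      have h10 : ((n % N : ℕ) : ℝ) * |c| ≤ N * |c| := mul_le_mul_of_nonneg_right h7 (abs_nonneg c)
      linarith
    have h11 : ((n % N : ℕ) : ℝ) * K ≤ N * K := mul_le_mul_of_nonneg_right h7 hK0
    have h12 : Real.log (Gs σX π f n n y) ≤ n * c + (N * |c| + N * K) := by linarith
    have h13 := mul_le_mul_of_nonneg_left h12 (by positivity : (0:ℝ) ≤ 1 / n)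
    rw [mul_add] at h13
    have e : 1 / (n:ℝ) * (n * c) = c := by field_simp
    rw [e] at h13
    linarith
  calc ∫ y, p2 σX π f y ∂m ≤ ∫ y, (1 / (N:ℝ)) * B y ∂m :=
        integral_mono (S.p2_int m) ((bdd_integrable hBm _ hBb).const_mul _) hpt
    _ = (1 / (N:ℝ)) * ∫ y, B y ∂m := integral_const_mul _ _
    _ ≤ _ := mul_le_mul_of_nonneg_left hBle (by positivity)
end main


section relpress
variable {k l : ℕ} {X : Set (ℕ → Fin k)} {Y : Set (ℕ → Fin l)} {σX : X → X} {σY : Y → Y}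
  {π : X → Y} {f : X → ℝ} {C : ℝ}

lemma sum_le_Wt (n : ℕ) (R : X → Prop) (E : Finset X)
    (hinj : ∀ x ∈ E, ∀ x' ∈ E, wd X n x = wd X n x' → x = x') (hR : ∀ x ∈ E, R x) :
    ∑ x ∈ E, Real.exp (Fs X σX f n (wd X n x)) ≤ Wt X σX f n R := by
  classical
  rw [← Finset.sum_image (s := E) (g := wd X n) (f := fun u => Real.exp (Fs X σX f n u))
    (fun x hx x' hx' e => hinj x hx x' hx' e)]
  unfold Wt
  rw [← Finset.sum_subset (Finset.subset_univ (Finset.univ.filter fun u => ∃ x ∈ cylSet X u, R x))]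
  · refine (Finset.sum_le_sum_of_subset_of_nonneg ?_ fun _ _ _ => (Real.exp_pos _).le).trans
      (Finset.sum_le_sum (s := Finset.univ.filter fun u => ∃ x ∈ cylSet X u, R x) fun u hu => ?_)
    · intro u hu
      obtain ⟨x, hx, rfl⟩ := Finset.mem_image.1 hu
      simp only [Finset.mem_filter, Finset.mem_univ, true_and]
      exact ⟨x, (mem_cyl X _ _).2 rfl, hR x hx⟩
    · rw [if_pos (Finset.mem_filter.1 hu).2]
  · intro u _ hu
    rw [if_neg]
    intro h
    exact hu (Finset.mem_filter.2 ⟨Finset.mem_univ _, h⟩)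

/-- the set whose supremum is `relPn` -/
def sepSet (σX : X → X) (π : X → Y) (f : X → ℝ) (n : ℕ) (δ : ℝ) (y : Y) : Set ℝ :=
  {s : ℝ | ∃ E : Finset X, (∀ x ∈ E, ((π x : Y) : ℕ → Fin l) = (y : ℕ → Fin l)) ∧
    (∀ x ∈ E, ∀ x' ∈ E, x ≠ x' →
      ∃ i < n, δ ≤ dSeq ((σX^[i] x : X) : ℕ → Fin k) ((σX^[i] x' : X) : ℕ → Fin k)) ∧
    s = ∑ x ∈ E, Real.exp (birk σX f n x)}

lemma relPn_eq (n : ℕ) (δ : ℝ) (y : Y) :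
    relPn X σX (fun z => ((π z : Y) : ℕ → Fin l)) f n δ y = sSup (sepSet σX π f n δ y) := rfl

lemma SU.sep_le (S : SU X Y σX σY π f C) (n r : ℕ) (δ : ℝ) (hr : (1 / 2 : ℝ) ^ r < δ) (y : Y)
    {s : ℝ} (hs : s ∈ sepSet σX π f n δ y) :
    s ≤ Real.exp (r * C + r * (C + Real.log k)) * Gs σX π f n n y := by
  obtain ⟨E, hE, hsep, rfl⟩ := hs
  have hδ : 0 < δ := lt_of_le_of_lt (by positivity) hr
  have hinj : ∀ x ∈ E, ∀ x' ∈ E, wd X (n + r) x = wd X (n + r) x' → x = x' := by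
    intro x hx x' hx' e
    by_contra hne
    obtain ⟨i, hi, hd⟩ := hsep x hx x' hx' hne
    unfold dSeq at hd
    split_ifs at hd with h0
    · linarith
    · set A := {j : ℕ | ((σX^[i] x : X) : ℕ → Fin k) j ≠ ((σX^[i] x' : X) : ℕ → Fin k) j} with hA
      have hAne : A.Nonempty := Function.ne_iff.1 h0
      have hmem := Nat.sInf_mem hAne
      have hrA : r ≤ sInf A := by
        by_contra hlt
        apply hmem
        rw [iter_apply S.hσX, iter_apply S.hσX]
        exact congrFun e ⟨i + sInf A, by omega⟩
      have : (1 / 2 : ℝ) ^ sInf A ≤ (1 / 2 : ℝ) ^ r :=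
        pow_le_pow_of_le_one (by norm_num) (by norm_num) hrA
      linarith
  have h1 : ∑ x ∈ E, Real.exp (birk σX f n x) ≤
      Real.exp (r * C) * ∑ x ∈ E, Real.exp (Fs X σX f (n + r) (wd X (n + r) x)) := by
    rw [Finset.mul_sum]
    refine Finset.sum_le_sum fun x _ => ?_
    rw [← Real.exp_add]
    refine Real.exp_le_exp.2 ?_
    have a1 := le_Fs (σ := σX) S.hC (n := n + r) ((mem_cyl X (wd X (n + r) x) x).2 rfl)
    rw [birk_add] at a1
    have a2 := (abs_le.1 (birk_abs_le σX f S.hC r (σX^[n] x))).1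
    linarith
  have h2 : ∑ x ∈ E, Real.exp (Fs X σX f (n + r) (wd X (n + r) x)) ≤
      Gs σX π f (n + r) (n + r) y :=
    sum_le_Wt (n + r) _ E hinj fun x hx => by
      have : π x = y := Subtype.ext (hE x hx)
      rw [this]
  have h3 := S.Gs_step n r n (by omega) y
  obtain ⟨x0, -⟩ := S.hπs y
  have h4 : Gs σX π f r r (σY^[n] y) ≤ Real.exp (r * (C + Real.log k)) := Wt_le S.hC r _ x0
  have h5 := mul_le_mul_of_nonneg_left h4 (S.Gs_pos n n y).le
  calc _ ≤ _ := h1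
    _ ≤ Real.exp (r * C) * (Gs σX π f n n y * Real.exp (r * (C + Real.log k))) :=
      mul_le_mul_of_nonneg_left (h2.trans (h3.trans h5)) (by positivity)
    _ = _ := by rw [Real.exp_add]; ring

lemma exists_r {δ : ℝ} (hδ : 0 < δ) : ∃ r : ℕ, (1 / 2 : ℝ) ^ r < δ :=
  exists_pow_lt_of_lt_one hδ (by norm_num)

lemma SU.sep_bdd (S : SU X Y σX σY π f C) (n : ℕ) {δ : ℝ} (hδ : 0 < δ) (y : Y) :
    BddAbove (sepSet σX π f n δ y) := by
  obtain ⟨r, hr⟩ := exists_r hδ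
  exact ⟨_, fun s hs => S.sep_le n r δ hr y hs⟩

lemma SU.relPn_ge (S : SU X Y σX σY π f C) (n : ℕ) {δ : ℝ} (hδ : 0 < δ) (y : Y) :
    Real.exp (-(n * C)) ≤ relPn X σX (fun z => ((π z : Y) : ℕ → Fin l)) f n δ y := by
  rw [relPn_eq]
  obtain ⟨x, rfl⟩ := S.hπs y
  have h1 : Real.exp (-(n * C)) ≤ Real.exp (birk σX f n x) :=
    Real.exp_le_exp.2 (abs_le.1 (birk_abs_le σX f S.hC n x)).1
  refine h1.trans (le_csSup (S.sep_bdd n hδ _) ⟨{x}, ?_, ?_, by simp⟩)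
  · simp
  · intro a ha b hb hne
    rw [Finset.mem_singleton] at ha hb
    exact absurd (ha.trans hb.symm) hne

lemma SU.relPn_avg_ge (S : SU X Y σX σY π f C) (n : ℕ) {δ : ℝ} (hδ : 0 < δ) (y : Y) :
    -C ≤ (1 / (n:ℝ)) * Real.log (relPn X σX (fun z => ((π z : Y) : ℕ → Fin l)) f n δ y) := by
  have h := Real.log_le_log (Real.exp_pos _) (S.relPn_ge n hδ y)
  rw [Real.log_exp] at h
  have h2 := mul_le_mul_of_nonneg_left h (by positivity : (0:ℝ) ≤ 1 / n)
  have h3 := (abs_le.1 (abs_avg_le (n := n) (a := -(n * C)) S.hC0 (by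
    rw [abs_neg, abs_of_nonneg (mul_nonneg (Nat.cast_nonneg n) S.hC0)]))).1
  linarith

lemma SU.limsup_relPn_le (S : SU X Y σX σY π f C) {δ : ℝ} (hδ : 0 < δ) (y : Y) :
    limsup (fun n : ℕ => (1 / (n:ℝ)) *
      Real.log (relPn X σX (fun z => ((π z : Y) : ℕ → Fin l)) f n δ y)) atTop ≤ p2 σX π f y := by
  obtain ⟨r, hr⟩ := exists_r hδ
  set D := r * C + r * (C + Real.log k) with hD
  have hw : Tendsto (fun n : ℕ => (1 / (n:ℝ)) * D) atTop (𝓝 0) := by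
    simpa only [zero_mul] using (tendsto_one_div_atTop_nhds_zero_nat (𝕜 := ℝ)).mul_const D
  refine limsup_le_aux (fun n => S.relPn_avg_ge n hδ y)
    (fun n => (abs_le.1 (S.Gavg_abs n n y)).2) hw (Eventually.of_forall fun n => ?_)
  rw [← mul_add]
  refine mul_le_mul_of_nonneg_left ?_ (by positivity)
  have h1 : relPn X σX (fun z => ((π z : Y) : ℕ → Fin l)) f n δ y ≤
      Real.exp D * Gs σX π f n n y := by
    rw [relPn_eq]
    refine csSup_le ⟨0, ∅, by simp, by simp, by simp⟩ fun s hs => S.sep_le n r δ hr y hs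
  have h2 := Real.log_le_log ((Real.exp_pos _).trans_le (S.relPn_ge n hδ y)) h1
  rw [Real.log_mul (Real.exp_pos _).ne' (S.Gs_pos _ _ _).ne', Real.log_exp] at h2
  linarith

lemma SU.Ds_le_relPn (S : SU X Y σX σY π f C) (ε c : ℝ)
    (hd : ∀ (n : ℕ) (x x' : X), wd X n x = wd X n x' →
      birk σX f n x ≤ birk σX f n x' + (n * ε + c)) (n : ℕ) (y : Y) :
    Ds σX π f n y ≤ Real.exp (n * ε + c) *
      relPn X σX (fun z => ((π z : Y) : ℕ → Fin l)) f n 1 y := by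
  classical
  set s : Finset (Fin n → Fin k) := Finset.univ.filter fun u => ∃ x ∈ cylSet X u, π x = y with hs
  obtain ⟨x0, -⟩ := S.hπs y
  have hch : ∀ u : Fin n → Fin k, ∃ x : X, u ∈ s → (wd X n x = u ∧ π x = y) := by
    intro u
    by_cases hu : u ∈ s
    · obtain ⟨x, hx, hy⟩ := (Finset.mem_filter.1 hu).2
      exact ⟨x, fun _ => ⟨(mem_cyl X _ _).1 hx, hy⟩⟩
    · exact ⟨x0, fun h => absurd h hu⟩
  choose z hz using hch
  have h1 : Ds σX π f n y = ∑ u ∈ s, Real.exp (Fs X σX f n u) := by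
    unfold Ds Wt
    rw [hs, Finset.sum_filter]
  have h2 : ∑ u ∈ s, Real.exp (Fs X σX f n u) ≤
      Real.exp (n * ε + c) * ∑ u ∈ s, Real.exp (birk σX f n (z u)) := by
    rw [Finset.mul_sum]
    refine Finset.sum_le_sum fun u hu => ?_
    rw [← Real.exp_add]
    refine Real.exp_le_exp.2 (Fs_le ((mem_cyl X _ _).2 (hz u hu).1) fun x hx => ?_)
    have := hd n x (z u) (((mem_cyl X _ _).1 hx).trans (hz u hu).1.symm)
    linarith
  have h3 : ∑ u ∈ s, Real.exp (birk σX f n (z u)) ≤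
      relPn X σX (fun z => ((π z : Y) : ℕ → Fin l)) f n 1 y := by
    rw [relPn_eq]
    refine le_csSup (S.sep_bdd n one_pos y) ⟨s.image z, ?_, ?_, ?_⟩
    · intro x hx
      obtain ⟨u, hu, rfl⟩ := Finset.mem_image.1 hx
      rw [(hz u hu).2]
    · intro x hx x' hx' hne
      obtain ⟨u, hu, rfl⟩ := Finset.mem_image.1 hx
      obtain ⟨u', hu', rfl⟩ := Finset.mem_image.1 hx'
      have huu : wd X n (z u) ≠ wd X n (z u') := by
        rw [(hz u hu).1, (hz u' hu').1]
        rintro rfl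
        exact hne rfl
      obtain ⟨i, hi⟩ := Function.ne_iff.1 huu
      refine ⟨i, i.2, ?_⟩
      have h0 : ((σX^[(i:ℕ)] (z u) : X) : ℕ → Fin k) 0 ≠ ((σX^[(i:ℕ)] (z u') : X) : ℕ → Fin k) 0 := by
        rw [iter_apply S.hσX, iter_apply S.hσX]
        exact hi
      unfold dSeq
      rw [if_neg (fun e => h0 (congrFun e 0))]
      have : sInf {j : ℕ | ((σX^[(i:ℕ)] (z u) : X) : ℕ → Fin k) j ≠
          ((σX^[(i:ℕ)] (z u') : X) : ℕ → Fin k) j} = 0 := Nat.sInf_eq_zero.2 (Or.inl h0)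
      rw [this, pow_zero]
    · rw [Finset.sum_image]
      intro u hu u' hu' e
      have e1 : z u = z u' := e
      rw [← (hz u hu).1, ← (hz u' hu').1, e1]
  rw [h1]
  exact h2.trans (mul_le_mul_of_nonneg_left h3 (by positivity))

lemma SU.relP_le (S : SU X Y σX σY π f C) (y : Y) :
    relP X σX (fun z => ((π z : Y) : ℕ → Fin l)) f y ≤ p2 σX π f y := by
  have : Nonempty {δ : ℝ // 0 < δ} := ⟨⟨1, one_pos⟩⟩
  exact ciSup_le fun δ => S.limsup_relPn_le δ.2 y

lemma SU.le_relP (S : SU X Y σX σY π f C) (y : Y) :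
    p1 σX π f y ≤ relP X σX (fun z => ((π z : Y) : ℕ → Fin l)) f y := by
  have hb : BddAbove (Set.range fun δ : {δ : ℝ // 0 < δ} =>
      limsup (fun n : ℕ => (1 / (n:ℝ)) *
      Real.log (relPn X σX (fun z => ((π z : Y) : ℕ → Fin l)) f n δ.1 y)) atTop) :=
    ⟨p2 σX π f y, by rintro _ ⟨δ, rfl⟩; exact S.limsup_relPn_le δ.2 y⟩
  refine le_trans ?_ (le_ciSup hb ⟨1, one_pos⟩)
  set v : ℕ → ℝ := fun n => (1 / (n:ℝ)) *
      Real.log (relPn X σX (fun z => ((π z : Y) : ℕ → Fin l)) f n 1 y) with hv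
  change p1 σX π f y ≤ limsup v atTop
  refine le_of_forall_pos_le_add fun ε hε => ?_
  obtain ⟨c, hc0, hd⟩ := distortion S.hX S.hσX f S.hf (ε / 3) (by linarith)
  obtain ⟨r, hr⟩ := exists_r one_pos
  have hvb : IsBoundedUnder (· ≤ ·) atTop v := by
    refine isBoundedUnder_of ⟨(C + Real.log k) + (r * C + r * (C + Real.log k)), fun n => ?_⟩
    have h1 : relPn X σX (fun z => ((π z : Y) : ℕ → Fin l)) f n 1 y ≤
        Real.exp (r * C + r * (C + Real.log k)) * Gs σX π f n n y := by
      rw [relPn_eq]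
      refine csSup_le ⟨0, ∅, by simp, by simp, by simp⟩ fun s hs => S.sep_le n r 1 hr y hs
    have h2 := Real.log_le_log ((Real.exp_pos _).trans_le (S.relPn_ge n one_pos y)) h1
    rw [Real.log_mul (Real.exp_pos _).ne' (S.Gs_pos _ _ _).ne', Real.log_exp] at h2
    have h3 := mul_le_mul_of_nonneg_left h2 (by positivity : (0:ℝ) ≤ 1 / n)
    have h4 := (abs_le.1 (S.Gavg_abs n n y)).2
    have hD0 : 0 ≤ r * C + r * (C + Real.log k) :=
      add_nonneg (mul_nonneg (Nat.cast_nonneg _) S.hC0)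
        (mul_nonneg (Nat.cast_nonneg _) (K_nonneg S))
    have h5 : 1 / (n:ℝ) * (r * C + r * (C + Real.log k)) ≤ r * C + r * (C + Real.log k) := by
      refine mul_le_of_le_one_left hD0 ?_
      rcases Nat.eq_zero_or_pos n with rfl | hn
      · simp
      · rw [div_le_one (by exact_mod_cast hn)]
        exact_mod_cast hn
    simp only [hv]
    linarith
  have hev : ∀ᶠ n in atTop, v n < limsup v atTop + ε / 3 :=
    eventually_lt_of_limsup_lt (by linarith) hvb
  have hw : Tendsto (fun n : ℕ => (1 / (n:ℝ)) * c) atTop (𝓝 0) := by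
    simpa only [zero_mul] using (tendsto_one_div_atTop_nhds_zero_nat (𝕜 := ℝ)).mul_const c
  refine limsup_le_of_le (IsBoundedUnder.isCoboundedUnder_le
      (isBoundedUnder_of ⟨-(C + Real.log k), fun n => (abs_le.1 (S.Davg_abs n y)).1⟩)) ?_
  filter_upwards [hev, hw.eventually_lt_const (by linarith : (0:ℝ) < ε / 3),
    eventually_ge_atTop 1] with n h1 h2 h3
  have hn' : (0:ℝ) < n := by exact_mod_cast h3
  have h4 := Real.log_le_log (S.Ds_pos n y) (S.Ds_le_relPn (ε / 3) c hd n y)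
  rw [Real.log_mul (Real.exp_pos _).ne'
    ((Real.exp_pos _).trans_le (S.relPn_ge n one_pos y)).ne', Real.log_exp] at h4
  have h5 := mul_le_mul_of_nonneg_left h4 (by positivity : (0:ℝ) ≤ 1 / n)
  rw [mul_add, mul_add] at h5
  have e : 1 / (n:ℝ) * (n * (ε / 3)) = ε / 3 := by field_simp
  rw [e] at h5
  simp only [hv] at h1
  linarith

lemma SU.tendsto_relP (S : SU X Y σX σY π f C) (m : Measure Y) [IsProbabilityMeasure m]
    (hm : MeasurePreserving σY m m) :
    Tendsto (fun n : ℕ => (1 / (n:ℝ)) * ∫ y, Real.log (Gs σX π f n n y) ∂m) atTop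
      (𝓝 (∫ y : Y, relP X σX (fun z => ((π z : Y) : ℕ → Fin l)) f (y : ℕ → Fin l) ∂m)) := by
  obtain ⟨Λ, hΛ, hle⟩ := S.exists_lim m hm
  have h1 : ∫ y, p2 σX π f y ∂m ≤ Λ := by
    refine ge_of_tendsto hΛ ?_
    filter_upwards [eventually_ge_atTop 1] with n hn
    exact S.int_p2_le m hm n hn
  have h2 : Λ ≤ ∫ y, p1 σX π f y ∂m := by
    refine reverse_fatou m (fun n y => (1 / (n:ℝ)) * Real.log (Ds σX π f n y))
      (fun n => (Real.measurable_log.comp (S.Ds_meas n)).const_mul _) (C + Real.log k)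
      (fun n y => S.Davg_abs n y) Λ fun n hn => ?_
    rw [integral_const_mul]
    exact hle n hn
  have h12 : ∀ y, p1 σX π f y ≤ p2 σX π f y := fun y => (S.le_relP y).trans (S.relP_le y)
  have heq : ∫ y, p1 σX π f y ∂m = ∫ y, p2 σX π f y ∂m :=
    le_antisymm (integral_mono (S.p1_int m) (S.p2_int m) h12) (h1.trans h2)
  have hae : p1 σX π f =ᵐ[m] p2 σX π f :=
    (integral_eq_iff_of_ae_le (S.p1_int m) (S.p2_int m) (ae_of_all _ h12)).1 heq
  have hae2 : (fun y : Y => relP X σX (fun z => ((π z : Y) : ℕ → Fin l)) f (y : ℕ → Fin l))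
      =ᵐ[m] p1 σX π f := by
    filter_upwards [hae] with y hy
    exact le_antisymm ((S.relP_le y).trans hy.ge) (S.le_relP y)
  rw [integral_congr_ae hae2]
  have : ∫ y, p1 σX π f y ∂m = Λ := le_antisymm (heq.le.trans h1) h2
  rw [this]
  exact hΛ
end relpress


section final
variable {k l : ℕ} {X : Set (ℕ → Fin k)} {Y : Set (ℕ → Fin l)} {σX : X → X} {σY : Y → Y}
  {π : X → Y} {f : X → ℝ} {C : ℝ} {τ : Fin k → Fin l}

lemma avgH_abs (μ : Measure X) [IsProbabilityMeasure μ] (n : ℕ) :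
    |(1 / (n:ℝ)) * Hn X μ n| ≤ Real.log k :=
  abs_avg_le (logk_nonneg k) (by rw [abs_of_nonneg (Hn_nonneg X μ n)]; exact Hn_le X μ n)

lemma ent_ev (μ : Measure X) [IsProbabilityMeasure μ] {ε : ℝ} (hε : 0 < ε) :
    ∀ᶠ n : ℕ in atTop, mEntropy X μ - ε < (1 / (n:ℝ)) * Hn X μ n := by
  have hb : IsBoundedUnder (· ≥ ·) atTop fun n : ℕ => (1 / (n:ℝ)) * Hn X μ n :=
    isBoundedUnder_of ⟨-Real.log k, fun n => (abs_le.1 (avgH_abs μ n)).1⟩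
  have h : mEntropy X μ - ε < liminf (fun n : ℕ => (1 / (n:ℝ)) * Hn X μ n) atTop := by
    have : mEntropy X μ = liminf (fun n : ℕ => (1 / (n:ℝ)) * Hn X μ n) atTop := rfl
    rw [← this]
    linarith
  exact eventually_lt_of_lt_liminf h hb

lemma le_ent (μ : Measure X) [IsProbabilityMeasure μ] {a : ℝ}
    (h : ∀ᶠ n : ℕ in atTop, a ≤ (1 / (n:ℝ)) * Hn X μ n) : a ≤ mEntropy X μ := by
  have hb : IsBoundedUnder (· ≤ ·) atTop fun n : ℕ => (1 / (n:ℝ)) * Hn X μ n :=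
    isBoundedUnder_of ⟨Real.log k, fun n => (abs_le.1 (avgH_abs μ n)).2⟩
  exact le_liminf_of_le hb.isCoboundedUnder_ge h

open Classical in
/-- the allowed words -/
noncomputable def Aw (X : Set (ℕ → Fin k)) (n : ℕ) : Finset (Fin n → Fin k) :=
  Finset.univ.filter fun u => ∃ x, x ∈ cylSet X u

lemma mem_Aw {n : ℕ} {u : Fin n → Fin k} : u ∈ Aw X n ↔ ∃ x, wd X n x = u := by
  simp [Aw, mem_cyl]

lemma wd_pi (hτ : ∀ (x : X) (i : ℕ), (π x : ℕ → Fin l) i = τ ((x : ℕ → Fin k) i)) (n : ℕ) (x : X) :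
    wd Y n (π x) = τ ∘ wd X n x := funext fun i => hτ x i

lemma Wt_tau (hτ : ∀ (x : X) (i : ℕ), (π x : ℕ → Fin l) i = τ ((x : ℕ → Fin k) i)) (n : ℕ)
    (w : Fin n → Fin l) :
    Wt X σX f n (fun x => wd Y n (π x) = w) =
      ∑ u ∈ (Aw X n).filter (fun u => τ ∘ u = w), Real.exp (Fs X σX f n u) := by
  classical
  unfold Wt
  rw [← Finset.sum_filter]
  refine Finset.sum_congr ?_ fun _ _ => rfl
  ext u
  simp only [Finset.mem_filter, Finset.mem_univ, true_and, mem_Aw, mem_cyl, wd_pi hτ]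
  constructor
  · rintro ⟨x, rfl, h⟩
    exact ⟨⟨x, rfl⟩, h⟩
  · rintro ⟨⟨x, rfl⟩, h⟩
    exact ⟨x, rfl, h⟩

lemma cyl_zero (μ : Measure X) {n : ℕ} {u : Fin n → Fin k} (hu : u ∉ Aw X n) :
    (μ (cylSet X u)).toReal = 0 := by
  have : cylSet X u = ∅ := by
    rw [Set.eq_empty_iff_forall_notMem]
    intro x hx
    exact hu (mem_Aw.2 ⟨x, (mem_cyl X u x).1 hx⟩)
  rw [this]
  simp

lemma map_cyl (hπm : Measurable π)
    (hτ : ∀ (x : X) (i : ℕ), (π x : ℕ → Fin l) i = τ ((x : ℕ → Fin k) i)) (μ : Measure X)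
    [IsProbabilityMeasure μ] (n : ℕ) (w : Fin n → Fin l) :
    ((μ.map π) (cylSet Y w)).toReal =
      ∑ u ∈ (Aw X n).filter (fun u => τ ∘ u = w), (μ (cylSet X u)).toReal := by
  have : IsProbabilityMeasure (μ.map π) := Measure.isProbabilityMeasure_map hπm.aemeasurable
  have h1 := integral_wd X μ n (fun u => if τ ∘ u = w then 1 else 0)
  have h2 := integral_wd Y (μ.map π) n (fun v => if v = w then 1 else 0)
  rw [integral_map hπm.aemeasurable] at h2
  · simp only [wd_pi hτ] at h2
    rw [h1] at h2
    simp only [mul_ite, mul_one, mul_zero, Finset.sum_ite_eq', Finset.mem_univ, if_true] at h2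
    rw [← h2, Finset.sum_filter]
    symm
    refine Finset.sum_subset (Finset.subset_univ _) fun u _ hu => ?_
    rw [cyl_zero μ hu]
    simp
  · exact ((measurable_of_finite (fun v : Fin n → Fin l => if v = w then (1:ℝ) else 0)).comp
        (wd_measurable Y n)).aestronglyMeasurable

lemma birk_le_sum {Z : Set (ℕ → Fin k)} {σ : Z → Z} {g : Z → ℝ} {D : ℝ} (hσ : Measurable σ)
    (hg : Measurable g)
    (hD : ∀ x, |g x| ≤ D) (μ : Measure Z) [IsProbabilityMeasure μ] (n : ℕ) :
    ∫ x, birk σ g n x ∂μ ≤ ∑ u, (μ (cylSet Z u)).toReal * Fs Z σ g n u := by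
  rw [← integral_wd Z μ n (Fs Z σ g n)]
  refine integral_mono (bdd_integrable (birk_measurable hσ hg n) (n * D) (birk_abs_le σ g hD n))
    ?_ fun x => le_Fs hD ((mem_cyl Z _ x).2 rfl)
  have : IsProbabilityMeasure (μ.map (wd Z n)) :=
    Measure.isProbabilityMeasure_map (wd_measurable Z n).aemeasurable
  have hi : Integrable (Fs Z σ g n) (μ.map (wd Z n)) := Integrable.of_finite
  exact hi.comp_measurable (wd_measurable Z n)

lemma SU.upper (S : SU X Y σX σY π f C)
    (hτ : ∀ (x : X) (i : ℕ), (π x : ℕ → Fin l) i = τ ((x : ℕ → Fin k) i)) (μ : Measure X)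
    [IsProbabilityMeasure μ] (n : ℕ) :
    Hn X μ n + ∫ x, birk σX f n x ∂μ ≤
      Hn Y (μ.map π) n + ∫ y, Real.log (Gs σX π f n n y) ∂(μ.map π) := by
  have hπm := S.hπc.measurable
  have : IsProbabilityMeasure (μ.map π) := Measure.isProbabilityMeasure_map hπm.aemeasurable
  have h1 := birk_le_sum (shift_continuous S.hσX).measurable S.hf.measurable S.hC μ n
  have h2 : ∫ y, Real.log (Gs σX π f n n y) ∂(μ.map π) =
      ∑ w, ((μ.map π) (cylSet Y w)).toReal *
        Real.log (∑ u ∈ (Aw X n).filter (fun u => τ ∘ u = w), Real.exp (Fs X σX f n u)) := by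
    rw [← integral_wd Y (μ.map π) n]
    refine integral_congr_ae (ae_of_all _ fun y => ?_)
    show Real.log (Wt X σX f n fun x => wd Y n (π x) = wd Y n y) = _
    rw [Wt_tau hτ]
  rw [h2]
  have h3 : Hn X μ n + ∑ u, (μ (cylSet X u)).toReal * Fs X σX f n u =
      ∑ w, ∑ u ∈ (Aw X n).filter (fun u => τ ∘ u = w),
        (Real.negMulLog ((μ (cylSet X u)).toReal) +
          (μ (cylSet X u)).toReal * Real.log (Real.exp (Fs X σX f n u))) := by
    unfold Hn
    rw [← Finset.sum_add_distrib, Finset.sum_fiberwise]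
    simp only [Real.log_exp]
    symm
    refine Finset.sum_subset (Finset.subset_univ _) fun u _ hu => ?_
    rw [cyl_zero μ hu]
    simp
  have h4 : ∀ w ∈ (Finset.univ : Finset (Fin n → Fin l)), _ := fun w _ =>
    gibbs_ineq ((Aw X n).filter (fun u => τ ∘ u = w)) (fun u => (μ (cylSet X u)).toReal)
      (fun u => Real.exp (Fs X σX f n u)) (fun _ _ => ENNReal.toReal_nonneg)
      (fun _ _ => (Real.exp_pos _).le) (fun _ _ _ => Real.exp_pos _)
  have h5 := Finset.sum_le_sum h4
  simp only [← map_cyl hπm hτ μ n] at h5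
  rw [Finset.sum_add_distrib] at h5
  unfold Hn at h3 ⊢
  linarith

lemma SU.lower (S : SU X Y σX σY π f C)
    (hτ : ∀ (x : X) (i : ℕ), (π x : ℕ → Fin l) i = τ ((x : ℕ → Fin k) i)) (m : Measure Y)
    [IsProbabilityMeasure m] (ψ : Y → ℝ) (hψ : Continuous ψ) (n : ℕ) :
    ∃ ν : Measure X, IsProbabilityMeasure ν ∧ ∀ ε c : ℝ,
      (∀ (y y' : Y), wd Y n y = wd Y n y' → birk σY ψ n y ≤ birk σY ψ n y' + (n * ε + c)) →
      Hn Y m n + ∫ y, Real.log (Gs σX π f n n y) ∂m + ∫ y, birk σY ψ n y ∂m ≤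
        Hn X ν n + ∫ x, birk σX (fun x => f x + ψ (π x)) n x ∂ν + (1 + (n * ε + c)) := by
  classical
  obtain ⟨D, hD0, hD⟩ := cont_bound S.hY ψ hψ
  obtain ⟨y0⟩ : Nonempty Y := nonempty_of_isProbabilityMeasure m
  obtain ⟨x0, -⟩ := S.hπs y0
  have hch : ∀ u : Fin n → Fin k, ∃ x : X, u ∈ Aw X n →
      (wd X n x = u ∧ Fs X σX f n u ≤ birk σX f n x + 1) := by
    intro u
    by_cases hu : u ∈ Aw X n
    · obtain ⟨x1, hx1⟩ := mem_Aw.1 hu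
      obtain ⟨_, ⟨x, hx, rfl⟩, hlt⟩ := exists_lt_of_lt_csSup
        (s := birk σX f n '' cylSet X u) ⟨_, x1, (mem_cyl X u x1).2 hx1, rfl⟩
        (show Fs X σX f n u - 1 < Fs X σX f n u by linarith)
      exact ⟨x, fun _ => ⟨(mem_cyl X u x).1 hx, by linarith⟩⟩
    · exact ⟨x0, fun h => absurd h hu⟩
  choose z hz using hch
  have hsne : (Aw X n).Nonempty := ⟨wd X n x0, mem_Aw.2 ⟨x0, rfl⟩⟩
  have hσXc := shift_continuous S.hσX
  have hΦ : Continuous fun x => f x + ψ (π x) := S.hf.add (hψ.comp S.hπc)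
  obtain ⟨ν, hν, hνeq⟩ := exists_atomic (Aw X n) hsne z
    (fun u hu => (mem_cyl X u _).2 (hz u hu).1)
    (birk σX (fun x => f x + ψ (π x)) n) (birk_continuous hσXc hΦ n).measurable
  refine ⟨ν, hν, fun ε c hd => ?_⟩
  rw [hνeq]
  have hbs : ∀ x, birk σX (fun x => f x + ψ (π x)) n x = birk σX f n x + birk σY ψ n (π x) := by
    intro x
    unfold birk
    rw [← Finset.sum_add_distrib]
    refine Finset.sum_congr rfl fun i _ => ?_
    rw [← S.comm]
  set q : (Fin n → Fin l) → ℝ := fun w => (m (cylSet Y w)).toReal with hq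
  set G : (Fin n → Fin l) → ℝ := fun w =>
    ∑ u ∈ (Aw X n).filter (fun u => τ ∘ u = w), Real.exp (Fs X σX f n u) with hG
  have h1 : ∫ y, birk σY ψ n y ∂m ≤ ∑ w, q w * Fs Y σY ψ n w :=
    birk_le_sum (shift_continuous S.hσY).measurable hψ.measurable hD m n
  have h2 : ∫ y, Real.log (Gs σX π f n n y) ∂m = ∑ w, q w * Real.log (G w) := by
    rw [hq, ← integral_wd Y m n]
    refine integral_congr_ae (ae_of_all _ fun y => ?_)
    show Real.log (Wt X σX f n fun x => wd Y n (π x) = wd Y n y) = _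
    rw [Wt_tau hτ]
  have hGpos : ∀ w, q w ≠ 0 → 0 < G w := by
    intro w hw
    have hwA : w ∈ Aw Y n := by
      by_contra hcon
      exact hw (cyl_zero m hcon)
    obtain ⟨y, rfl⟩ := mem_Aw.1 hwA
    obtain ⟨x, rfl⟩ := S.hπs y
    refine Finset.sum_pos (fun _ _ => Real.exp_pos _) ⟨wd X n x, ?_⟩
    rw [Finset.mem_filter]
    exact ⟨mem_Aw.2 ⟨x, rfl⟩, (wd_pi hτ n x).symm⟩
  have hG0 : ∀ w, 0 ≤ G w := fun w => Finset.sum_nonneg fun _ _ => (Real.exp_pos _).le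
  have h3 := gibbs_ineq Finset.univ q (fun w => G w * Real.exp (Fs Y σY ψ n w))
    (fun _ _ => ENNReal.toReal_nonneg) (fun w _ => mul_nonneg (hG0 w) (Real.exp_pos _).le)
    (fun w _ hw => mul_pos (hGpos w hw) (Real.exp_pos _))
  have hq1 : ∑ w, q w = 1 := sum_cyl Y m n
  rw [hq1, Real.negMulLog_one, one_mul, zero_add] at h3
  have h4 : ∑ w, (Real.negMulLog (q w) + q w * Real.log (G w * Real.exp (Fs Y σY ψ n w))) =
      Hn Y m n + ∑ w, q w * Real.log (G w) + ∑ w, q w * Fs Y σY ψ n w := by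
    unfold Hn
    rw [← Finset.sum_add_distrib, ← Finset.sum_add_distrib]
    refine Finset.sum_congr rfl fun w _ => ?_
    by_cases hw : q w = 0
    · have hw' : (m (cylSet Y w)).toReal = 0 := hw
      rw [hw, hw']
      simp
    · rw [Real.log_mul (hGpos w hw).ne' (Real.exp_pos _).ne', Real.log_exp]
      ring
  have h5 : ∑ w, G w * Real.exp (Fs Y σY ψ n w) =
      ∑ u ∈ Aw X n, Real.exp (Fs X σX f n u + Fs Y σY ψ n (τ ∘ u)) := by
    rw [← Finset.sum_fiberwise (Aw X n) (fun u => τ ∘ u)]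
    refine Finset.sum_congr rfl fun w _ => ?_
    rw [hG, Finset.sum_mul]
    refine Finset.sum_congr rfl fun u hu => ?_
    rw [(Finset.mem_filter.1 hu).2, Real.exp_add]
  have h6 : ∑ u ∈ Aw X n, Real.exp (Fs X σX f n u + Fs Y σY ψ n (τ ∘ u)) ≤
      Real.exp (1 + (n * ε + c)) *
        ∑ u ∈ Aw X n, Real.exp (birk σX (fun x => f x + ψ (π x)) n (z u)) := by
    rw [Finset.mul_sum]
    refine Finset.sum_le_sum fun u hu => ?_
    rw [← Real.exp_add]
    refine Real.exp_le_exp.2 ?_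
    rw [hbs]
    have e1 : wd Y n (π (z u)) = τ ∘ u := by rw [wd_pi hτ, (hz u hu).1]
    have a1 : Fs Y σY ψ n (τ ∘ u) ≤ birk σY ψ n (π (z u)) + (n * ε + c) :=
      Fs_le ((mem_cyl Y _ _).2 e1) fun y hy =>
        hd y (π (z u)) (((mem_cyl Y _ _).1 hy).trans e1.symm)
    have a2 := (hz u hu).2
    linarith
  have hpos : 0 < ∑ u ∈ Aw X n, Real.exp (Fs X σX f n u + Fs Y σY ψ n (τ ∘ u)) :=
    Finset.sum_pos (fun _ _ => Real.exp_pos _) hsne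
  have h7 := Real.log_le_log hpos h6
  rw [Real.log_mul (Real.exp_pos _).ne'
    (Finset.sum_pos (fun _ _ => Real.exp_pos _) hsne).ne', Real.log_exp] at h7
  rw [h4, h5] at h3
  linarith

lemma integral_birk {Z : Set (ℕ → Fin k)} {σ : Z → Z} {g : Z → ℝ} {D : ℝ}
    (hg : Measurable g) (hD : ∀ x, |g x| ≤ D) (μ : Measure Z) [IsProbabilityMeasure μ]
    (hμ : MeasurePreserving σ μ μ) (n : ℕ) : ∫ x, birk σ g n x ∂μ = n * ∫ x, g x ∂μ := by
  unfold birk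
  rw [integral_finsetSum]
  · simp [integral_iter μ σ hμ g hg]
  · intro i _
    exact bdd_integrable (hg.comp (hμ.iterate i).measurable) D fun x => hD _

end final

theorem stmt13 {k l : ℕ}
    (X : Set (ℕ → Fin k)) (hX : IsSubshift X)
    (Y : Set (ℕ → Fin l)) (hY : IsSubshift Y)
    (σX : X → X) (hσX : ∀ x : X, (σX x : ℕ → Fin k) = shiftMap (x : ℕ → Fin k))
    (σY : Y → Y) (hσY : ∀ y : Y, (σY y : ℕ → Fin l) = shiftMap (y : ℕ → Fin l))
    -- π is a one-block factor map
    (π : X → Y) (hπc : Continuous π) (hπs : Function.Surjective π)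
    (hπcomm : ∀ x, π (σX x) = σY (π x))
    (hπ1 : ∃ τ : Fin k → Fin l, ∀ (x : X) (i : ℕ), (π x : ℕ → Fin l) i = τ ((x : ℕ → Fin k) i))
    (f : X → ℝ) (hf : Continuous f)
    (h : Y → ℝ) (hh : Continuous h)
    -- ∫ P(σ_X, π, f) dm = ∫ h dm for every invariant m on Y
    (hint : ∀ ν : Measure Y, IsProbabilityMeasure ν → MeasurePreserving σY ν ν →
      ∫ y, relP X σX (fun z => ((π z : ℕ → Fin l))) f ((y : ℕ → Fin l)) ∂ν = ∫ y, h y ∂ν) :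
    -- f - h ∘ π is a compensation function for π
    ∀ φ : Y → ℝ, Continuous φ →
      sSup {r : ℝ | ∃ μ : Measure X, IsProbabilityMeasure μ ∧ MeasurePreserving σX μ μ ∧
          r = mEntropy X μ + ∫ x, (f x - h (π x)) ∂μ + ∫ x, φ (π x) ∂μ} =
      sSup {r : ℝ | ∃ ν : Measure Y, IsProbabilityMeasure ν ∧ MeasurePreserving σY ν ν ∧
          r = mEntropy Y ν + ∫ y, φ y ∂ν} := by
  intro φ hφ
  obtain ⟨τ, hτ⟩ := hπ1
  obtain ⟨C, hC0, hC⟩ := cont_bound hX.1 f hf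
  obtain ⟨Dh, -, hDh⟩ := cont_bound hY.1 h hh
  obtain ⟨Dp, -, hDp⟩ := cont_bound hY.1 φ hφ
  have S : SU X Y σX σY π f C := ⟨hX.1, hY.1, hσX, hσY, hπc, hπs, hπcomm, hf, hC0, hC⟩
  have hπm := hπc.measurable
  have hlim : ∀ m : Measure Y, IsProbabilityMeasure m → MeasurePreserving σY m m →
      Tendsto (fun n : ℕ => (1 / (n:ℝ)) * ∫ y, Real.log (Gs σX π f n n y) ∂m) atTop
        (𝓝 (∫ y, h y ∂m)) := by
    intro m hmp hm
    rw [← hint m hmp hm]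
    exact S.tendsto_relP m hm
  have hifX : ∀ μ : Measure X, IsProbabilityMeasure μ → Integrable f μ := fun μ _ =>
    bdd_integrable hf.measurable C hC
  have hihX : ∀ μ : Measure X, IsProbabilityMeasure μ → Integrable (fun x => h (π x)) μ :=
    fun μ _ => bdd_integrable (hh.measurable.comp hπm) Dh fun x => hDh _
  have hipX : ∀ μ : Measure X, IsProbabilityMeasure μ → Integrable (fun x => φ (π x)) μ :=
    fun μ _ => bdd_integrable (hφ.measurable.comp hπm) Dp fun x => hDp _
  have hih : ∀ m : Measure Y, IsProbabilityMeasure m → Integrable h m :=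
    fun m _ => bdd_integrable hh.measurable Dh hDh
  have hip : ∀ m : Measure Y, IsProbabilityMeasure m → Integrable φ m :=
    fun m _ => bdd_integrable hφ.measurable Dp hDp
  apply csSup_eq_csSup_of_forall_exists_le
  · rintro _ ⟨μ, hμp, hμ, rfl⟩
    have hmp : IsProbabilityMeasure (μ.map π) :=
      Measure.isProbabilityMeasure_map hπm.aemeasurable
    have hσYm := (shift_continuous hσY).measurable
    have hm : MeasurePreserving σY (μ.map π) (μ.map π) := by
      refine ⟨hσYm, ?_⟩
      rw [Measure.map_map hσYm hπm]
      have : σY ∘ π = π ∘ σX := funext fun x => (hπcomm x).symm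
      rw [this, ← Measure.map_map hπm hμ.measurable, hμ.map_eq]
    refine ⟨_, ⟨μ.map π, hmp, hm, rfl⟩, ?_⟩
    have e1 : ∫ y, φ y ∂(μ.map π) = ∫ x, φ (π x) ∂μ :=
      integral_map hπm.aemeasurable hφ.measurable.aestronglyMeasurable
    have e2 : ∫ y, h y ∂(μ.map π) = ∫ x, h (π x) ∂μ :=
      integral_map hπm.aemeasurable hh.measurable.aestronglyMeasurable
    rw [e1, integral_sub (hifX μ hμp) (hihX μ hμp)]
    have key : mEntropy X μ + ∫ x, f x ∂μ - ∫ x, h (π x) ∂μ ≤ mEntropy Y (μ.map π) := by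
      refine le_of_forall_pos_le_add fun ε hε => ?_
      rw [← sub_le_iff_le_add]
      refine le_ent _ ?_
      have hl := hlim _ hmp hm
      rw [e2] at hl
      filter_upwards [ent_ev μ (half_pos hε),
        hl.eventually_lt_const (lt_add_of_pos_right _ (half_pos hε)),
        eventually_ge_atTop 1] with n h1 h2 h3
      have hn' : (0:ℝ) < n := by exact_mod_cast h3
      have h4 := S.upper hτ μ n
      rw [integral_birk hf.measurable hC μ hμ n] at h4
      have h5 := mul_le_mul_of_nonneg_left h4 (by positivity : (0:ℝ) ≤ 1 / n)
      rw [mul_add, mul_add] at h5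
      have e : 1 / (n:ℝ) * (n * ∫ x, f x ∂μ) = ∫ x, f x ∂μ := by field_simp
      rw [e] at h5
      linarith
    linarith
  · rintro _ ⟨m, hmp, hm, rfl⟩
    have hψ : Continuous fun y => φ y - h y := hφ.sub hh
    obtain ⟨Ds', -, hDs⟩ := cont_bound hY.1 _ hψ
    choose ν hνp hν using fun n => S.lower hτ m (fun y => φ y - h y) hψ n
    have hΦ : Continuous fun x => f x + (φ (π x) - h (π x)) := hf.add (hψ.comp hπc)
    obtain ⟨μ, hμp, hμ, hle⟩ := misiurewicz hX.1 hσX (fun x => f x + (φ (π x) - h (π x))) hΦ ν hνp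
      (mEntropy Y m + ∫ y, φ y ∂m) (by
        intro ε hε
        obtain ⟨c, -, hd⟩ := distortion hY.1 hσY (fun y => φ y - h y) hψ (ε / 4) (by linarith)
        have hw : Tendsto (fun n : ℕ => (1 / (n:ℝ)) * (1 + c)) atTop (𝓝 0) := by
          simpa only [zero_mul] using
            (tendsto_one_div_atTop_nhds_zero_nat (𝕜 := ℝ)).mul_const (1 + c)
        filter_upwards [ent_ev m (show (0:ℝ) < ε / 4 by linarith),
          (hlim m hmp hm).eventually_const_lt (sub_lt_self _ (show (0:ℝ) < ε / 4 by linarith)),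
          hw.eventually_lt_const (show (0:ℝ) < ε / 4 by linarith),
          eventually_ge_atTop 1] with n h1 h2 h3 h4
        have hn' : (0:ℝ) < n := by exact_mod_cast h4
        have h5 := hν n (ε / 4) c (hd n)
        rw [integral_birk hψ.measurable hDs m hm n,
          integral_sub (hip m hmp) (hih m hmp)] at h5
        rw [one_div, lt_inv_mul_iff₀ hn'] at h1 h2
        rw [one_div, inv_mul_lt_iff₀ hn'] at h3
        linarith)
    refine ⟨_, ⟨μ, hμp, hμ, rfl⟩, ?_⟩
    have hi2 : Integrable (fun x => φ (π x) - h (π x)) μ := (hipX μ hμp).sub (hihX μ hμp)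
    rw [integral_add (hifX μ hμp) hi2,
      integral_sub (hipX μ hμp) (hihX μ hμp)] at hle
    rw [integral_sub (hifX μ hμp) (hihX μ hμp)]
    linarith
end

section
/- Let $(X,\sigma_X)$ be an irreducible one-sided shift of finite type, $(Y,\sigma_Y)$ a subshift, $\pi:X\to Y$ a one-block factor map, $f \in C(X)$, and define $g_n$ on $Y$ by the fiberwise sums. For $h \in C(Y)$ the following are equivalent: (i) $\lim_{n\to\infty}\frac1n\log(g_n(y)/e^{(S_nh)(y)}) = 0$ for every periodic point $y \in Y$; (ii) $\lim_{n\to\infty}\frac1n\log(g_n(y)/e^{(S_nh)(y)}) = 0$ for every $y \in Y$; (iii) $\lim_{n\to\infty}\frac1n\|\log(g_n/e^{S_nh})\|_\infty = 0$. -/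
open Filter Topology MeasureTheory

/-- `X` is a one-step shift of finite type, given by a transition relation on symbols. -/
def IsSFT {k : ℕ} (X : Set (ℕ → Fin k)) : Prop :=
  ∃ A : Fin k → Fin k → Prop, X = {x | ∀ i : ℕ, A (x i) (x (i + 1))}

/-- `X` is an irreducible subshift: any two allowable words can be joined. -/
def IrreducibleSubshift {k : ℕ} (X : Set (ℕ → Fin k)) : Prop :=
  ∀ (n m : ℕ) (u : Fin n → Fin k) (v : Fin m → Fin k), WordIn X u → WordIn X v →
    ∃ (q : ℕ) (w : Fin q → Fin k), WordIn X (Fin.append (Fin.append u w) v)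

/-- Prefix of length `n`. -/
def s16pre {k : ℕ} {X : Set (ℕ → Fin k)} (n : ℕ) (x : X) : Fin n → Fin k :=
  fun i => (x : ℕ → Fin k) i

/-- `E` lies over `y` up to time `n` and has distinct `n`-prefixes. -/
def s16Sep {k l : ℕ} {X : Set (ℕ → Fin k)} (πs : X → (ℕ → Fin l)) (n : ℕ) (y : ℕ → Fin l)
    (E : Finset X) : Prop :=
  (∀ x ∈ E, ∀ i < n, πs x i = y i) ∧ Set.InjOn (s16pre n) (E : Set X)

lemma s16_pre_eq {k : ℕ} {X : Set (ℕ → Fin k)} {n : ℕ} {x x' : X} :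
    s16pre n x = s16pre n x' ↔ ∀ i < n, (x : ℕ → Fin k) i = (x' : ℕ → Fin k) i := by
  constructor
  · intro h i hi
    exact congrFun h ⟨i, hi⟩
  · intro h
    funext i
    exact h i i.2

lemma s16_birk_add {α : Type*} (T : α → α) (h : α → ℝ) (n m : ℕ) (x : α) :
    birk T h (n + m) x = birk T h n x + birk T h m (T^[n] x) := by
  unfold birk
  rw [Finset.sum_range_add]
  congr 1
  refine Finset.sum_congr rfl fun i _ => ?_
  rw [← Function.iterate_add_apply, add_comm]

lemma s16_birk_abs {α : Type*} (T : α → α) (h : α → ℝ) (M : ℝ) (hM : ∀ x, |h x| ≤ M)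
    (n : ℕ) (x : α) : |birk T h n x| ≤ n * M := by
  unfold birk
  refine (Finset.abs_sum_le_sum_abs _ _).trans ?_
  refine (Finset.sum_le_sum fun i _ => hM _).trans ?_
  simp

lemma s16_iter {k : ℕ} {X : Set (ℕ → Fin k)} {σ : X → X}
    (hσ : ∀ x : X, (σ x : ℕ → Fin k) = shiftMap (x : ℕ → Fin k)) (n : ℕ) (x : X) (i : ℕ) :
    (σ^[n] x : ℕ → Fin k) i = (x : ℕ → Fin k) (i + n) := by
  induction n generalizing i with
  | zero => rfl
  | succ n ih =>
    rw [Function.iterate_succ_apply', hσ]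
    simp only [shiftMap]
    rw [ih, show i + 1 + n = i + (n + 1) by omega]

lemma s16_sep_card {k l : ℕ} {X : Set (ℕ → Fin k)} {πs : X → (ℕ → Fin l)} {n : ℕ}
    {y : ℕ → Fin l} {E : Finset X} (hE : s16Sep πs n y E) : E.card ≤ k ^ n := by
  classical
  have := Finset.card_le_card_of_injOn (s := E) (t := Finset.univ) (s16pre n)
    (fun _ _ => Finset.mem_coe.2 (Finset.mem_univ _)) hE.2
  simpa using this

lemma s16_sep_sum_le {k l : ℕ} {X : Set (ℕ → Fin k)} {σ : X → X} {πs : X → (ℕ → Fin l)}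
    {f : X → ℝ} {M : ℝ} (hM : ∀ x, |f x| ≤ M) {n : ℕ}
    {y : ℕ → Fin l} {E : Finset X} (hE : s16Sep πs n y E) :
    ∑ x ∈ E, Real.exp (birk σ f n x) ≤ (k : ℝ) ^ n * Real.exp (n * M) := by
  calc ∑ x ∈ E, Real.exp (birk σ f n x) ≤ ∑ x ∈ E, Real.exp (n * M) := by
        refine Finset.sum_le_sum fun x _ => Real.exp_le_exp.2 ?_
        exact (le_abs_self _).trans (s16_birk_abs σ f M hM n x)
    _ = (E.card : ℝ) * Real.exp (n * M) := by simp
    _ ≤ _ := by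
        gcongr
        exact_mod_cast s16_sep_card hE

lemma s16_ext {k l : ℕ} {X : Set (ℕ → Fin k)} {τ : Fin k → Fin l} {πs : X → (ℕ → Fin l)}
    (hτ : ∀ x i, πs x i = τ ((x : ℕ → Fin k) i)) {n : ℕ}
    {y : ℕ → Fin l} {E : Finset X} (hE : s16Sep πs n y E) :
    ∃ E' : Finset X, E ⊆ E' ∧ s16Sep πs n y E' ∧
      ∀ z : X, (∀ i < n, πs z i = y i) → ∃ x ∈ E', s16pre n x = s16pre n z := by
  classical
  let R : (Fin n → Fin k) → Prop := fun u => ∃ z : X, s16pre n z = u ∧ ∀ i < n, πs z i = y i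
  have key : ∀ u : {u // R u}, ∃ x : X, s16pre n x = u.1 ∧ (∀ i < n, πs x i = y i) ∧
      ∀ e ∈ E, s16pre n e = u.1 → x = e := by
    rintro ⟨u, z, hz, hzy⟩
    by_cases h : ∃ e ∈ E, s16pre n e = u
    · obtain ⟨e, he, heu⟩ := h
      exact ⟨e, heu, hE.1 e he, fun e' he' h' => hE.2 he he' (heu.trans h'.symm)⟩
    · exact ⟨z, hz, hzy, fun e he h' => absurd ⟨e, he, h'⟩ h⟩
  choose c hc1 hc2 hc3 using key
  refine ⟨Finset.univ.image c, ?_, ⟨?_, ?_⟩, ?_⟩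
  · intro e he
    refine Finset.mem_image.2 ⟨⟨s16pre n e, e, rfl, hE.1 e he⟩, Finset.mem_univ _, ?_⟩
    exact hc3 _ e he rfl
  · intro x hx
    obtain ⟨u, _, rfl⟩ := Finset.mem_image.1 hx
    exact hc2 u
  · intro x hx x' hx' h
    obtain ⟨u, _, rfl⟩ := Finset.mem_image.1 (Finset.mem_coe.1 hx)
    obtain ⟨u', _, rfl⟩ := Finset.mem_image.1 (Finset.mem_coe.1 hx')
    rw [hc1, hc1] at h
    rw [Subtype.ext h]
  · intro z hz
    exact ⟨c ⟨s16pre n z, z, rfl, hz⟩, Finset.mem_image_of_mem _ (Finset.mem_univ _), hc1 _⟩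

lemma s16_g_eq {k l : ℕ} {X : Set (ℕ → Fin k)} (σ : X → X) (πs : X → (ℕ → Fin l))
    (f : X → ℝ) (n : ℕ) (y : ℕ → Fin l) :
    gfun X σ πs f n y = sSup {s : ℝ | ∃ E : Finset X, s16Sep πs n y E ∧
      (∀ z : X, (∀ i < n, πs z i = y i) → ∃ x ∈ E, s16pre n x = s16pre n z) ∧
      s = ∑ x ∈ E, Real.exp (birk σ f n x)} := by
  unfold gfun
  congr 1
  ext s
  constructor
  · rintro ⟨E, h1, h2, h3, h4⟩
    refine ⟨E, ⟨fun x hx i hi => h1 x hx ⟨i, hi⟩, ?_⟩, ?_, h4⟩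
    · intro x hx x' hx' h
      exact h2 x hx x' hx' fun i => s16_pre_eq.1 h i i.2
    · intro z hz
      obtain ⟨x, hx, hxz⟩ := h3 (s16pre n z) ⟨z, fun i => rfl, fun i => hz i i.2⟩
      exact ⟨x, hx, funext hxz⟩
  · rintro ⟨E, ⟨h1, h2⟩, h3, h4⟩
    refine ⟨E, fun x hx i => h1 x hx i i.2, ?_, ?_, h4⟩
    · intro x hx x' hx' h
      exact h2 hx hx' (funext h)
    · rintro u ⟨z, hz, hzy⟩
      obtain ⟨x, hx, hxz⟩ := h3 z fun i hi => hzy ⟨i, hi⟩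
      exact ⟨x, hx, fun i => (congrFun hxz i).trans (hz i)⟩

lemma s16_le_g {k l : ℕ} {X : Set (ℕ → Fin k)} {σ : X → X} {τ : Fin k → Fin l}
    {πs : X → (ℕ → Fin l)}
    (hτ : ∀ x i, πs x i = τ ((x : ℕ → Fin k) i))
    {f : X → ℝ} {M : ℝ} (hM : ∀ x, |f x| ≤ M) {n : ℕ}
    {y : ℕ → Fin l} {E : Finset X} (hE : s16Sep πs n y E) :
    ∑ x ∈ E, Real.exp (birk σ f n x) ≤ gfun X σ πs f n y := by
  obtain ⟨E', hEE, hE', hfull⟩ := s16_ext hτ hE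
  rw [s16_g_eq]
  refine (Finset.sum_le_sum_of_subset_of_nonneg hEE fun _ _ _ => (Real.exp_pos _).le).trans ?_
  refine le_csSup ⟨(k : ℝ) ^ n * Real.exp (n * M), ?_⟩ ⟨E', hE', hfull, rfl⟩
  rintro s ⟨E, hE, -, rfl⟩
  exact s16_sep_sum_le hM hE

lemma s16_g_le {k l : ℕ} {X : Set (ℕ → Fin k)} {σ : X → X} {τ : Fin k → Fin l}
    {πs : X → (ℕ → Fin l)}
    (hτ : ∀ x i, πs x i = τ ((x : ℕ → Fin k) i))
    {f : X → ℝ} {n : ℕ} {y : ℕ → Fin l} {B : ℝ}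
    (hB : ∀ E : Finset X, s16Sep πs n y E → ∑ x ∈ E, Real.exp (birk σ f n x) ≤ B) :
    gfun X σ πs f n y ≤ B := by
  have h0 : s16Sep πs n y (∅ : Finset X) := ⟨by simp, by simp⟩
  obtain ⟨E', hEE, hE', hfull⟩ := s16_ext hτ h0
  rw [s16_g_eq]
  refine csSup_le ⟨_, E', hE', hfull, rfl⟩ ?_
  rintro s ⟨E, hE, -, rfl⟩
  exact hB E hE

lemma s16_g_nonneg {k l : ℕ} {X : Set (ℕ → Fin k)} {σ : X → X} {τ : Fin k → Fin l}
    {πs : X → (ℕ → Fin l)}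
    (hτ : ∀ x i, πs x i = τ ((x : ℕ → Fin k) i))
    {f : X → ℝ} {M : ℝ} (hM : ∀ x, |f x| ≤ M) (n : ℕ) (y : ℕ → Fin l) :
    0 ≤ gfun X σ πs f n y := by
  have h0 : s16Sep πs n y (∅ : Finset X) := ⟨by simp, by simp⟩
  simpa using s16_le_g (σ := σ) hτ hM h0

lemma s16_g_lower {k l : ℕ} {X : Set (ℕ → Fin k)} {σ : X → X} {τ : Fin k → Fin l}
    {πs : X → (ℕ → Fin l)}
    (hτ : ∀ x i, πs x i = τ ((x : ℕ → Fin k) i))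
    {f : X → ℝ} {M : ℝ} (hM : ∀ x, |f x| ≤ M) (n : ℕ) (x : X) :
    Real.exp (-(n * M)) ≤ gfun X σ πs f n (πs x) := by
  have h0 : s16Sep πs n (πs x) ({x} : Finset X) := ⟨by simp, by simp⟩
  have := s16_le_g (σ := σ) hτ hM h0
  rw [Finset.sum_singleton] at this
  refine le_trans (Real.exp_le_exp.2 ?_) this
  have := s16_birk_abs σ f M hM n x
  exact (abs_le.1 this).1

lemma s16_g_upper {k l : ℕ} {X : Set (ℕ → Fin k)} {σ : X → X} {τ : Fin k → Fin l}
    {πs : X → (ℕ → Fin l)}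
    (hτ : ∀ x i, πs x i = τ ((x : ℕ → Fin k) i))
    {f : X → ℝ} {M : ℝ} (hM : ∀ x, |f x| ≤ M) (n : ℕ) (y : ℕ → Fin l) :
    gfun X σ πs f n y ≤ (k : ℝ) ^ n * Real.exp (n * M) :=
  s16_g_le hτ fun _ hE => s16_sep_sum_le hM hE

lemma s16_g_congr {k l : ℕ} {X : Set (ℕ → Fin k)} (σ : X → X) (πs : X → (ℕ → Fin l))
    (f : X → ℝ) (n : ℕ) (y y' : ℕ → Fin l) (h : ∀ i < n, y i = y' i) :
    gfun X σ πs f n y = gfun X σ πs f n y' := by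
  unfold gfun
  have : ∀ i : Fin n, y i = y' i := fun i => h i i.2
  simp only [this]

lemma s16_subadd {k l : ℕ} {X : Set (ℕ → Fin k)} {σ : X → X}
    (hσ : ∀ x : X, (σ x : ℕ → Fin k) = shiftMap (x : ℕ → Fin k)) {τ : Fin k → Fin l}
    {πs : X → (ℕ → Fin l)}
    (hτ : ∀ x i, πs x i = τ ((x : ℕ → Fin k) i))
    {f : X → ℝ} {M : ℝ} (hM : ∀ x, |f x| ≤ M) (n m : ℕ) (y : ℕ → Fin l) :
    gfun X σ πs f (n + m) y ≤ gfun X σ πs f n y * gfun X σ πs f m (fun i => y (i + n)) := by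
  classical
  refine s16_g_le hτ fun E hE => ?_
  set g := gfun X σ πs f m (fun i => y (i + n)) with hg
  have hg0 : 0 ≤ g := s16_g_nonneg hτ hM _ _
  -- representatives
  have key : ∀ u : {u // u ∈ E.image (s16pre n)}, ∃ r ∈ E, s16pre n r = u.1 ∧
      ∀ x ∈ E, s16pre n x = u.1 → birk σ f n x ≤ birk σ f n r := by
    rintro ⟨u, hu⟩
    obtain ⟨x0, hx0, hx0u⟩ := Finset.mem_image.1 hu
    obtain ⟨r, hr, hmax⟩ := Finset.exists_max_image (E.filter fun x => s16pre n x = u)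
      (birk σ f n) ⟨x0, Finset.mem_filter.2 ⟨hx0, hx0u⟩⟩
    rw [Finset.mem_filter] at hr
    exact ⟨r, hr.1, hr.2, fun x hx hxu => hmax x (Finset.mem_filter.2 ⟨hx, hxu⟩)⟩
  choose r hrE hru hrmax using key
  have hrinj : Function.Injective r := by
    intro u u' h
    apply Subtype.ext
    rw [← hru u, ← hru u', h]
  have hsep : s16Sep πs n y (Finset.univ.image r) := by
    constructor
    · intro x hx i hi
      obtain ⟨u, _, rfl⟩ := Finset.mem_image.1 hx
      exact hE.1 _ (hrE u) i (by omega)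
    · intro x hx x' hx' h
      obtain ⟨u, _, rfl⟩ := Finset.mem_image.1 (Finset.mem_coe.1 hx)
      obtain ⟨u', _, rfl⟩ := Finset.mem_image.1 (Finset.mem_coe.1 hx')
      rw [hru, hru] at h
      rw [Subtype.ext h]
  have hfib : ∀ u : {u // u ∈ E.image (s16pre n)},
      ∑ x ∈ E.filter (fun x => s16pre n x = u.1), Real.exp (birk σ f (n + m) x) ≤
        Real.exp (birk σ f n (r u)) * g := by
    intro u
    have hinj : Set.InjOn (σ^[n]) (E.filter (fun x => s16pre n x = u.1) : Finset X) ∧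
        s16Sep πs m (fun i => y (i + n)) ((E.filter (fun x => s16pre n x = u.1)).image σ^[n]) := by
      have aux : ∀ x ∈ E.filter (fun x => s16pre n x = u.1),
          ∀ x' ∈ E.filter (fun x => s16pre n x = u.1),
          s16pre m (σ^[n] x) = s16pre m (σ^[n] x') → x = x' := by
        intro x hx x' hx' h
        rw [Finset.mem_filter] at hx hx'
        refine hE.2 hx.1 hx'.1 (s16_pre_eq.2 fun i hi => ?_)
        by_cases hin : i < n
        · exact s16_pre_eq.1 (hx.2.trans hx'.2.symm) i hin
        · have := s16_pre_eq.1 h (i - n) (by omega)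
          rw [s16_iter hσ, s16_iter hσ] at this
          rwa [Nat.sub_add_cancel (by omega)] at this
      refine ⟨fun x hx x' hx' h => aux x hx x' hx' (by rw [h]), ?_, ?_⟩
      · intro x hx i hi
        obtain ⟨x, hx2, rfl⟩ := Finset.mem_image.1 hx
        rw [hτ, s16_iter hσ, ← hτ]
        exact hE.1 x (Finset.mem_filter.1 hx2).1 _ (by omega)
      · intro x hx x' hx' h
        obtain ⟨x, hx2, rfl⟩ := Finset.mem_image.1 (Finset.mem_coe.1 hx)
        obtain ⟨x', hx2', rfl⟩ := Finset.mem_image.1 (Finset.mem_coe.1 hx')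
        rw [aux x hx2 x' hx2' h]
    have h2 := s16_le_g (σ := σ) hτ hM hinj.2
    rw [Finset.sum_image hinj.1] at h2
    calc _ ≤ ∑ x ∈ E.filter (fun x => s16pre n x = u.1),
          Real.exp (birk σ f n (r u)) * Real.exp (birk σ f m (σ^[n] x)) := by
          refine Finset.sum_le_sum fun x hx => ?_
          rw [Finset.mem_filter] at hx
          rw [s16_birk_add, Real.exp_add]
          gcongr
          exact hrmax u x hx.1 hx.2
      _ ≤ _ := by
          rw [← Finset.mul_sum]
          gcongr
  calc ∑ x ∈ E, Real.exp (birk σ f (n + m) x)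
      = ∑ u ∈ E.image (s16pre n), ∑ x ∈ E.filter (fun x => s16pre n x = u),
          Real.exp (birk σ f (n + m) x) :=
        (Finset.sum_fiberwise_of_maps_to (fun x hx => Finset.mem_image_of_mem _ hx) _).symm
    _ = ∑ u : {u // u ∈ E.image (s16pre n)}, ∑ x ∈ E.filter (fun x => s16pre n x = u.1),
          Real.exp (birk σ f (n + m) x) := by
        rw [← Finset.sum_coe_sort]
    _ ≤ ∑ u : {u // u ∈ E.image (s16pre n)}, Real.exp (birk σ f n (r u)) * g :=
        Finset.sum_le_sum fun u _ => hfib u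
    _ = (∑ x ∈ Finset.univ.image r, Real.exp (birk σ f n x)) * g := by
        rw [← Finset.sum_mul, Finset.sum_image hrinj.injOn]
    _ ≤ _ := by
        gcongr
        exact s16_le_g hτ hM hsep

/-- bounded image and distortion -/
lemma s16_bdd {k : ℕ} {X : Set (ℕ → Fin k)} (hX : IsClosed X) {f : X → ℝ} (hf : Continuous f) :
    ∃ M : ℝ, 0 ≤ M ∧ ∀ x, |f x| ≤ M := by
  have : CompactSpace X := isCompact_iff_compactSpace.1 hX.isCompact
  obtain ⟨M, hM⟩ := (isCompact_range hf.abs).bddAbove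
  exact ⟨max M 0, le_max_right _ _, fun x => (hM ⟨x, rfl⟩).trans (le_max_left _ _)⟩

lemma s16_unif {k : ℕ} {X : Set (ℕ → Fin k)} (hX : IsClosed X) {f : X → ℝ} (hf : Continuous f)
    {ε : ℝ} (hε : 0 < ε) :
    ∃ N : ℕ, ∀ x x' : X, (∀ i < N, (x : ℕ → Fin k) i = (x' : ℕ → Fin k) i) →
      |f x - f x'| ≤ ε := by
  classical
  have : CompactSpace X := isCompact_iff_compactSpace.1 hX.isCompact
  have loc : ∀ x : X, ∃ N : ℕ, ∀ x' : X, (∀ i < N, (x' : ℕ → Fin k) i = (x : ℕ → Fin k) i) →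
      |f x' - f x| < ε / 2 := by
    intro x
    have h1 : {x' : X | |f x' - f x| < ε / 2} ∈ 𝓝 x := by
      have : Continuous fun x' : X => |f x' - f x| := (hf.sub continuous_const).abs
      exact this.isOpen_preimage _ isOpen_Iio |>.mem_nhds (by simp [hε])
    rw [nhds_subtype, Filter.mem_comap] at h1
    obtain ⟨t, ht, hts⟩ := h1
    obtain ⟨u, ⟨z, N, rfl⟩, hxu, hut⟩ :=
      (PiNat.isTopologicalBasis_cylinders (fun _ : ℕ => Fin k)).mem_nhds_iff.1 ht
    refine ⟨N, fun x' hx' => hts (hut ?_)⟩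
    intro i hi
    rw [hx' i hi]
    exact hxu i hi
  choose N hN using loc
  have hopen : ∀ x : X, IsOpen {x' : X | ∀ i < N x, (x' : ℕ → Fin k) i = (x : ℕ → Fin k) i} := by
    intro x
    exact (PiNat.isOpen_cylinder (fun _ : ℕ => Fin k) (x : ℕ → Fin k) (N x)).preimage
      continuous_subtype_val
  obtain ⟨t, ht⟩ := isCompact_univ.elim_finite_subcover _ hopen
    (fun x _ => Set.mem_iUnion.2 ⟨x, fun i _ => rfl⟩)
  refine ⟨t.sup N, fun x x' hxx => ?_⟩
  obtain ⟨c, hc⟩ := Set.mem_iUnion.1 (ht (Set.mem_univ x))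
  obtain ⟨hct, hxc⟩ := Set.mem_iUnion.1 hc
  have hle : N c ≤ t.sup N := Finset.le_sup hct
  have h1 := hN c x hxc
  have h2 := hN c x' fun i hi => (hxx i (by omega)).symm.trans (hxc i hi)
  rw [abs_lt] at h1 h2
  rw [abs_le]
  constructor <;> linarith [h1.1, h1.2, h2.1, h2.2]

lemma s16_dist {k : ℕ} {X : Set (ℕ → Fin k)} (hX : IsClosed X) {σ : X → X}
    (hσ : ∀ x : X, (σ x : ℕ → Fin k) = shiftMap (x : ℕ → Fin k))
    {f : X → ℝ} (hf : Continuous f) {ε : ℝ} (hε : 0 < ε) :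
    ∃ C : ℝ, 0 ≤ C ∧ ∀ (n : ℕ) (x x' : X),
      (∀ i < n, (x : ℕ → Fin k) i = (x' : ℕ → Fin k) i) →
      |birk σ f n x - birk σ f n x'| ≤ ε * n + C := by
  obtain ⟨M, hM0, hM⟩ := s16_bdd hX hf
  obtain ⟨N, hN⟩ := s16_unif hX hf hε
  refine ⟨2 * M * N, by positivity, fun n x x' hxx => ?_⟩
  have hbound : ∀ j, |birk σ f j x - birk σ f j x'| ≤ 2 * M * j := by
    intro j
    have h1 := abs_le.1 (s16_birk_abs σ f M hM j x)
    have h2 := abs_le.1 (s16_birk_abs σ f M hM j x')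
    rw [abs_le]
    constructor <;> nlinarith [h1.1, h1.2, h2.1, h2.2]
  by_cases hn : n ≤ N
  · refine (hbound n).trans ?_
    have : (n : ℝ) ≤ N := by exact_mod_cast hn
    have h3 : 0 ≤ ε * n := by positivity
    nlinarith
  · obtain ⟨j, rfl⟩ : ∃ j, n = j + N := ⟨n - N, by omega⟩
    have h1 : |birk σ f j x - birk σ f j x'| ≤ ε * j := by
      unfold birk
      rw [← Finset.sum_sub_distrib]
      refine (Finset.abs_sum_le_sum_abs _ _).trans ?_
      refine (Finset.sum_le_sum (g := fun _ => ε) fun i hi => ?_).trans (by simp [mul_comm])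
      rw [Finset.mem_range] at hi
      refine hN _ _ fun a ha => ?_
      rw [s16_iter hσ, s16_iter hσ]
      exact hxx _ (by omega)
    have h2 : |birk σ f N (σ^[j] x) - birk σ f N (σ^[j] x')| ≤ 2 * M * N := by
      have h1 := abs_le.1 (s16_birk_abs σ f M hM N (σ^[j] x))
      have h2 := abs_le.1 (s16_birk_abs σ f M hM N (σ^[j] x'))
      rw [abs_le]
      constructor <;> nlinarith [h1.1, h1.2, h2.1, h2.2]
    rw [s16_birk_add, s16_birk_add]
    have h4 : 0 ≤ ε * N := by positivity
    rw [abs_le] at *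
    push_cast
    constructor <;> linarith [h1.1, h1.2, h2.1, h2.2]

/-- glue `u` up to time `p` with `x` -/
def s16glue {k : ℕ} (p : ℕ) (u x : ℕ → Fin k) : ℕ → Fin k :=
  fun i => if i < p then u i else x (i - p)

lemma s16_glue_mem {k : ℕ} {X : Set (ℕ → Fin k)} (hSFT : IsSFT X) {p : ℕ} {u x : ℕ → Fin k}
    (hu : u ∈ X) (hx : x ∈ X) (h : u p = x 0) : s16glue p u x ∈ X := by
  obtain ⟨A, rfl⟩ := hSFT
  intro i
  have h1 := hu i
  unfold s16glue
  by_cases hi : i + 1 < p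
  · rw [if_pos (by omega), if_pos hi]; exact h1
  · by_cases hi' : i < p
    · have : i + 1 = p := by omega
      rw [if_pos hi', if_neg hi, this, Nat.sub_self, ← h, ← this]; exact h1
    · rw [if_neg hi', if_neg hi, show i + 1 - p = (i - p) + 1 by omega]
      exact hx _

lemma s16_per_mem {k : ℕ} {X : Set (ℕ → Fin k)} (hSFT : IsSFT X) {p : ℕ} (hp : 0 < p)
    {u : ℕ → Fin k} (hu : u ∈ X) (h : u p = u 0) : (fun i => u (i % p)) ∈ X := by
  obtain ⟨A, rfl⟩ := hSFT
  intro i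
  have h1 := hu (i % p)
  have hlt := Nat.mod_lt i hp
  show A (u (i % p)) (u ((i + 1) % p))
  by_cases hi : i % p + 1 = p
  · have : (i + 1) % p = 0 := by
      rw [Nat.add_mod]
      by_cases h1p : p = 1
      · subst h1p; simp [Nat.mod_one]
      · rw [Nat.mod_eq_of_lt (show 1 < p by omega), hi, Nat.mod_self]
    rw [this, ← h]
    rw [hi] at h1
    exact h1
  · have : (i + 1) % p = i % p + 1 := by
      rw [Nat.add_mod, Nat.mod_eq_of_lt (show 1 < p by omega), Nat.mod_eq_of_lt (by omega)]
    rw [this]; exact h1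

lemma s16_connect {k : ℕ} {X : Set (ℕ → Fin k)} (hX : IsSubshift X)
    (hirr : IrreducibleSubshift X) :
    ∃ Q : ℕ, ∀ x ∈ X, ∀ i j : ℕ, ∃ c ∈ X, ∃ q, 1 ≤ q ∧ q ≤ Q ∧ c 0 = x i ∧ c q = x j := by
  classical
  have hsh : ∀ x ∈ X, ∀ i, (fun n => x (n + i)) ∈ X := by
    intro x hx i
    induction i with
    | zero => exact hx
    | succ i ih =>
      have := hX.2 _ ih
      convert this using 1
      funext n
      simp only [shiftMap]
      congr 1
      omega
  have key : ∀ ab : Fin k × Fin k, ∃ q : ℕ, (∃ x ∈ X, ∃ i j : ℕ, x i = ab.1 ∧ x j = ab.2) →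
      1 ≤ q ∧ ∃ c ∈ X, c 0 = ab.1 ∧ c q = ab.2 := by
    rintro ⟨a, b⟩
    by_cases hex : ∃ x ∈ X, ∃ i j : ℕ, x i = a ∧ x j = b
    · obtain ⟨x, hx, i, j, rfl, rfl⟩ := hex
      obtain ⟨q, w, c, hc, hcw⟩ := hirr 1 1 (fun _ => x i) (fun _ => x j)
        ⟨_, hsh x hx i, fun n => by simp⟩ ⟨_, hsh x hx j, fun n => by simp⟩
      refine ⟨1 + q, fun _ => ⟨by omega, c, hc, ?_, ?_⟩⟩
      · have := hcw (Fin.castAdd 1 (Fin.castAdd q 0))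
        rw [Fin.append_left, Fin.append_left] at this
        simpa using this
      · have := hcw (Fin.natAdd (1 + q) 0)
        rw [Fin.append_right] at this
        simpa using this
    · exact ⟨0, fun h => absurd h hex⟩
  choose q hq using key
  refine ⟨Finset.univ.sup q, fun x hx i j => ?_⟩
  obtain ⟨h1, c, hc, hc0, hcq⟩ := hq (x i, x j) ⟨x, hx, i, j, rfl, rfl⟩
  exact ⟨c, hc, q (x i, x j), h1, Finset.le_sup (Finset.mem_univ _), hc0, hcq⟩

lemma s16_seq {φ : ℕ → ℝ} (hφ : Tendsto (fun n : ℕ => (1 / (n : ℝ)) * φ n) atTop (𝓝 0))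
    {p : ℕ} (hp : 0 < p) {D : ℝ} (hD : ∀ m : ℕ, m * D ≤ φ (m * p)) : D ≤ 0 := by
  have h1 : Tendsto (fun m : ℕ => m * p) atTop atTop := tendsto_id.atTop_mul_const' hp
  have h2 := hφ.comp h1
  have hp' : (0 : ℝ) < p := by exact_mod_cast hp
  have h3 : D / p ≤ 0 := by
    refine ge_of_tendsto h2 ?_
    filter_upwards [eventually_gt_atTop 0] with m hm
    have hm' : (0 : ℝ) < m := by exact_mod_cast hm
    have := hD m
    simp only [Function.comp]
    push_cast
    rw [div_le_iff₀ hp', one_div, inv_mul_eq_div, div_mul_eq_mul_div, le_div_iff₀ (by positivity)]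
    nlinarith
  by_contra hneg
  push Not at hneg
  exact absurd h3 (not_le.2 (by positivity))

lemma s16_birk_per {α : Type*} (T : α → α) (h : α → ℝ) (p : ℕ) (z : α) (hz : T^[p] z = z)
    (m : ℕ) : birk T h (m * p) z = m * birk T h p z := by
  induction m with
  | zero => simp [birk]
  | succ m ih =>
    rw [show (m + 1) * p = p + m * p by ring, s16_birk_add, hz, ih]
    push_cast
    ring

lemma s16_g_pow_le {k l : ℕ} {X : Set (ℕ → Fin k)} {σ : X → X}
    (hσ : ∀ x : X, (σ x : ℕ → Fin k) = shiftMap (x : ℕ → Fin k)) {τ : Fin k → Fin l}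
    {πs : X → (ℕ → Fin l)}
    (hτ : ∀ x i, πs x i = τ ((x : ℕ → Fin k) i))
    {f : X → ℝ} {M : ℝ} (hM : ∀ x, |f x| ≤ M) (p : ℕ) (z : ℕ → Fin l)
    (hz : ∀ i, z (i + p) = z i) (m : ℕ) :
    gfun X σ πs f (m * p) z ≤ gfun X σ πs f p z ^ m := by
  induction m with
  | zero => simpa using s16_g_upper (σ := σ) hτ hM 0 z
  | succ m ih =>
    rw [show (m + 1) * p = p + m * p by ring]
    refine (s16_subadd hσ hτ hM p (m * p) z).trans ?_
    rw [pow_succ, mul_comm]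
    simp only [hz]
    exact mul_le_mul_of_nonneg_right ih (s16_g_nonneg hτ hM _ _)

lemma s16_pow_le_g {k l : ℕ} {X : Set (ℕ → Fin k)} (hSFT : IsSFT X) {σ : X → X}
    (hσ : ∀ x : X, (σ x : ℕ → Fin k) = shiftMap (x : ℕ → Fin k)) {τ : Fin k → Fin l}
    {πs : X → (ℕ → Fin l)}
    (hτ : ∀ x i, πs x i = τ ((x : ℕ → Fin k) i))
    {f : X → ℝ} {p : ℕ} (hp : 0 < p) {z : ℕ → Fin l}
    (hz : ∀ i, z (i + p) = z i) {T : Finset X} (hTne : T.Nonempty) {H : X → X} {a : Fin k}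
    (h0 : ∀ u ∈ T, (H u : ℕ → Fin k) 0 = a) (h1 : ∀ u ∈ T, (H u : ℕ → Fin k) p = a)
    (h2 : ∀ u ∈ T, ∀ i < p, πs (H u) i = z i)
    (h3 : ∀ u ∈ T, ∀ u' ∈ T, (∀ i < p, (H u : ℕ → Fin k) i = (H u' : ℕ → Fin k) i) → u = u')
    {ω : X → ℝ} (hω0 : ∀ u, 0 ≤ ω u)
    (hω : ∀ u ∈ T, ∀ x : X, (∀ i < p, (x : ℕ → Fin k) i = (H u : ℕ → Fin k) i) →
      ω u ≤ Real.exp (birk σ f p x)) (m : ℕ) :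
    ∃ E : Finset X, s16Sep πs (m * p) z E ∧ (∀ x ∈ E, (x : ℕ → Fin k) 0 = a) ∧
      (∑ u ∈ T, ω u) ^ m ≤ ∑ x ∈ E, Real.exp (birk σ f (m * p) x) := by
  classical
  induction m with
  | zero =>
    obtain ⟨u, hu⟩ := hTne
    refine ⟨{H u}, ⟨by simp, by simp⟩, by simpa using h0 u hu, by simp [birk]⟩
  | succ m ih =>
    obtain ⟨E, hE, hEa, hEs⟩ := ih
    have key : ∀ t : X × X, ∃ w : X, t.1 ∈ T → t.2 ∈ E →
        (w : ℕ → Fin k) = s16glue p (H t.1) t.2 := by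
      rintro ⟨u, x⟩
      by_cases hh : u ∈ T ∧ x ∈ E
      · exact ⟨⟨_, s16_glue_mem hSFT (H u).2 x.2 ((h1 u hh.1).trans (hEa x hh.2).symm)⟩,
          fun _ _ => rfl⟩
      · exact ⟨u, fun hu hx => absurd ⟨hu, hx⟩ hh⟩
    choose G hG using key
    have hGlt : ∀ t ∈ T ×ˢ E, ∀ i < p, (G t : ℕ → Fin k) i = (H t.1 : ℕ → Fin k) i := by
      intro t ht i hi
      rw [Finset.mem_product] at ht
      rw [hG t ht.1 ht.2, s16glue, if_pos hi]
    have hGge : ∀ t ∈ T ×ˢ E, ∀ i, (G t : ℕ → Fin k) (i + p) = (t.2 : ℕ → Fin k) i := by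
      intro t ht i
      rw [Finset.mem_product] at ht
      rw [hG t ht.1 ht.2, s16glue, if_neg (by omega), Nat.add_sub_cancel]
    have hGσ : ∀ t ∈ T ×ˢ E, σ^[p] (G t) = t.2 := by
      intro t ht
      apply Subtype.ext
      funext i
      rw [s16_iter hσ, hGge t ht]
    have hexp : (m + 1) * p = p + m * p := by ring
    have hinj : ∀ t ∈ T ×ˢ E, ∀ t' ∈ T ×ˢ E,
        (∀ i < (m + 1) * p, (G t : ℕ → Fin k) i = (G t' : ℕ → Fin k) i) → t = t' := by
      intro t ht t' ht' h
      have ht1 := Finset.mem_product.1 ht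
      have ht1' := Finset.mem_product.1 ht'
      refine Prod.ext ?_ ?_
      · refine h3 _ ht1.1 _ ht1'.1 fun i hi => ?_
        rw [← hGlt t ht i hi, ← hGlt t' ht' i hi]
        exact h i (by omega)
      · refine hE.2 ht1.2 ht1'.2 (s16_pre_eq.2 fun i hi => ?_)
        rw [← hGge t ht, ← hGge t' ht']
        exact h _ (by omega)
    refine ⟨(T ×ˢ E).image G, ⟨?_, ?_⟩, ?_, ?_⟩
    · intro x hx i hi
      obtain ⟨t, ht, rfl⟩ := Finset.mem_image.1 hx
      have ht1 := Finset.mem_product.1 ht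
      by_cases hip : i < p
      · rw [hτ, hGlt t ht i hip, ← hτ]
        exact h2 _ ht1.1 i hip
      · obtain ⟨j, rfl⟩ : ∃ j, i = j + p := ⟨i - p, by omega⟩
        rw [hτ, hGge t ht, ← hτ, hz]
        exact hE.1 _ ht1.2 j (by omega)
    · intro x hx x' hx' h
      obtain ⟨t, ht, rfl⟩ := Finset.mem_image.1 (Finset.mem_coe.1 hx)
      obtain ⟨t', ht', rfl⟩ := Finset.mem_image.1 (Finset.mem_coe.1 hx')
      rw [hinj t ht t' ht' (s16_pre_eq.1 h)]
    · intro x hx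
      obtain ⟨t, ht, rfl⟩ := Finset.mem_image.1 hx
      rw [hGlt t ht 0 hp]
      exact h0 _ (Finset.mem_product.1 ht).1
    · rw [Finset.sum_image (fun t ht t' ht' h => hinj t ht t' ht' (by rw [h]; simp))]
      have hS : 0 ≤ ∑ u ∈ T, ω u := Finset.sum_nonneg fun u _ => hω0 u
      calc (∑ u ∈ T, ω u) ^ (m + 1)
          ≤ (∑ u ∈ T, ω u) * ∑ x ∈ E, Real.exp (birk σ f (m * p) x) := by
            rw [pow_succ, mul_comm]
            gcongr
        _ = ∑ t ∈ T ×ˢ E, ω t.1 * Real.exp (birk σ f (m * p) t.2) := by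
            rw [Finset.sum_mul_sum, Finset.sum_product]
        _ ≤ _ := by
            refine Finset.sum_le_sum fun t ht => ?_
            rw [hexp, s16_birk_add, hGσ t ht, Real.exp_add]
            gcongr
            exact hω t.1 (Finset.mem_product.1 ht).1 _ (hGlt t ht)

set_option maxHeartbeats 2000000 in
lemma s16_main {k l : ℕ}
    (X : Set (ℕ → Fin k)) (hX : IsSubshift X)
    (hSFT : IsSFT X) (hirr : IrreducibleSubshift X)
    (Y : Set (ℕ → Fin l)) (hY : IsSubshift Y)
    (σX : X → X) (hσX : ∀ x : X, (σX x : ℕ → Fin k) = shiftMap (x : ℕ → Fin k))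
    (σY : Y → Y) (hσY : ∀ y : Y, (σY y : ℕ → Fin l) = shiftMap (y : ℕ → Fin l))
    (π : X → Y) (hπs : Function.Surjective π)
    (τ : Fin k → Fin l) (hτ' : ∀ (x : X) (i : ℕ), (π x : ℕ → Fin l) i = τ ((x : ℕ → Fin k) i))
    (f : X → ℝ) (hf : Continuous f)
    (h : Y → ℝ) (hh : Continuous h)
    (hper : ∀ y : Y, (∃ p, 0 < p ∧ σY^[p] y = y) →
        Tendsto (fun n : ℕ => (1 / (n : ℝ)) *
          Real.log (gfun X σX (fun z => ((π z : ℕ → Fin l))) f n (y : ℕ → Fin l) /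
            Real.exp (birk σY h n y))) atTop (𝓝 0))
    {ε : ℝ} (hε : 0 < ε) :
    ∃ C : ℝ, 0 ≤ C ∧ ∀ (n : ℕ) (y : Y), 1 ≤ n →
      |Real.log (gfun X σX (fun z => ((π z : ℕ → Fin l))) f n (y : ℕ → Fin l) /
            Real.exp (birk σY h n y))| ≤ ε * n + C := by
  classical
  set πs : X → (ℕ → Fin l) := fun z => ((π z : ℕ → Fin l)) with hπsdef
  have hτ : ∀ x i, πs x i = τ ((x : ℕ → Fin k) i) := hτ'
  obtain ⟨Mf, hMf0, hMf⟩ := s16_bdd hX.1 hf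
  obtain ⟨Mh, hMh0, hMh⟩ := s16_bdd hY.1 hh
  obtain ⟨C1, hC10, hC1⟩ := s16_dist hX.1 hσX hf (half_pos hε)
  obtain ⟨C2, hC20, hC2⟩ := s16_dist hY.1 hσY hh (half_pos hε)
  obtain ⟨Q, hQ⟩ := s16_connect hX hirr
  set L : ℝ := |Real.log (2 * (k : ℝ) ^ 2)| + Q * |Real.log k| with hL
  have hL0 : 0 ≤ L := by positivity
  refine ⟨C1 + C2 + Q * Mf + Q * Mh + L, by positivity, fun n y hn => ?_⟩
  obtain ⟨x0, rfl⟩ := hπs y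
  have hk : 0 < k := by
    have := ((x0 : ℕ → Fin k) 0).2
    omega
  have hk' : (0 : ℝ) < k := by exact_mod_cast hk
  have hgpos : ∀ n (y : Y), 0 < gfun X σX πs f n (y : ℕ → Fin l) := by
    intro n y
    obtain ⟨x, rfl⟩ := hπs y
    exact (Real.exp_pos _).trans_le (s16_g_lower (πs := πs) hτ hMf n x)
  have hlog : ∀ n (y : Y), Real.log (gfun X σX πs f n (y : ℕ → Fin l) /
      Real.exp (birk σY h n y)) = Real.log (gfun X σX πs f n (y : ℕ → Fin l)) - birk σY h n y := by
    intro n y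
    rw [Real.log_div (hgpos n y).ne' (Real.exp_pos _).ne', Real.log_exp]
  simp only [hlog] at hper ⊢
  set y : Y := π x0 with hy
  set g := gfun X σX πs f n (y : ℕ → Fin l) with hg
  have hg0 : 0 < g := hgpos n y
  -- choose a nearly optimal transversal
  obtain ⟨E0, hE0, hE0s⟩ : ∃ E : Finset X, s16Sep πs n y E ∧
      g / 2 < ∑ x ∈ E, Real.exp (birk σX f n x) := by
    by_contra hcon
    push Not at hcon
    have : g ≤ g / 2 := s16_g_le hτ hcon
    linarith
  -- most popular pair
  let P : X → Fin k × Fin k := fun x => ((x : ℕ → Fin k) 0, (x : ℕ → Fin k) (n - 1))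
  obtain ⟨ab, hab⟩ : ∃ ab : Fin k × Fin k, g / (2 * (k : ℝ) ^ 2) <
      ∑ x ∈ E0.filter (fun x => P x = ab), Real.exp (birk σX f n x) := by
    by_contra hcon
    push Not at hcon
    have h1 := Finset.sum_le_sum (s := Finset.univ) fun ab _ => hcon ab
    rw [Finset.sum_fiberwise] at h1
    simp only [Finset.sum_const, Finset.card_univ, Fintype.card_prod, Fintype.card_fin,
      nsmul_eq_mul, Nat.cast_mul] at h1
    have h2 : (k : ℝ) * k * (g / (2 * (k : ℝ) ^ 2)) = g / 2 := by
      field_simp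
    linarith
  set T := E0.filter (fun x => P x = ab) with hT
  have hTne : T.Nonempty := by
    rw [Finset.nonempty_iff_ne_empty]
    intro h0
    rw [h0, Finset.sum_empty] at hab
    exact absurd hab (not_lt.2 (by positivity))
  obtain ⟨x1, hx1⟩ := hTne
  obtain ⟨c, hcX, q, hq1, hqQ, hc0, hcq⟩ := hQ x1 x1.2 (n - 1) 0
  have hTE : ∀ u ∈ T, u ∈ E0 := fun u hu => (Finset.mem_filter.1 hu).1
  have hTP : ∀ u ∈ T, (u : ℕ → Fin k) 0 = (x1 : ℕ → Fin k) 0 ∧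
      (u : ℕ → Fin k) (n - 1) = (x1 : ℕ → Fin k) (n - 1) := by
    intro u hu
    have : P u = P x1 := (Finset.mem_filter.1 hu).2.trans (Finset.mem_filter.1 hx1).2.symm
    exact ⟨congrArg Prod.fst this, congrArg Prod.snd this⟩
  have key : ∀ u : X, ∃ w : X, u ∈ T → (w : ℕ → Fin k) = s16glue (n - 1) u c := by
    intro u
    by_cases hu : u ∈ T
    · exact ⟨⟨_, s16_glue_mem hSFT u.2 hcX ((hTP u hu).2.trans hc0.symm)⟩, fun _ => rfl⟩
    · exact ⟨u, fun h => absurd h hu⟩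
  choose H hH using key
  obtain ⟨r, rfl⟩ : ∃ r, q = r + 1 := ⟨q - 1, by omega⟩
  have hHlt : ∀ u ∈ T, ∀ i < n, (H u : ℕ → Fin k) i = (u : ℕ → Fin k) i := by
    intro u hu i hi
    rw [hH u hu, s16glue]
    split_ifs with h1
    · rfl
    · have : i = n - 1 := by omega
      rw [this, Nat.sub_self, hc0, (hTP u hu).2]
  have hHge : ∀ u ∈ T, ∀ i, n ≤ i → (H u : ℕ → Fin k) i = c (i - (n - 1)) := by
    intro u hu i hi
    rw [hH u hu, s16glue, if_neg (by omega)]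
  set p := n + r with hp
  have hp0 : 0 < p := by omega
  have hH0 : ∀ u ∈ T, (H u : ℕ → Fin k) 0 = (x1 : ℕ → Fin k) 0 := fun u hu => by
    rw [hHlt u hu 0 (by omega), (hTP u hu).1]
  have hHp : ∀ u ∈ T, (H u : ℕ → Fin k) p = (x1 : ℕ → Fin k) 0 := fun u hu => by
    rw [hHge u hu p (by omega), show p - (n - 1) = r + 1 by omega, hcq]
  -- the periodic point
  let xz : X := ⟨_, s16_per_mem hSFT hp0 (H x1).2 ((hHp x1 hx1).trans (hH0 x1 hx1).symm)⟩
  set z : Y := π xz with hzdef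
  have hzi : ∀ i, (z : ℕ → Fin l) i = τ ((H x1 : ℕ → Fin k) (i % p)) := fun i => hτ xz i
  have hzp : ∀ i, (z : ℕ → Fin l) (i + p) = (z : ℕ → Fin l) i := by
    intro i
    rw [hzi, hzi, Nat.add_mod_right]
  have hzper : σY^[p] z = z := by
    apply Subtype.ext
    funext i
    rw [s16_iter hσY, hzp]
  have hHz : ∀ u ∈ T, ∀ i < p, πs (H u) i = (z : ℕ → Fin l) i := by
    intro u hu i hi
    rw [hzi, Nat.mod_eq_of_lt hi, hτ]
    by_cases hin : i < n
    · rw [hHlt u hu i hin, hHlt x1 hx1 i hin, ← hτ, ← hτ,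
        hE0.1 u (hTE u hu) i hin, hE0.1 x1 (hTE x1 hx1) i hin]
    · rw [hHge u hu i (by omega), hHge x1 hx1 i (by omega)]
  have hzy : ∀ i < n, (z : ℕ → Fin l) i = (y : ℕ → Fin l) i := by
    intro i hi
    rw [← hHz x1 hx1 i (by omega), hτ, hHlt x1 hx1 i hi, ← hτ, hE0.1 x1 (hTE x1 hx1) i hi]
  have hHinj : ∀ u ∈ T, ∀ u' ∈ T,
      (∀ i < p, (H u : ℕ → Fin k) i = (H u' : ℕ → Fin k) i) → u = u' := by
    intro u hu u' hu' hu3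
    refine hE0.2 (hTE u hu) (hTE u' hu') (s16_pre_eq.2 fun i hi => ?_)
    rw [← hHlt u hu i hi, ← hHlt u' hu' i hi]
    exact hu3 i (by omega)
  have hrQ : (r : ℝ) ≤ Q := by
    have : r ≤ Q := by omega
    exact_mod_cast this
  -- weights
  set K : ℝ := ε / 2 * n + C1 + Q * Mf with hK
  let ω : X → ℝ := fun u => Real.exp (birk σX f n u) * Real.exp (-K)
  have hω : ∀ u ∈ T, ∀ x : X, (∀ i < p, (x : ℕ → Fin k) i = (H u : ℕ → Fin k) i) →
      ω u ≤ Real.exp (birk σX f p x) := by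
    intro u hu x hx
    simp only [ω]
    rw [← Real.exp_add, Real.exp_le_exp, hp, s16_birk_add]
    have e1 := abs_le.1 (hC1 n x u fun i hi => (hx i (by omega)).trans (hHlt u hu i hi))
    have e2 := abs_le.1 (s16_birk_abs σX f Mf hMf r (σX^[n] x))
    have e3 : (r : ℝ) * Mf ≤ Q * Mf := by gcongr
    linarith [e1.1, e2.1]
  have hlow : ∀ m : ℕ, (∑ u ∈ T, ω u) ^ m ≤ gfun X σX πs f (m * p) (z : ℕ → Fin l) := by
    intro m
    obtain ⟨E, hE, -, hEs⟩ := s16_pow_le_g (f := f) hSFT hσX hτ hp0 hzp ⟨x1, hx1⟩ hH0 hHp hHz hHinj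
      (fun u => by positivity) hω m
    exact hEs.trans (s16_le_g hτ hMf hE)
  have hωsum : ∑ u ∈ T, ω u = (∑ u ∈ T, Real.exp (birk σX f n u)) * Real.exp (-K) := by
    rw [Finset.sum_mul]
  have hSpos : 0 < ∑ u ∈ T, Real.exp (birk σX f n u) :=
    lt_trans (by positivity) hab
  have hωpos : 0 < ∑ u ∈ T, ω u := by
    rw [hωsum]; positivity
  have hzlim := hper z ⟨p, hp0, hzper⟩
  have hD1 : Real.log (∑ u ∈ T, ω u) - birk σY h p z ≤ 0 := by
    refine s16_seq hzlim hp0 fun m => ?_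
    rw [s16_birk_per σY h p z hzper]
    have := Real.log_le_log (by positivity) (hlow m)
    rw [Real.log_pow] at this
    linarith
  have hD2 : -(Real.log (gfun X σX πs f p (z : ℕ → Fin l)) - birk σY h p z) ≤ 0 := by
    have hneg : Tendsto (fun n : ℕ => (1 / (n : ℝ)) *
        (-(Real.log (gfun X σX πs f n (z : ℕ → Fin l)) - birk σY h n z))) atTop (𝓝 0) := by
      have := hzlim.neg
      simpa only [mul_neg, neg_zero] using this
    refine s16_seq hneg hp0 fun m => ?_
    rw [s16_birk_per σY h p z hzper]
    have := Real.log_le_log (hgpos (m * p) z) (s16_g_pow_le hσX hτ hMf p z hzp m)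
    rw [Real.log_pow] at this
    linarith
  -- comparison of Birkhoff sums of `h`
  have hh1 := abs_le.1 (hC2 n z y hzy)
  have hh2 := abs_le.1 (s16_birk_abs σY h Mh hMh r (σY^[n] z))
  have hh3 : (r : ℝ) * Mh ≤ Q * Mh := by gcongr
  have hbp : birk σY h p z = birk σY h n z + birk σY h r (σY^[n] z) := s16_birk_add _ _ _ _ _
  have hl1 : |Real.log (2 * (k : ℝ) ^ 2)| ≤ L := by
    rw [hL]; linarith [show 0 ≤ (Q : ℝ) * |Real.log k| by positivity]
  have hl2 : (Q : ℝ) * |Real.log k| ≤ L := by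
    rw [hL]; linarith [abs_nonneg (Real.log (2 * (k : ℝ) ^ 2))]
  have hQMf : 0 ≤ (Q : ℝ) * Mf := by positivity
  have hεn : 0 ≤ ε * n := by positivity
  rw [abs_le]
  constructor
  · -- lower bound
    have s1 := s16_subadd hσX hτ hMf n r (z : ℕ → Fin l)
    rw [s16_g_congr σX πs f n z y hzy, ← hg] at s1
    have s2 := s16_g_upper (σ := σX) hτ hMf r (fun i => (z : ℕ → Fin l) (i + n))
    have s3 : gfun X σX πs f p (z : ℕ → Fin l) ≤ g * ((k : ℝ) ^ r * Real.exp (r * Mf)) :=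
      s1.trans (mul_le_mul_of_nonneg_left s2 hg0.le)
    have s4 := Real.log_le_log (hgpos p z) s3
    rw [Real.log_mul hg0.ne' (by positivity), Real.log_mul (by positivity) (by positivity),
      Real.log_pow, Real.log_exp] at s4
    have s5 : (r : ℝ) * Mf ≤ Q * Mf := by gcongr
    have s6 : (r : ℝ) * Real.log k ≤ Q * |Real.log k| := by
      calc (r : ℝ) * Real.log k ≤ r * |Real.log k| := by gcongr; exact le_abs_self _
        _ ≤ _ := by gcongr
    linarith [hh1.1, hh1.2, hh2.1, hh2.2]
  · -- upper bound
    have s1 := Real.log_lt_log (by positivity) hab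
    rw [Real.log_div hg0.ne' (by positivity)] at s1
    rw [hωsum, Real.log_mul hSpos.ne' (Real.exp_pos _).ne', Real.log_exp] at hD1
    have s2 := le_abs_self (Real.log (2 * (k : ℝ) ^ 2))
    linarith [hh1.1, hh1.2, hh2.1, hh2.2]

theorem stmt16 {k l : ℕ}
    (X : Set (ℕ → Fin k)) (hX : IsSubshift X)
    (hSFT : IsSFT X) (hirr : IrreducibleSubshift X)
    (Y : Set (ℕ → Fin l)) (hY : IsSubshift Y)
    (σX : X → X) (hσX : ∀ x : X, (σX x : ℕ → Fin k) = shiftMap (x : ℕ → Fin k))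
    (σY : Y → Y) (hσY : ∀ y : Y, (σY y : ℕ → Fin l) = shiftMap (y : ℕ → Fin l))
    -- π is a one-block factor map
    (π : X → Y) (hπc : Continuous π) (hπs : Function.Surjective π)
    (hπcomm : ∀ x, π (σX x) = σY (π x))
    (hπ1 : ∃ τ : Fin k → Fin l, ∀ (x : X) (i : ℕ), (π x : ℕ → Fin l) i = τ ((x : ℕ → Fin k) i))
    (f : X → ℝ) (hf : Continuous f)
    (h : Y → ℝ) (hh : Continuous h) :
    ((∀ y : Y, (∃ p, 0 < p ∧ σY^[p] y = y) →
        Tendsto (fun n : ℕ => (1 / (n : ℝ)) *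
          Real.log (gfun X σX (fun z => ((π z : ℕ → Fin l))) f n (y : ℕ → Fin l) /
            Real.exp (birk σY h n y))) atTop (𝓝 0)) ↔
      (∀ y : Y,
        Tendsto (fun n : ℕ => (1 / (n : ℝ)) *
          Real.log (gfun X σX (fun z => ((π z : ℕ → Fin l))) f n (y : ℕ → Fin l) /
            Real.exp (birk σY h n y))) atTop (𝓝 0))) ∧
    ((∀ y : Y,
        Tendsto (fun n : ℕ => (1 / (n : ℝ)) *
          Real.log (gfun X σX (fun z => ((π z : ℕ → Fin l))) f n (y : ℕ → Fin l) /
            Real.exp (birk σY h n y))) atTop (𝓝 0)) ↔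
      Tendsto (fun n : ℕ => (1 / (n : ℝ)) *
        ⨆ y : Y, |Real.log (gfun X σX (fun z => ((π z : ℕ → Fin l))) f n (y : ℕ → Fin l) /
          Real.exp (birk σY h n y))|) atTop (𝓝 0)) := by
  obtain ⟨τ, hτ⟩ := hπ1
  have h13 : (∀ y : Y, (∃ p, 0 < p ∧ σY^[p] y = y) →
        Tendsto (fun n : ℕ => (1 / (n : ℝ)) *
          Real.log (gfun X σX (fun z => ((π z : ℕ → Fin l))) f n (y : ℕ → Fin l) /
            Real.exp (birk σY h n y))) atTop (𝓝 0)) →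
      Tendsto (fun n : ℕ => (1 / (n : ℝ)) *
        ⨆ y : Y, |Real.log (gfun X σX (fun z => ((π z : ℕ → Fin l))) f n (y : ℕ → Fin l) /
          Real.exp (birk σY h n y))|) atTop (𝓝 0) := by
    intro hper
    rw [Metric.tendsto_atTop]
    intro ε hε
    obtain ⟨C, hC0, hC⟩ := s16_main X hX hSFT hirr Y hY σX hσX σY hσY π hπs τ hτ f hf h hh hper
      (half_pos hε)
    obtain ⟨N, hN⟩ := exists_nat_gt (C / (ε / 2))
    refine ⟨N + 1, fun n hn => ?_⟩
    have hn0 : (0 : ℝ) < n := by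
      have : 0 < n := by omega
      exact_mod_cast this
    have hsup0 : 0 ≤ ⨆ y : Y,
        |Real.log (gfun X σX (fun z => ((π z : ℕ → Fin l))) f n (y : ℕ → Fin l) /
          Real.exp (birk σY h n y))| := Real.iSup_nonneg fun _ => abs_nonneg _
    have hsup : (⨆ y : Y,
        |Real.log (gfun X σX (fun z => ((π z : ℕ → Fin l))) f n (y : ℕ → Fin l) /
          Real.exp (birk σY h n y))|) ≤ ε / 2 * n + C :=
      Real.iSup_le (fun y => hC n y (by omega)) (by positivity)
    rw [Real.dist_eq, sub_zero, abs_of_nonneg (by positivity), one_div, inv_mul_eq_div,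
      div_lt_iff₀ hn0]
    rw [div_lt_iff₀ (half_pos hε)] at hN
    have hnN : (N : ℝ) + 1 ≤ n := by exact_mod_cast hn
    nlinarith
  have h32 : Tendsto (fun n : ℕ => (1 / (n : ℝ)) *
        ⨆ y : Y, |Real.log (gfun X σX (fun z => ((π z : ℕ → Fin l))) f n (y : ℕ → Fin l) /
          Real.exp (birk σY h n y))|) atTop (𝓝 0) →
      (∀ y : Y,
        Tendsto (fun n : ℕ => (1 / (n : ℝ)) *
          Real.log (gfun X σX (fun z => ((π z : ℕ → Fin l))) f n (y : ℕ → Fin l) /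
            Real.exp (birk σY h n y))) atTop (𝓝 0)) := by
    intro hlim y
    obtain ⟨Mf, hMf0, hMf⟩ := s16_bdd hX.1 hf
    obtain ⟨Mh, hMh0, hMh⟩ := s16_bdd hY.1 hh
    refine squeeze_zero_norm (fun n => ?_) hlim
    rw [norm_mul, Real.norm_eq_abs, Real.norm_eq_abs, abs_of_nonneg (by positivity)]
    refine mul_le_mul_of_nonneg_left ?_ (by positivity)
    refine le_ciSup (f := fun y : Y =>
      |Real.log (gfun X σX (fun z => ((π z : ℕ → Fin l))) f n (y : ℕ → Fin l) /
          Real.exp (birk σY h n y))|) ?_ y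
    refine ⟨n * Mf + |Real.log ((k : ℝ) ^ n)| + n * Mh, ?_⟩
    rintro _ ⟨y, rfl⟩
    obtain ⟨x, rfl⟩ := hπs y
    have hk : 0 < k := by
      have := ((x : ℕ → Fin k) 0).2
      omega
    have hk' : (0 : ℝ) < k := by exact_mod_cast hk
    have h1 := s16_g_lower (σ := σX) (πs := fun z => ((π z : ℕ → Fin l))) hτ hMf n x
    have h2 := s16_g_upper (σ := σX) (πs := fun z => ((π z : ℕ → Fin l))) hτ hMf n (π x)
    have hpos := (Real.exp_pos _).trans_le h1
    have h1' := Real.log_le_log (Real.exp_pos _) h1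
    have h2' := Real.log_le_log hpos h2
    rw [Real.log_exp] at h1'
    rw [Real.log_mul (by positivity) (by positivity), Real.log_exp] at h2'
    have h3 := abs_le.1 (s16_birk_abs σY h Mh hMh n (π x))
    have h4 := le_abs_self (Real.log ((k : ℝ) ^ n))
    have h5 := abs_nonneg (Real.log ((k : ℝ) ^ n))
    simp only
    rw [Real.log_div hpos.ne' (Real.exp_pos _).ne', Real.log_exp, abs_le]
    constructor <;> linarith [h3.1, h3.2]
  exact ⟨⟨fun h1 => h32 (h13 h1), fun h2 y _ => h2 y⟩, ⟨fun h2 => h13 fun y _ => h2 y, h32⟩⟩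
end
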